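/- arXiv:1407.5029 — 3 statements merged into one kernel-verified Lean document; each statement's English description precedes it below -/
import Mathlib

section
/- Let Ω be a planar Jordan domain and suppose that Σ(Ω,φ) is linearly locally connected for every φ in the class F. Then Ω has the level quasicircle property. -/
open Metric Set MeasureTheory

noncomputable section

/-- The Euclidean plane. -/
abbrev E2 : Type := EuclideanSpace ℝ (Fin 2)
/-- Euclidean three-space. -/
abbrev E3 : Type := EuclideanSpace ℝ (Fin 3)

/-- Build a point of ℝ³ from a planar point and a height. -/
def mk3 (x : E2) (z : ℝ) : E3 := (WithLp.equiv 2 (Fin 3 → ℝ)).symm ![x 0, x 1, z]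

/-- A Jordan curve: the image of the unit circle under a continuous injection
(equivalently, a topological embedding, by compactness of the circle). -/
def IsJordanCurve (Γ : Set E2) : Prop :=
  ∃ f : E2 → E2, ContinuousOn f (sphere 0 1) ∧ InjOn f (sphere 0 1) ∧ f '' (sphere 0 1) = Γ

/-- A Jordan domain: a bounded domain whose boundary is a Jordan curve. -/
def IsJordanDomain (Ω : Set E2) : Prop :=
  IsOpen Ω ∧ IsConnected Ω ∧ Bornology.IsBounded Ω ∧ IsJordanCurve (frontier Ω)

/-- The ε-level set γ_ε = {x ∈ Ω : dist(x,∂Ω) = ε}, with the convention γ₀ = ∂Ω. -/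
def levelSet (Ω : Set E2) (ε : ℝ) : Set E2 :=
  if ε = 0 then frontier Ω else {x ∈ Ω | infDist x (frontier Ω) = ε}

/-- The double-dome-like surface Σ(Ω,φ). -/
def domeSurface (Ω : Set E2) (φ : ℝ → ℝ) : Set E3 :=
  {p | ∃ x ∈ closure Ω, p = mk3 x (φ (infDist x (frontier Ω))) ∨
                        p = mk3 x (-φ (infDist x (frontier Ω)))}

/-- The class 𝓕 of gauges: homeomorphisms φ of [0,∞) onto [0,∞) with φ(0)=0,
liminf_{t→0} φ(t)/t > 0, and φ Lipschitz on [r,∞) for every r > 0. -/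
structure GaugeF (φ : ℝ → ℝ) : Prop where
  continuousOn : ContinuousOn φ (Ici 0)
  strictMonoOn : StrictMonoOn φ (Ici 0)
  surjOn : SurjOn φ (Ici 0) (Ici 0)
  map_zero : φ 0 = 0
  liminf_pos : ∃ m > (0:ℝ), ∀ᶠ t in nhdsWithin 0 (Ioi 0), m * t ≤ φ t
  lipschitzOn : ∀ r > (0:ℝ), ∃ L : NNReal, LipschitzOnWith L φ (Ici r)

/-- A subarc of Γ with endpoints x and y: a subset of Γ that is a simple arc from x to y. -/
def IsSubarc (Γ A : Set E2) (x y : E2) : Prop :=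
  A ⊆ Γ ∧ ∃ f : ℝ → E2, ContinuousOn f (Icc 0 1) ∧ InjOn f (Icc 0 1) ∧
    f 0 = x ∧ f 1 = y ∧ f '' (Icc 0 1) = A

/-- The 2-point condition with constant C: for any two points of Γ, some subarc joining
them (hence the one of smaller diameter) has diameter at most C·|x−y|. -/
def TwoPointCondition (Γ : Set E2) (C : ℝ) : Prop :=
  ∀ x ∈ Γ, ∀ y ∈ Γ, x ≠ y →
    ∃ A, IsSubarc Γ A x y ∧ Metric.diam A ≤ C * dist x y

/-- A c-chord-arc curve: a rectifiable Jordan curve such that for any two points, the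
shorter subarc joining them has length (1-dimensional Hausdorff measure) at most c·|x−y|. -/
def IsChordArc (Γ : Set E2) (c : ℝ) : Prop :=
  IsJordanCurve Γ ∧ μH[1] Γ < ⊤ ∧
  ∀ x ∈ Γ, ∀ y ∈ Γ, x ≠ y →
    ∃ A, IsSubarc Γ A x y ∧ μH[1] A ≤ ENNReal.ofReal (c * dist x y)

/-- The λ-LLC₁ condition. -/
def LLC1With {X : Type*} [MetricSpace X] (S : Set X) (lam : ℝ) : Prop :=
  ∀ x ∈ S, ∀ r > (0:ℝ), ∀ y₁ ∈ ball x r ∩ S, ∀ y₂ ∈ ball x r ∩ S,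
    ∃ E ⊆ ball x (lam * r) ∩ S, IsCompact E ∧ IsConnected E ∧ y₁ ∈ E ∧ y₂ ∈ E

/-- The λ-LLC₂ condition. -/
def LLC2With {X : Type*} [MetricSpace X] (S : Set X) (lam : ℝ) : Prop :=
  ∀ x ∈ S, ∀ r > (0:ℝ), ∀ y₁ ∈ S \ ball x r, ∀ y₂ ∈ S \ ball x r,
    ∃ E ⊆ S \ ball x (r / lam), IsCompact E ∧ IsConnected E ∧ y₁ ∈ E ∧ y₂ ∈ E

/-- λ-linear local connectivity. -/
def LLCWith {X : Type*} [MetricSpace X] (S : Set X) (lam : ℝ) : Prop :=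
  LLC1With S lam ∧ LLC2With S lam

/-- S (with the Euclidean metric of ℝ³) is quasisymmetric to the unit sphere S²:
there are a homeomorphism η of [0,∞) onto itself and an η-quasisymmetric
homeomorphism of S onto the unit sphere. -/
def QSEquivSphere (S : Set E3) : Prop :=
  ∃ η : ℝ → ℝ, (ContinuousOn η (Ici 0) ∧ StrictMonoOn η (Ici 0) ∧ SurjOn η (Ici 0) (Ici 0)) ∧
  ∃ f : S → (sphere (0:E3) 1 : Set E3), Function.Bijective f ∧
    ∀ (x a b : S) (t : ℝ), 0 < t → dist (x:E3) a ≤ t * dist (x:E3) b →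
      dist (f x : E3) (f a) ≤ η t * dist (f x : E3) (f b)

/-- The level chord-arc property. -/
def LevelChordArc (Ω : Set E2) : Prop :=
  ∃ ε₀ > (0:ℝ), ∃ c > (1:ℝ), ∀ ε, 0 ≤ ε → ε ≤ ε₀ → IsChordArc (levelSet Ω ε) c

/-- The level quasicircle property. -/
def LevelQuasicircle (Ω : Set E2) : Prop :=
  ∃ ε₀ > (0:ℝ), ∃ C > (1:ℝ), ∀ ε, 0 ≤ ε → ε ≤ ε₀ →
    IsJordanCurve (levelSet Ω ε) ∧ TwoPointCondition (levelSet Ω ε) C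


/-- A decreasing limit of continua joining two points is a continuum joining them. -/
theorem exists_continuum_of_forall_sublevel {M : Type*} [MetricSpace M] {B : Set M}
    (hB : IsCompact B) {F : M → ℝ} (hF : Continuous F) {x y : M}
    (h : ∀ η > 0, ∃ S ⊆ B ∩ {z | F z ≤ η}, IsPreconnected S ∧ x ∈ S ∧ y ∈ S) :
    ∃ S ⊆ B ∩ {z | F z ≤ 0}, IsCompact S ∧ IsPreconnected S ∧ x ∈ S ∧ y ∈ S := by
  set u : ℕ → ℝ := fun n => 1 / ((n : ℝ) + 1) with hu
  have hupos : ∀ n, 0 < u n := fun n => by simp only [hu]; positivity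
  have hanti : Antitone u := fun m n hmn => by
    simp only [hu]
    exact one_div_le_one_div_of_le (by positivity) (by exact_mod_cast Nat.succ_le_succ hmn)
  set K : ℕ → Set M := fun n => B ∩ {z | F z ≤ u n} with hK
  have hKc : ∀ n, IsCompact (K n) := fun n =>
    hB.inter_right (isClosed_le hF continuous_const)
  set C : ℕ → Set M := fun n => connectedComponentIn (K n) x with hC
  have hCS : ∀ n, x ∈ C n ∧ y ∈ C n := fun n => by
    obtain ⟨S, hS, hSc, hx, hy⟩ := h (u n) (hupos n)
    have := hSc.subset_connectedComponentIn hx hS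
    exact ⟨this hx, this hy⟩
  have hCK : ∀ n, C n ⊆ K n := fun n => connectedComponentIn_subset _ _
  have hCpre : ∀ n, IsPreconnected (C n) := fun n => isPreconnected_connectedComponentIn
  have hCcl : ∀ n, IsClosed (C n) := fun n => by
    refine isClosed_of_closure_subset ?_
    exact ((hCpre n).closure).subset_connectedComponentIn (subset_closure (hCS n).1)
      (closure_minimal (hCK n) (hKc n).isClosed)
  have hCc : ∀ n, IsCompact (C n) := fun n => (hKc n).of_isClosed_subset (hCcl n) (hCK n)
  have hCanti : Antitone C := fun m n hmn => by
    refine connectedComponentIn_mono _ ?_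
    exact fun z hz => ⟨hz.1, le_trans hz.2 (hanti hmn)⟩
  have hdir : Directed (· ⊇ ·) C := hCanti.directed_ge
  have hEc : IsCompact (⋂ n, C n) := (hCc 0).of_isClosed_subset (isClosed_iInter hCcl) (iInter_subset _ 0)
  refine ⟨⋂ n, C n, ?_, hEc, ?_, mem_iInter.2 fun n => (hCS n).1, mem_iInter.2 fun n => (hCS n).2⟩
  · intro z hz
    rw [mem_iInter] at hz
    refine ⟨(hCK 0 (hz 0)).1, ?_⟩
    refine ge_of_tendsto' (tendsto_one_div_add_atTop_nhds_zero_nat (𝕜 := ℝ)) fun n => ?_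
    exact (hCK n (hz n)).2
  · rw [isPreconnected_closed_iff]
    intro t t' ht ht' hsub hnt hnt'
    by_contra hne
    rw [not_nonempty_iff_eq_empty] at hne
    have hdisj : Disjoint ((⋂ n, C n) ∩ t) ((⋂ n, C n) ∩ t') := by
      rw [disjoint_iff_inter_eq_empty, ← hne]
      ext z; simp only [mem_inter_iff]; tauto
    obtain ⟨U, V, hU, hV, hAU, hAV, hUV⟩ :=
      SeparatedNhds.of_isCompact_isCompact (hEc.inter_right ht) (hEc.inter_right ht') hdisj
    obtain ⟨n, hn⟩ := exists_subset_nhds_of_isCompact hdir hCc (U := U ∪ V) (fun z hz =>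
      (hU.union hV).mem_nhds ((hsub hz).imp (fun h => hAU ⟨hz, h⟩) (fun h => hAV ⟨hz, h⟩)))
    obtain ⟨a, ha⟩ := hnt
    obtain ⟨b, hb⟩ := hnt'
    obtain ⟨z, -, hz⟩ := hCpre n U V hU hV hn ⟨a, mem_iInter.1 ha.1 n, hAU ha⟩
      ⟨b, mem_iInter.1 hb.1 n, hAV hb⟩
    exact hUV.le_bot hz

/-- The plane vector with the coordinates of a complex number. -/
def planeOfComplex (z : ℂ) : E2 := !₂[z.re, z.im]

/-- The unit circle of `ℂ` and the unit sphere of the plane are homeomorphic. -/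
def circleHomeoSphere : Circle ≃ₜ sphere (0 : E2) 1 where
  toFun z := ⟨planeOfComplex z, by
    have h := Circle.norm_coe z
    rw [Complex.norm_def, Real.sqrt_eq_one, Complex.normSq_apply] at h
    simp [planeOfComplex, EuclideanSpace.norm_eq, Fin.sum_univ_two]
    nlinarith⟩
  invFun v := ⟨⟨v.1 0, v.1 1⟩, by
    have h := v.2
    simp only [mem_sphere_iff_norm, sub_zero, EuclideanSpace.norm_eq, Fin.sum_univ_two,
      Real.norm_eq_abs, sq_abs, Real.sqrt_eq_one] at h
    change _ ∈ sphere (0 : ℂ) 1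
    rw [mem_sphere_zero_iff_norm, Complex.norm_def, Real.sqrt_eq_one, Complex.normSq_apply]
    nlinarith⟩
  left_inv z := by
    ext
    simp [planeOfComplex]
  right_inv v := by
    apply Subtype.ext
    ext i
    fin_cases i <;> simp [planeOfComplex]
  continuous_toFun := by
    refine Continuous.subtype_mk ?_ _
    unfold planeOfComplex
    refine (PiLp.continuous_toLp 2 _).comp (continuous_pi fun i => ?_)
    fin_cases i
    · exact Complex.continuous_re.comp continuous_subtype_val
    · exact Complex.continuous_im.comp continuous_subtype_val
  continuous_invFun := by
    refine Continuous.subtype_mk ?_ _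
    have : Continuous fun v : sphere (0 : E2) 1 =>
        ((v.1 0 : ℝ) : ℂ) + ((v.1 1 : ℝ) : ℂ) * Complex.I := by fun_prop
    refine this.congr fun v => ?_
    apply Complex.ext <;> simp

theorem isJordanCurve_range {p : ℝ} (hp : 0 < p) {f : AddCircle p → E2} (hf : Continuous f)
    (hi : Function.Injective f) : IsJordanCurve (range f) := by
  classical
  set e : sphere (0 : E2) 1 ≃ₜ AddCircle p :=
    circleHomeoSphere.symm.trans (AddCircle.homeomorphCircle hp.ne').symm
  refine ⟨fun v => if hv : v ∈ sphere (0 : E2) 1 then f (e ⟨v, hv⟩) else 0, ?_, ?_, ?_⟩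
  · rw [continuousOn_iff_continuous_domRestrict]
    refine (hf.comp e.continuous).congr fun v => ?_
    simp only [domRestrict_apply, dif_pos v.2, Function.comp]
  · intro v hv w hw hvw
    simp only [dif_pos hv, dif_pos hw] at hvw
    simpa using e.injective (hi hvw)
  · ext z
    constructor
    · rintro ⟨v, hv, rfl⟩
      simp only [dif_pos hv]
      exact mem_range_self _
    · rintro ⟨θ, rfl⟩
      refine ⟨(e.symm θ).1, (e.symm θ).2, ?_⟩
      simp only [dif_pos (e.symm θ).2]
      simp

theorem IsJordanCurve.exists_param {Γ : Set E2} (h : IsJordanCurve Γ) :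
    ∃ G : ℝ → E2, Continuous G ∧ range G = Γ ∧ (∀ t, G (t + 1) = G t) ∧
      ∀ s t, |s - t| < 1 → G s = G t → s = t := by
  obtain ⟨f, hf, hi, rfl⟩ := h
  set e : AddCircle (1 : ℝ) ≃ₜ sphere (0 : E2) 1 :=
    (AddCircle.homeomorphCircle one_ne_zero).trans circleHomeoSphere
  refine ⟨fun t => f (e t), ?_, ?_, ?_, ?_⟩
  · rw [continuousOn_iff_continuous_domRestrict] at hf
    exact (hf.comp e.continuous).comp (AddCircle.continuous_mk' 1)
  · ext z
    constructor
    · rintro ⟨t, rfl⟩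
      exact ⟨_, (e t).2, rfl⟩
    · rintro ⟨v, hv, rfl⟩
      obtain ⟨t, ht⟩ := QuotientAddGroup.mk_surjective (e.symm ⟨v, hv⟩)
      refine ⟨t, ?_⟩
      have : (t : AddCircle (1 : ℝ)) = e.symm ⟨v, hv⟩ := ht
      simp only [this, Homeomorph.apply_symm_apply]
  · intro t
    simp only [AddCircle.coe_add_period]
  · intro s t hst hG
    have h1 := e.injective (Subtype.ext (hi (e s).2 (e t).2 hG))
    rw [← sub_eq_zero, ← AddCircle.coe_sub, AddCircle.coe_eq_zero_iff] at h1
    obtain ⟨n, hn⟩ := h1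
    rw [zsmul_eq_mul, mul_one] at hn
    rw [← hn] at hst
    have : n = 0 := by
      have : |n| < 1 := by exact_mod_cast hst
      exact Int.abs_lt_one_iff.1 this
    rw [this] at hn
    push_cast at hn
    linarith

/-- Joining condition: any two points of `X` lie in a connected subset of `X` of size comparable
to their distance. -/
def BoundedTurning (X : Set E2) (C : ℝ) : Prop :=
  ∀ x ∈ X, ∀ y ∈ X, ∃ S ⊆ X ∩ closedBall x (C * dist x y), IsPreconnected S ∧ x ∈ S ∧ y ∈ S

/-- The affine reparametrisation of an injective path is a subarc. -/
theorem isSubarc_of_affine {Γ : Set E2} {G : ℝ → E2} (hG : Continuous G) (hΓ : range G = Γ)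
    {s k : ℝ} (hk : k ≠ 0) (hi : ∀ a ∈ Icc (0 : ℝ) 1, ∀ b ∈ Icc (0 : ℝ) 1,
      G (s + k * a) = G (s + k * b) → s + k * a = s + k * b) :
    IsSubarc Γ ((fun t => G (s + k * t)) '' Icc 0 1) (G s) (G (s + k)) := by
  refine ⟨?_, fun t => G (s + k * t), ?_, ?_, by simp, by simp, rfl⟩
  · rintro _ ⟨t, -, rfl⟩
    exact hΓ ▸ mem_range_self _
  · exact (hG.comp (by fun_prop)).continuousOn
  · intro a ha b hb hab
    have := hi a ha b hb hab
    exact mul_left_cancel₀ hk (by linarith)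

/-- A connected subset of a Jordan curve contains a subarc between any two of its points. -/
theorem IsJordanCurve.exists_isSubarc_subset {Γ : Set E2} (hJ : IsJordanCurve Γ) {S : Set E2}
    (hS : S ⊆ Γ) (hSc : IsPreconnected S) {x y : E2} (hx : x ∈ S) (hy : y ∈ S) (hxy : x ≠ y) :
    ∃ A ⊆ S, IsSubarc Γ A x y := by
  obtain ⟨G, hG, hΓ, hper, hinj⟩ := hJ.exists_param
  obtain ⟨s, rfl⟩ : x ∈ range G := hΓ ▸ hS hx
  obtain ⟨t, rfl, hst, hts⟩ : ∃ t, G t = y ∧ s < t ∧ t < s + 1 := by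
    obtain ⟨t₀, ht₀⟩ : y ∈ range G := hΓ ▸ hS hy
    have hP : Function.Periodic G 1 := hper
    obtain ⟨t, ht, htt⟩ := hP.exists_mem_Ico one_pos t₀ s
    refine ⟨t, by rw [← htt, ht₀], lt_of_le_of_ne ht.1 ?_, ht.2⟩
    rintro rfl
    exact hxy (by rw [← htt, ht₀])
  by_cases h1 : (fun r => G (s + (t - s) * r)) '' Icc 0 1 ⊆ S
  · refine ⟨_, h1, ?_⟩
    have := isSubarc_of_affine hG hΓ (s := s) (k := t - s) (by linarith) (fun a ha b hb hab =>
      hinj _ _ (by rw [abs_lt]; constructor <;> nlinarith [ha.1, ha.2, hb.1, hb.2]) hab)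
    simpa using this
  by_cases h2 : (fun r => G (s + 1 + (t - (s + 1)) * r)) '' Icc 0 1 ⊆ S
  · refine ⟨_, h2, ?_⟩
    have := isSubarc_of_affine hG hΓ (s := s + 1) (k := t - (s + 1)) (by linarith)
      (fun a ha b hb hab =>
        hinj _ _ (by rw [abs_lt]; constructor <;> nlinarith [ha.1, ha.2, hb.1, hb.2]) hab)
    simpa [hper] using this
  exfalso
  obtain ⟨_, ⟨a', ha', rfl⟩, haS⟩ := not_subset.1 h1
  obtain ⟨_, ⟨b', hb', rfl⟩, hbS⟩ := not_subset.1 h2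
  obtain ⟨a, ha⟩ : ∃ a, a = s + (t - s) * a' := ⟨_, rfl⟩
  obtain ⟨b, hb⟩ : ∃ b, b = s + 1 + (t - (s + 1)) * b' := ⟨_, rfl⟩
  simp only [← ha] at haS
  simp only [← hb] at hbS
  have has : s < a := lt_of_le_of_ne (by nlinarith [ha'.1]) (by rintro rfl; exact haS hx)
  have hat : a < t := lt_of_le_of_ne (by nlinarith [ha'.2]) (by rintro rfl; exact haS hy)
  have hbt : t < b := lt_of_le_of_ne (by nlinarith [hb'.2]) (by rintro rfl; exact hbS hy)
  have hbs : b < s + 1 := lt_of_le_of_ne (by nlinarith [hb'.1])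
    (by rintro rfl; exact hbS (by rwa [hper]))
  obtain ⟨z, hz, ⟨c, hc, hcz⟩, ⟨d, hd, hdz⟩⟩ := isPreconnected_closed_iff.1 hSc
    (G '' Icc a b) (G '' Icc b (a + 1))
    (isCompact_Icc.image hG).isClosed (isCompact_Icc.image hG).isClosed (by
      intro z hz
      have hP : Function.Periodic G 1 := hper
      obtain ⟨r₀, hr₀⟩ : z ∈ range G := hΓ ▸ hS hz
      obtain ⟨r, hr, hrr⟩ := hP.exists_mem_Ico one_pos r₀ a
      have hrz : G r = z := by rw [← hrr, hr₀]
      rcases le_total r b with hrb | hrb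
      · exact Or.inl ⟨r, ⟨hr.1, hrb⟩, hrz⟩
      · exact Or.inr ⟨r, ⟨hrb, hr.2.le⟩, hrz⟩)
    ⟨G t, hy, t, ⟨hat.le, hbt.le⟩, rfl⟩ ⟨G s, hx, s + 1, ⟨hbs.le, by linarith⟩, hper s⟩
  rcases eq_or_lt_of_le hc.1 with rfl | hac
  · exact haS (hcz ▸ hz)
  · have : c = d := hinj c d (by rw [abs_lt]; constructor <;> linarith [hc.2, hd.1, hd.2])
      (hcz.trans hdz.symm)
    have hcb : c = b := le_antisymm hc.2 (this ▸ hd.1)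
    exact hbS (by rw [← hcb, hcz]; exact hz)

theorem BoundedTurning.twoPointCondition {Γ : Set E2} {C : ℝ} (h : BoundedTurning Γ C)
    (hJ : IsJordanCurve Γ) : TwoPointCondition Γ (2 * C) := by
  intro x hx y hy hxy
  obtain ⟨S, hS, hSc, hxS, hyS⟩ := h x hx y hy
  obtain ⟨A, hAS, hA⟩ := hJ.exists_isSubarc_subset (fun z hz => (hS hz).1) hSc hxS hyS hxy
  refine ⟨A, hA, ?_⟩
  have h0 : 0 ≤ C * dist x y := by simpa using (hS hxS).2
  have := diam_le_of_subset_closedBall h0 (fun z hz => (hS (hAS hz)).2)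
  linarith

/-- `c` parametrises by `[-r, r]` a piece of `X` containing `X ∩ W`, with inverse `π`. -/
structure IsArcChart {M : Type*} [MetricSpace M] (X : Set M) (π : M → ℝ) (c : ℝ → M) (W : Set M)
    (r : ℝ) : Prop where
  pos : 0 < r
  continuous_coord : Continuous π
  continuousOn : ContinuousOn c (Icc (-r) r)
  mem : ∀ t ∈ Icc (-r) r, c t ∈ X
  coord_apply : ∀ t ∈ Icc (-r) r, π (c t) = t
  isOpen : IsOpen W
  coord_mem : ∀ y ∈ X ∩ W, π y ∈ Ioo (-r) r
  apply_coord : ∀ y ∈ X ∩ W, c (π y) = y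

namespace IsArcChart

variable {M : Type*} [MetricSpace M] {X : Set M} {π : M → ℝ} {c : ℝ → M} {W : Set M} {r : ℝ}

theorem flip (h : IsArcChart X π c W r) :
    IsArcChart X (fun y => -π y) (fun t => c (-t)) W r where
  pos := h.pos
  continuous_coord := h.continuous_coord.neg
  continuousOn := h.continuousOn.comp continuous_neg.continuousOn fun t ht =>
    ⟨by linarith [ht.2], by linarith [ht.1]⟩
  mem t ht := h.mem _ ⟨by linarith [ht.2], by linarith [ht.1]⟩
  coord_apply t ht := by
    have := h.coord_apply (-t) ⟨by linarith [ht.2], by linarith [ht.1]⟩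
    simp only [this, neg_neg]
  isOpen := h.isOpen
  coord_mem y hy := ⟨by linarith [(h.coord_mem y hy).2], by linarith [(h.coord_mem y hy).1]⟩
  apply_coord y hy := by simp only [neg_neg, h.apply_coord y hy]

theorem injOn (h : IsArcChart X π c W r) : InjOn c (Icc (-r) r) := fun s hs t ht hst => by
  rw [← h.coord_apply s hs, ← h.coord_apply t ht, hst]

theorem exists_extension_of_coord_lt (h : IsArcChart X π c W r) {α : ℝ → M} {a d : ℝ}
    (ha : a ≤ -d) (hd : 0 < d) (hα : ContinuousOn α (Icc a 0)) (hi : InjOn α (Icc a 0))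
    (hX : α 0 ∈ X) (hW : α 0 ∈ W) (hlt : ∀ t ∈ Ico (-d) 0, π (α t) < π (α 0)) :
    ∃ b > 0, ∃ β : ℝ → M, ContinuousOn β (Icc 0 b) ∧ InjOn β (Icc 0 b) ∧
      (∀ t ∈ Icc 0 b, β t ∈ X) ∧ β 0 = α 0 ∧ β b = c r ∧
      ∃ δ > 0, ∀ s ∈ Ioo 0 δ, s ≤ b → β s ∉ α '' Icc a 0 := by
  obtain ⟨h1, h2⟩ := h.coord_mem _ ⟨hX, hW⟩
  set p := π (α 0) with hp
  have hmaps : ∀ s ∈ Icc 0 (r - p), p + s ∈ Icc (-r) r := fun s hs =>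
    ⟨by linarith [hs.1], by linarith [hs.2]⟩
  have hβ : ContinuousOn (fun s => c (p + s)) (Icc 0 (r - p)) :=
    h.continuousOn.comp (by fun_prop) hmaps
  have hβ0 : c (p + 0) = α 0 := by rw [add_zero, h.apply_coord _ ⟨hX, hW⟩]
  refine ⟨r - p, by linarith, fun s => c (p + s), hβ, ?_, fun t ht => h.mem _ (hmaps t ht),
    hβ0, by ring_nf, ?_⟩
  · intro s hs t ht hst
    have := h.injOn (hmaps s hs) (hmaps t ht) hst
    linarith
  · have hcl : IsClosed (α '' Icc a (-d)) :=
      (isCompact_Icc.image_of_continuousOn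
        (hα.mono (Icc_subset_Icc_right (by linarith)))).isClosed
    have hnot : c (p + 0) ∈ (α '' Icc a (-d))ᶜ := by
      rw [hβ0]
      rintro ⟨t, ht, htz⟩
      have := hi ⟨ht.1, by linarith [ht.2]⟩ ⟨by linarith, le_rfl⟩ htz
      linarith [ht.2]
    have hev := (hβ 0 ⟨le_rfl, by linarith⟩).preimage_mem_nhdsWithin (hcl.isOpen_compl.mem_nhds hnot)
    obtain ⟨δ, hδ, hδs⟩ := Metric.mem_nhdsWithin_iff.1 hev
    refine ⟨δ, hδ, fun s hs hsb => ?_⟩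
    rintro ⟨t, ht, hts⟩
    rcases le_or_gt t (-d) with htd | htd
    · refine hδs ⟨?_, hs.1.le, hsb⟩ ⟨t, ⟨ht.1, htd⟩, hts⟩
      rw [mem_ball, Real.dist_eq, sub_zero, abs_of_pos hs.1]
      exact hs.2
    · have h3 : π (α t) = p + s := by
        rw [hts, h.coord_apply _ (hmaps s ⟨hs.1.le, hsb⟩)]
      rcases eq_or_lt_of_le ht.2 with h0 | h0
      · rw [h0] at h3
        linarith [hs.1]
      · linarith [hlt t ⟨htd.le, h0⟩, hs.1]

theorem exists_extension (h : IsArcChart X π c W r) {α : ℝ → M} {a : ℝ}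
    (ha : a < 0) (hα : ContinuousOn α (Icc a 0)) (hi : InjOn α (Icc a 0))
    (hX : ∀ t ∈ Icc a 0, α t ∈ X) (hW : α 0 ∈ W) :
    ∃ b > 0, ∃ β : ℝ → M, ContinuousOn β (Icc 0 b) ∧ InjOn β (Icc 0 b) ∧
      (∀ t ∈ Icc 0 b, β t ∈ X) ∧ β 0 = α 0 ∧ (β b = c r ∨ β b = c (-r)) ∧
      ∃ δ > 0, ∀ s ∈ Ioo 0 δ, s ≤ b → β s ∉ α '' Icc a 0 := by
  have hev := (hα 0 ⟨ha.le, le_rfl⟩).preimage_mem_nhdsWithin (h.isOpen.mem_nhds hW)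
  obtain ⟨e, he, hes⟩ := Metric.mem_nhdsWithin_iff.1 hev
  obtain ⟨d, hd, hda, hde⟩ : ∃ d > 0, a ≤ -d ∧ d < e :=
    ⟨min (e / 2) (-a), lt_min (by linarith) (by linarith),
      by linarith [min_le_right (e / 2) (-a)], by linarith [min_le_left (e / 2) (-a)]⟩
  have hsub : Icc (-d) 0 ⊆ Icc a 0 := Icc_subset_Icc_left hda
  have hXW : ∀ t ∈ Icc (-d) 0, α t ∈ X ∩ W := fun t ht => by
    refine ⟨hX t (hsub ht), hes ⟨?_, hsub ht⟩⟩
    rw [mem_ball, Real.dist_eq, sub_zero, abs_of_nonpos ht.2]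
    linarith [ht.1]
  have hinj : InjOn (fun t => π (α t)) (Icc (-d) 0) := fun s hs t ht hst => by
    refine hi (hsub hs) (hsub ht) ?_
    rw [← h.apply_coord _ (hXW s hs), ← h.apply_coord _ (hXW t ht)]
    exact congrArg c hst
  have h0 : (0 : ℝ) ∈ Icc (-d) 0 := ⟨by linarith, le_rfl⟩
  rcases (h.continuous_coord.comp_continuousOn (hα.mono hsub)).strictMonoOn_of_injOn_Icc'
    (by linarith) hinj with hm | hm
  · obtain ⟨b, hb, β, h1, h2, h3, h4, h5, h6⟩ := h.exists_extension_of_coord_lt hda hd hα hi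
      (hXW 0 h0).1 hW fun t ht => hm ⟨ht.1, ht.2.le⟩ h0 ht.2
    exact ⟨b, hb, β, h1, h2, h3, h4, Or.inl h5, h6⟩
  · obtain ⟨b, hb, β, h1, h2, h3, h4, h5, h6⟩ := h.flip.exists_extension_of_coord_lt hda hd hα hi
      (hXW 0 h0).1 hW fun t ht => neg_lt_neg (hm ⟨ht.1, ht.2.le⟩ h0 ht.2)
    exact ⟨b, hb, β, h1, h2, h3, h4, Or.inr h5, h6⟩

/-- A Jordan curve inside `X` contains a neighbourhood in `X` of each of its points covered by a
chart. -/
theorem exists_nhds_subset_image (h : IsArcChart X π c W r) {G : ℝ → M} {t₀ ρ : ℝ} (hρ : 0 < ρ)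
    (hG : Continuous G) (hi : InjOn G (Icc (t₀ - ρ) (t₀ + ρ))) (hX : ∀ t, G t ∈ X)
    (hW : G t₀ ∈ W) : ∃ N, IsOpen N ∧ G t₀ ∈ N ∧ X ∩ N ⊆ range G := by
  obtain ⟨e, he, hes⟩ := Metric.isOpen_iff.1 (h.isOpen.preimage hG) t₀ hW
  obtain ⟨d, hd, hdρ, hde⟩ : ∃ d > 0, d ≤ ρ ∧ d < e :=
    ⟨min (e / 2) ρ, lt_min (by linarith) hρ, min_le_right _ _,
      by linarith [min_le_left (e / 2) ρ]⟩
  have hXW : ∀ t ∈ Icc (t₀ - d) (t₀ + d), G t ∈ X ∩ W := fun t ht => by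
    refine ⟨hX t, hes ?_⟩
    rw [mem_ball, Real.dist_eq, abs_lt]
    constructor <;> linarith [ht.1, ht.2]
  have hinj : InjOn (fun t => π (G t)) (Icc (t₀ - d) (t₀ + d)) := fun s hs t ht hst => by
    refine hi ⟨by linarith [hs.1], by linarith [hs.2]⟩ ⟨by linarith [ht.1], by linarith [ht.2]⟩ ?_
    rw [← h.apply_coord _ (hXW s hs), ← h.apply_coord _ (hXW t ht)]
    exact congrArg c hst
  have hc : ContinuousOn (fun t => π (G t)) (Icc (t₀ - d) (t₀ + d)) :=
    (h.continuous_coord.comp hG).continuousOn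
  have key : ∀ u v, u < π (G t₀) → π (G t₀) < v →
      Icc u v ⊆ (fun t => π (G t)) '' Icc (t₀ - d) (t₀ + d) →
      ∃ N, IsOpen N ∧ G t₀ ∈ N ∧ X ∩ N ⊆ range G := by
    intro u v hu hv huv
    refine ⟨W ∩ π ⁻¹' Ioo u v, h.isOpen.inter (isOpen_Ioo.preimage h.continuous_coord),
      ⟨hW, hu, hv⟩, ?_⟩
    rintro y ⟨hyX, hyW, hyu⟩
    obtain ⟨t, ht, hty⟩ := huv (Ioo_subset_Icc_self hyu)
    refine ⟨t, ?_⟩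
    rw [← h.apply_coord _ (hXW t ht), ← h.apply_coord _ ⟨hyX, hyW⟩]
    exact congrArg c hty
  have m1 : t₀ - d ∈ Icc (t₀ - d) (t₀ + d) := ⟨le_rfl, by linarith⟩
  have m2 : t₀ ∈ Icc (t₀ - d) (t₀ + d) := ⟨by linarith, by linarith⟩
  have m3 : t₀ + d ∈ Icc (t₀ - d) (t₀ + d) := ⟨by linarith, le_rfl⟩
  rcases hc.strictMonoOn_of_injOn_Icc' (by linarith) hinj with hm | hm
  · exact key _ _ (hm m1 m2 (by linarith)) (hm m2 m3 (by linarith))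
      (intermediate_value_Icc (by linarith) hc)
  · exact key _ _ (hm m2 m3 (by linarith)) (hm m1 m2 (by linarith))
      (intermediate_value_Icc' (by linarith) hc)

end IsArcChart

section Gluing

variable {M : Type*} {α β : ℝ → M} {a b : ℝ}

theorem continuousOn_glue [TopologicalSpace M] (ha : a ≤ 0) (hb : 0 ≤ b)
    (hα : ContinuousOn α (Icc a 0)) (hβ : ContinuousOn β (Icc 0 b)) (h0 : β 0 = α 0) :
    ContinuousOn (fun t => if t ≤ 0 then α t else β t) (Icc a b) := by
  rw [← Icc_union_Icc_eq_Icc ha hb]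
  refine ContinuousOn.union_of_isClosed ?_ ?_ isClosed_Icc isClosed_Icc
  · exact hα.congr fun t ht => if_pos ht.2
  · refine hβ.congr fun t ht => ?_
    rcases eq_or_lt_of_le ht.1 with h | h
    · simp [← h, h0]
    · exact if_neg (not_le.2 h)

theorem injOn_glue {J : Set ℝ} (hJ : J ⊆ Ioi 0) (hα : InjOn α (Icc a 0)) (hβ : InjOn β J)
    (hd : ∀ s ∈ J, β s ∉ α '' Icc a 0) :
    InjOn (fun t => if t ≤ 0 then α t else β t) (Icc a 0 ∪ J) := by
  have hJ' : ∀ t ∈ J, ¬ t ≤ 0 := fun t ht => not_le.2 (hJ ht)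
  rintro s (hs | hs) t (ht | ht) hst
  · simp only [if_pos hs.2, if_pos ht.2] at hst
    exact hα hs ht hst
  · simp only [if_pos hs.2, if_neg (hJ' t ht)] at hst
    exact (hd t ht ⟨s, hs, hst⟩).elim
  · simp only [if_neg (hJ' s hs), if_pos ht.2] at hst
    exact (hd s hs ⟨t, ht, hst.symm⟩).elim
  · simp only [if_neg (hJ' s hs), if_neg (hJ' t ht)] at hst
    exact hβ hs ht hst

end Gluing

/-- A compact set covered by charts contains a Jordan curve. -/
theorem exists_injective_addCircle {M : Type*} [MetricSpace M] {X : Set M} (hX : IsCompact X)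
    (hne : X.Nonempty) (h : ∀ x ∈ X, ∃ π c W r, IsArcChart X π c W r ∧ x ∈ W) :
    ∃ p : ℝ, ∃ _ : 0 < p, ∃ f : AddCircle p → M,
      Continuous f ∧ Function.Injective f ∧ range f ⊆ X := by
  classical
  choose! π c W r hch hxW using h
  obtain ⟨T, hTX, hT⟩ := hX.elim_nhds_subcover W fun x hx => (hch x hx).isOpen.mem_nhds (hxW x hx)
  set S : Set M := ⋃ x ∈ T, {c x (r x), c x (-r x)} with hS
  have hSfin : S.Finite := T.finite_toSet.biUnion fun x _ => by simp
  have hSmem : ∀ x ∈ T, ∀ y, y = c x (r x) ∨ y = c x (-r x) → y ∈ S := fun x hx y hy => by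
    simp only [hS, mem_iUnion]
    exact ⟨x, hx, hy⟩
  have hcov : ∀ y ∈ X, ∃ x ∈ T, y ∈ W x := fun y hy => by
    simpa only [mem_iUnion, exists_prop] using hT hy
  let P : Set ℕ := {n | ∃ a < 0, ∃ α : ℝ → M, ContinuousOn α (Icc a 0) ∧ InjOn α (Icc a 0) ∧
    (∀ t ∈ Icc a 0, α t ∈ X) ∧ α 0 ∈ S ∧ (S ∩ α '' Icc a 0).ncard = n}
  have hPb : BddAbove P := by
    refine ⟨S.ncard, ?_⟩
    rintro n ⟨a, -, α, -, -, -, -, rfl⟩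
    exact ncard_le_ncard inter_subset_left hSfin
  have hPne : P.Nonempty := by
    obtain ⟨x₀, hx₀⟩ := hne
    obtain ⟨x, hx, -⟩ := hcov x₀ hx₀
    have hc := hch x (hTX x hx)
    have hmaps : ∀ t ∈ Icc (-2 * r x) 0, t + r x ∈ Icc (-r x) (r x) := fun t ht =>
      ⟨by linarith [ht.1], by linarith [ht.2]⟩
    refine ⟨_, -2 * r x, by linarith [hc.pos], fun t => c x (t + r x),
      hc.continuousOn.comp (by fun_prop) hmaps, ?_, fun t ht => hc.mem _ (hmaps t ht),
      hSmem x hx _ (Or.inl (by simp only [zero_add])), rfl⟩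
    intro s hs t ht hst
    simpa using hc.injOn (hmaps s hs) (hmaps t ht) hst
  obtain ⟨a, ha, α, hα, hαi, hαX, hαS, hn⟩ := Nat.sSup_mem hPne hPb
  have hmax : ∀ m ∈ P, m ≤ (S ∩ α '' Icc a 0).ncard := fun m hm => hn ▸ le_csSup hPb hm
  obtain ⟨x, hx, hxW'⟩ := hcov (α 0) (hαX 0 ⟨ha.le, le_rfl⟩)
  obtain ⟨b, hb, β, hβ, hβi, hβX, hβ0, hβb, δ, hδ, hδs⟩ :=
    (hch x (hTX x hx)).exists_extension ha hα hαi hαX hxW'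
  set γ : ℝ → M := fun t => if t ≤ 0 then α t else β t with hγ
  have hγX : ∀ t ∈ Icc a b, γ t ∈ X := fun t ht => by
    simp only [hγ]
    split_ifs with h0
    · exact hαX t ⟨ht.1, h0⟩
    · exact hβX t ⟨(not_le.1 h0).le, ht.2⟩
  have hγc : ContinuousOn γ (Icc a b) := continuousOn_glue ha.le hb.le hα hβ hβ0
  by_cases hhit : ∃ s ∈ Ioc 0 b, β s ∈ α '' Icc a 0
  · set Z : Set ℝ := Icc (min δ b) b ∩ β ⁻¹' (α '' Icc a 0) with hZ
    have hδb : 0 < min δ b := lt_min hδ hb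
    have hZin : ∀ s ∈ Ioc 0 b, β s ∈ α '' Icc a 0 → s ∈ Z := fun s hs hsα => by
      refine ⟨⟨?_, hs.2⟩, hsα⟩
      by_contra hlt
      exact hδs s ⟨hs.1, (not_le.1 hlt).trans_le (min_le_left _ _)⟩ hs.2 hsα
    have hZc : IsCompact Z := by
      have : IsClosed Z := (hβ.mono (Icc_subset_Icc_left hδb.le)).preimage_isClosed_of_isClosed
        isClosed_Icc (isCompact_Icc.image_of_continuousOn hα).isClosed
      exact isCompact_Icc.of_isClosed_subset this inter_subset_left
    obtain ⟨s₀, hs₀, hs₁⟩ := hhit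
    obtain ⟨s, ⟨hsI, t, ht, hts⟩, hsmin⟩ := hZc.exists_isLeast ⟨s₀, hZin s₀ hs₀ hs₁⟩
    have hs0 : 0 < s := hδb.trans_le hsI.1
    have ht0 : t < 0 := by
      refine lt_of_le_of_ne ht.2 ?_
      rintro rfl
      have := hβi ⟨hs0.le, hsI.2⟩ ⟨le_rfl, hb.le⟩ (hts.symm.trans hβ0.symm)
      exact hs0.ne' this
    have hp : 0 < s - t := by linarith
    have : Fact (0 < s - t) := ⟨hp⟩
    have hts' : t + (s - t) = s := by ring
    have hinj : InjOn γ (Ico t (t + (s - t))) := by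
      rw [hts']
      have hJ : Ioo 0 s ⊆ Icc 0 b := fun u hu => ⟨hu.1.le, hu.2.le.trans hsI.2⟩
      refine (injOn_glue (J := Ioo 0 s) (fun u hu => hu.1) hαi (hβi.mono hJ)
        fun u hu huα => ?_).mono ?_
      · exact absurd (hsmin (hZin u ⟨hu.1, hu.2.le.trans hsI.2⟩ huα)) (not_le.2 hu.2)
      · intro u hu
        rcases le_or_gt u 0 with h0 | h0
        · exact Or.inl ⟨ht.1.trans hu.1, h0⟩
        · exact Or.inr ⟨h0, hu.2⟩
    have hlift : ∀ u ∈ Ico t (t + (s - t)),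
        AddCircle.liftIco (s - t) t γ (u : AddCircle (s - t)) = γ u :=
      fun u hu => AddCircle.liftIco_coe_apply hu
    have hrep : ∀ θ : AddCircle (s - t), ∃ u ∈ Ico t (t + (s - t)),
        (u : AddCircle (s - t)) = θ := fun θ =>
      ⟨(AddCircle.equivIco (s - t) t θ).1, (AddCircle.equivIco (s - t) t θ).2,
        AddCircle.coe_equivIco⟩
    refine ⟨s - t, hp, AddCircle.liftIco (s - t) t γ, ?_, ?_, ?_⟩
    · refine AddCircle.liftIco_continuous ?_ ?_
      · rw [hts']
        simp only [hγ, if_pos ht0.le, if_neg (not_le.2 hs0), hts]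
      · rw [hts']
        exact hγc.mono (Icc_subset_Icc ht.1 hsI.2)
    · intro θ₁ θ₂ hθ
      obtain ⟨u, hu, rfl⟩ := hrep θ₁
      obtain ⟨v, hv, rfl⟩ := hrep θ₂
      rw [hlift u hu, hlift v hv] at hθ
      rw [hinj hu hv hθ]
    · rintro _ ⟨θ, rfl⟩
      obtain ⟨u, hu, rfl⟩ := hrep θ
      rw [hlift u hu]
      exact hγX u ⟨ht.1.trans hu.1, by linarith [hu.2, hsI.2]⟩
  · exfalso
    push Not at hhit
    have hγi : InjOn γ (Icc a b) := by
      refine (injOn_glue (J := Ioc 0 b) (fun u hu => hu.1) hαi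
        (hβi.mono Ioc_subset_Icc_self) hhit).mono ?_
      intro u hu
      rcases le_or_gt u 0 with h0 | h0
      · exact Or.inl ⟨hu.1, h0⟩
      · exact Or.inr ⟨h0, hu.2⟩
    have hmaps : ∀ t ∈ Icc (a - b) 0, t + b ∈ Icc a b := fun t ht =>
      ⟨by linarith [ht.1], by linarith [ht.2]⟩
    have hγb : γ b = β b := if_neg (not_le.2 hb)
    have hbS : β b ∈ S := hSmem x hx _ hβb
    have hlt : (S ∩ α '' Icc a 0).ncard < (S ∩ (fun t => γ (t + b)) '' Icc (a - b) 0).ncard := by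
      refine ncard_lt_ncard ((ssubset_iff_of_subset ?_).2 ⟨β b, ⟨hbS, 0, ⟨by linarith, le_rfl⟩, ?_⟩,
        fun hmem => hhit b ⟨hb, le_rfl⟩ hmem.2⟩) (hSfin.subset inter_subset_left)
      · rintro _ ⟨hyS, t, ht, rfl⟩
        refine ⟨hyS, t - b, ⟨by linarith [ht.1], by linarith [ht.2]⟩, ?_⟩
        simp only [sub_add_cancel, hγ, if_pos ht.2]
      · simp only [zero_add, hγb]
    refine absurd (hmax _ ⟨a - b, by linarith, fun t => γ (t + b),
      hγc.comp (by fun_prop) hmaps, ?_, fun t ht => hγX _ (hmaps t ht), ?_, rfl⟩) (not_le.2 hlt)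
    · intro u hu v hv huv
      simpa using hγi (hmaps u hu) (hmaps v hv) huv
    · simpa only [zero_add, hγb] using hbS

/-- A continuum in the plane covered by charts is a Jordan curve. -/
theorem isJordanCurve_of_arcCharts {X : Set E2} (hX : IsCompact X) (hne : X.Nonempty)
    (hc : IsPreconnected X) (h : ∀ x ∈ X, ∃ π c W r, IsArcChart X π c W r ∧ x ∈ W) :
    IsJordanCurve X := by
  obtain ⟨p, hp, f, hf, hfi, hfX⟩ := exists_injective_addCircle hX hne h
  have : Fact (0 < p) := ⟨hp⟩
  have hcl : IsClosed (range f) := (isCompact_range hf).isClosed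
  have hN : ∀ θ, ∃ N, IsOpen N ∧ f θ ∈ N ∧ X ∩ N ⊆ range f := by
    intro θ
    obtain ⟨t₀, rfl⟩ := QuotientAddGroup.mk_surjective θ
    obtain ⟨π, c, W, r, hch, hW⟩ := h _ (hfX (mem_range_self (t₀ : AddCircle p)))
    obtain ⟨N, hN1, hN2, hN3⟩ := hch.exists_nhds_subset_image (G := fun t : ℝ => f t) (t₀ := t₀)
      (ρ := p / 4) (by linarith) (hf.comp (AddCircle.continuous_mk' p)) (by
        intro s hs t ht hst
        have h1 := hfi hst
        have hI : ∀ u ∈ Icc (t₀ - p / 4) (t₀ + p / 4), u ∈ Ico (t₀ - p / 4) (t₀ - p / 4 + p) :=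
          fun u hu => ⟨hu.1, by linarith [hu.2]⟩
        exact (AddCircle.coe_eq_coe_iff_of_mem_Ico (hI s hs) (hI t ht)).1 h1)
      (fun t => hfX (mem_range_self _)) hW
    exact ⟨N, hN1, hN2, hN3.trans (by rintro _ ⟨t, rfl⟩; exact mem_range_self _)⟩
  choose N hNo hNm hNs using hN
  have hsub : X ⊆ range f := by
    intro y hy
    by_contra hyr
    obtain ⟨z, hzX, hz, hzr⟩ := hc _ _ (isOpen_iUnion hNo) hcl.isOpen_compl (fun z _ => by
      by_cases hz : z ∈ range f
      · obtain ⟨θ, rfl⟩ := hz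
        exact Or.inl (mem_iUnion.2 ⟨θ, hNm θ⟩)
      · exact Or.inr hz)
      ⟨f 0, hfX (mem_range_self _), mem_iUnion.2 ⟨0, hNm 0⟩⟩ ⟨y, hy, hyr⟩
    obtain ⟨θ, hθ⟩ := mem_iUnion.1 hz
    exact hzr (hNs θ ⟨hzX, hθ⟩)
  rw [hsub.antisymm hfX]
  exact isJordanCurve_range hp hf hfi

theorem dist_sq_plane (a b : E2) : dist a b ^ 2 = (a 0 - b 0) ^ 2 + (a 1 - b 1) ^ 2 := by
  rw [EuclideanSpace.dist_eq, Real.sq_sqrt (by positivity), Fin.sum_univ_two, Real.dist_eq,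
    Real.dist_eq, sq_abs, sq_abs]

/-- On a segment towards `K` the distance to `K` takes every smaller value. -/
theorem exists_infDist_eq_on_segment {K : Set E2} {z p : E2} {e : ℝ} (hp : p ∈ K) (he : 0 ≤ e)
    (hz : e < infDist z K) :
    ∃ τ : ℝ, 0 < τ ∧ τ ≤ 1 ∧ infDist (z + τ • (p - z)) K = e := by
  have hc : ContinuousOn (fun τ : ℝ => infDist (z + τ • (p - z)) K) (Icc 0 1) :=
    ((continuous_infDist_pt K).comp (by fun_prop)).continuousOn
  obtain ⟨τ, hτ, hτe⟩ := intermediate_value_Icc' zero_le_one hc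
    (show e ∈ Icc _ _ from ⟨by simpa [infDist_zero_of_mem hp] using he, by simpa using hz.le⟩)
  refine ⟨τ, lt_of_le_of_ne hτ.1 ?_, hτ.2, hτe⟩
  rintro rfl
  simp only [zero_smul, add_zero] at hτe
  exact hz.ne' hτe

/-- If the nearest points of `x` contain an antipodal pair, bounded turning of the slightly lower
level sets prevents points at the same or higher level close to `x`. -/
theorem not_antipodal_of_boundedTurning {K : Set E2} (hK : IsClosed K) {ε C H : ℝ} (hC : 0 ≤ C)
    {x p q w : E2} (hp : p ∈ K) (hq : q ∈ K) (hε : 0 < ε) (hx : infDist x K = ε)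
    (hpx : dist p x = ε) (hpq : q - x = -(p - x)) (hw : ε ≤ infDist w K) (hH : dist w x = H)
    (hH0 : 0 < H) (hHε : 4 * (2 * C + 1) * H < ε)
    (hBT : BoundedTurning {z | infDist z K = ε - H ^ 2 / (2 * ε)} C) : False := by
  have hne : K.Nonempty := ⟨p, hp⟩
  have hq0 : q 0 - x 0 = -(p 0 - x 0) := by simpa using congrArg (fun v : E2 => v 0) hpq
  have hq1 : q 1 - x 1 = -(p 1 - x 1) := by simpa using congrArg (fun v : E2 => v 1) hpq
  have hP := dist_sq_plane p x
  have hV := dist_sq_plane w x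
  rw [hpx] at hP
  rw [hH] at hV
  have hwk : ∀ k ∈ K, ε ^ 2 ≤ dist w k ^ 2 := fun k hk =>
    pow_le_pow_left₀ hε.le (hw.trans (infDist_le_dist_of_mem hk)) 2
  have hxk : ∀ k ∈ K, ε ^ 2 ≤ dist x k ^ 2 := fun k hk =>
    pow_le_pow_left₀ hε.le (hx ▸ infDist_le_dist_of_mem hk) 2
  obtain ⟨P0, hP0⟩ : ∃ t, t = p 0 - x 0 := ⟨_, rfl⟩
  obtain ⟨P1, hP1⟩ : ∃ t, t = p 1 - x 1 := ⟨_, rfl⟩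
  obtain ⟨v0, hv0⟩ : ∃ t, t = w 0 - x 0 := ⟨_, rfl⟩
  obtain ⟨v1, hv1⟩ : ∃ t, t = w 1 - x 1 := ⟨_, rfl⟩
  rw [← hP0, ← hP1] at hP
  rw [← hv0, ← hv1] at hV
  have hin1 : 2 * (v0 * P0 + v1 * P1) ≤ H ^ 2 := by
    have := hwk p hp
    rw [dist_sq_plane, show w 0 - p 0 = v0 - P0 by linarith,
      show w 1 - p 1 = v1 - P1 by linarith] at this
    linear_combination this - hP - hV
  have hin2 : -(2 * (v0 * P0 + v1 * P1)) ≤ H ^ 2 := by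
    have := hwk q hq
    rw [dist_sq_plane, show w 0 - q 0 = v0 + P0 by linarith,
      show w 1 - q 1 = v1 + P1 by linarith] at this
    linear_combination this - hP - hV
  have hHε' : 4 * H < ε := by linarith [mul_nonneg hC hH0.le]
  set e := ε - H ^ 2 / (2 * ε) with he
  have hμ : H ^ 2 / (2 * ε) * (2 * ε) = H ^ 2 := div_mul_cancel₀ _ (by positivity)
  set μ := H ^ 2 / (2 * ε) with hμdef
  have hμ0 : 0 < μ := by positivity
  have hμε : μ < ε / 8 := by
    rw [hμdef, div_lt_iff₀ (by positivity)]
    have := pow_lt_pow_left₀ hHε' (by positivity) two_ne_zero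
    linarith [sq_nonneg ε]
  have hμ2 : μ ^ 2 ≤ H ^ 2 / 16 := by
    have := mul_le_mul_of_nonneg_left hμε.le hμ0.le
    linear_combination this + hμ / 16
  have he0 : 0 ≤ e := by linarith
  have hseg : ∀ s ∈ Icc (0 : ℝ) 1, ∀ y : E2, y 0 = x 0 + s * v0 → y 1 = x 1 + s * v1 →
      e < infDist y K := by
    intro s hs y hy0 hy1
    obtain ⟨k, hk, hky⟩ := hK.exists_infDist_eq_dist hne y
    rw [hky]
    refine lt_of_pow_lt_pow_left₀ 2 dist_nonneg ?_
    have h1 := hwk k hk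
    have h2 := hxk k hk
    rw [dist_sq_plane] at h1 h2 ⊢
    have h3 : (y 0 - k 0) ^ 2 + (y 1 - k 1) ^ 2 =
        (1 - s) * ((x 0 - k 0) ^ 2 + (x 1 - k 1) ^ 2) + s * ((w 0 - k 0) ^ 2 + (w 1 - k 1) ^ 2)
          - s * (1 - s) * H ^ 2 := by
      rw [hy0, hy1, hV, show w 0 = x 0 + v0 by linarith, show w 1 = x 1 + v1 by linarith]
      ring
    have h4 : ε ^ 2 - H ^ 2 / 4 ≤ (y 0 - k 0) ^ 2 + (y 1 - k 1) ^ 2 := by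
      rw [h3]
      have h5 := mul_le_mul_of_nonneg_left h2 (sub_nonneg.2 hs.2)
      have h6 := mul_le_mul_of_nonneg_left h1 hs.1
      have h7 := mul_nonneg (sq_nonneg (s - 1 / 2)) (sq_nonneg H)
      linear_combination h5 + h6 + h7
    refine lt_of_lt_of_le ?_ h4
    have h8 : e ^ 2 = ε ^ 2 - H ^ 2 + μ ^ 2 := by rw [he]; linear_combination -hμ
    rw [h8]
    linarith [pow_pos hH0 2]
  obtain ⟨z, hz⟩ : ∃ z : E2, z = !₂[x 0 + 1 / 2 * v0, x 1 + 1 / 2 * v1] := ⟨_, rfl⟩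
  have hz0 : z 0 = x 0 + 1 / 2 * v0 := by simp [hz]
  have hz1 : z 1 = x 1 + 1 / 2 * v1 := by simp [hz]
  have hze : e < infDist z K := hseg (1 / 2) ⟨by norm_num, by norm_num⟩ z hz0 hz1
  have hfoot : ∀ k ∈ K, (z 0 - k 0) ^ 2 + (z 1 - k 1) ^ 2 ≤ ε ^ 2 + 3 / 4 * H ^ 2 →
      ∃ a : E2, infDist a K = e ∧ dist a z ≤ 2 * μ ∧ ∃ τ > 0,
        a 0 = z 0 + τ * (k 0 - z 0) ∧ a 1 = z 1 + τ * (k 1 - z 1) := by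
    intro k hk hkz
    obtain ⟨τ, hτ0, hτ1, hτ⟩ := exists_infDist_eq_on_segment hk he0 hze
    refine ⟨_, hτ, ?_, τ, hτ0, by simp, by simp⟩
    have h1 : e ≤ (1 - τ) * dist k z := by
      rw [← hτ]
      refine (infDist_le_dist_of_mem hk).trans (le_of_eq ?_)
      rw [dist_eq_norm, dist_eq_norm, show z + τ • (k - z) - k = -((1 - τ) • (k - z)) by module,
        norm_neg, norm_smul, Real.norm_of_nonneg (by linarith)]
    have h2 : dist (z + τ • (k - z)) z = τ * dist k z := by
      rw [dist_eq_norm, dist_eq_norm, add_sub_cancel_left, norm_smul, Real.norm_of_nonneg hτ0.le]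
    have h3 : dist k z ≤ ε + 3 / 4 * μ := by
      refine le_of_sq_le_sq ?_ (by positivity)
      rw [dist_comm, dist_sq_plane]
      linear_combination hkz + 9 / 16 * sq_nonneg μ - 3 / 4 * hμ
    rw [h2]
    linarith
  obtain ⟨a, haK, haz, τ, hτ, ha0, ha1⟩ := hfoot p hp (by
    rw [hz0, hz1, show x 0 + 1 / 2 * v0 - p 0 = 1 / 2 * v0 - P0 by linarith,
      show x 1 + 1 / 2 * v1 - p 1 = 1 / 2 * v1 - P1 by linarith]
    linear_combination -hP - hV / 4 + hin2 / 2)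
  obtain ⟨b, hbK, hbz, σ, hσ, hb0, hb1⟩ := hfoot q hq (by
    rw [hz0, hz1, show x 0 + 1 / 2 * v0 - q 0 = 1 / 2 * v0 + P0 by linarith,
      show x 1 + 1 / 2 * v1 - q 1 = 1 / 2 * v1 + P1 by linarith]
    linear_combination -hP - hV / 4 + hin1 / 2)
  obtain ⟨S, hS, hSc, haS, hbS⟩ := hBT a haK b hbK
  set L : E2 → ℝ := fun y => v0 * (y 1 - x 1) - v1 * (y 0 - x 0) with hL
  have hLc : Continuous L := by simp only [hL]; fun_prop
  set Δ := v0 * P1 - v1 * P0 with hΔ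
  have hLa : L a = τ * Δ := by
    simp only [hL, hΔ]
    rw [ha0, ha1, hz0, hz1, show p 0 = x 0 + P0 by linarith, show p 1 = x 1 + P1 by linarith]
    ring
  have hLb : L b = -(σ * Δ) := by
    simp only [hL, hΔ]
    rw [hb0, hb1, hz0, hz1, show q 0 = x 0 - P0 by linarith, show q 1 = x 1 - P1 by linarith]
    ring
  have hΔ0 : Δ ≠ 0 := by
    intro h0
    have h1 : (v0 * P0 + v1 * P1) ^ 2 = H ^ 2 * ε ^ 2 := by
      have : Δ ^ 2 + (v0 * P0 + v1 * P1) ^ 2 = H ^ 2 * ε ^ 2 := by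
        rw [hV, hP, hΔ]; ring
      rwa [h0, zero_pow two_ne_zero, zero_add] at this
    have h2 : (2 * (v0 * P0 + v1 * P1)) ^ 2 ≤ (H ^ 2) ^ 2 :=
      sq_le_sq' (by linarith) hin1
    have h3 : H ^ 2 * H ^ 2 < H ^ 2 * (4 * ε ^ 2) := by
      have : H ^ 2 < ε ^ 2 := pow_lt_pow_left₀ (by linarith) hH0.le two_ne_zero
      exact mul_lt_mul_of_pos_left (by linarith [pow_pos hε 2]) (pow_pos hH0 2)
    refine lt_irrefl (0 : ℝ) ?_
    linear_combination h2 + h3 - 4 * h1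
  obtain ⟨y, hyS, hyL⟩ : ∃ y ∈ S, L y = 0 := by
    rcases lt_or_gt_of_ne hΔ0 with h | h
    · exact hSc.intermediate_value haS hbS hLc.continuousOn
        ⟨by rw [hLa]; exact (mul_neg_of_pos_of_neg hτ h).le,
          by rw [hLb]; exact neg_nonneg.2 (mul_neg_of_pos_of_neg hσ h).le⟩
    · exact hSc.intermediate_value hbS haS hLc.continuousOn
        ⟨by rw [hLb]; exact neg_nonpos.2 (mul_pos hσ h).le,
          by rw [hLa]; exact (mul_pos hτ h).le⟩
  have hyK : infDist y K = e := (hS hyS).1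
  have hya : dist y a ≤ C * dist a b := (hS hyS).2
  have hyz : dist y z < H / 4 := by
    have h1 : dist a b ≤ 4 * μ := by
      have := dist_triangle_right a b z
      linarith
    have h2 : dist y z ≤ 2 * (2 * C + 1) * μ := by
      have := dist_triangle y a z
      linarith [mul_le_mul_of_nonneg_left h1 hC]
    refine h2.trans_lt ?_
    refine lt_of_mul_lt_mul_right ?_ hε.le
    have h3 := mul_lt_mul_of_pos_right hHε hH0
    linear_combination h3 / 4 + (2 * C + 1) * hμ
  obtain ⟨s, hs⟩ : ∃ s, s = (v0 * (y 0 - x 0) + v1 * (y 1 - x 1)) / H ^ 2 := ⟨_, rfl⟩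
  have hL0 : v0 * (y 1 - x 1) = v1 * (y 0 - x 0) := by
    simp only [hL] at hyL
    linarith
  have hH2 : H ^ 2 ≠ 0 := by positivity
  have hy0 : y 0 = x 0 + s * v0 := by
    have : s * v0 = y 0 - x 0 := by
      rw [hs, div_mul_eq_mul_div, div_eq_iff hH2, hV]
      linear_combination v1 * hL0
    linarith
  have hy1 : y 1 = x 1 + s * v1 := by
    have : s * v1 = y 1 - x 1 := by
      rw [hs, div_mul_eq_mul_div, div_eq_iff hH2, hV]
      linear_combination -v0 * hL0
    linarith
  have hs2 : (s - 1 / 2) ^ 2 * H ^ 2 < (1 / 4) ^ 2 * H ^ 2 := by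
    have h1 : dist y z ^ 2 = (s - 1 / 2) ^ 2 * H ^ 2 := by
      rw [dist_sq_plane, hy0, hy1, hz0, hz1, hV]
      ring
    rw [← h1]
    calc dist y z ^ 2 < (H / 4) ^ 2 := pow_lt_pow_left₀ hyz dist_nonneg two_ne_zero
      _ = _ := by ring
  have hs3 : (s - 1 / 2) ^ 2 < (1 / 4) ^ 2 := lt_of_mul_lt_mul_right hs2 (by positivity)
  have hs4 := abs_lt.1 (abs_lt_of_sq_lt_sq hs3 (by norm_num))
  exact (hseg s ⟨by linarith [hs4.1], by linarith [hs4.2]⟩ y hy0 hy1).ne' hyK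

/-- Two planar vectors of equal length orthogonal to a common line and at an obtuse angle are
opposite. -/
theorem eq_neg_of_inner_eq_zero {a b u : E2} (hu : u ≠ 0) (ha : inner ℝ a u = 0)
    (hb : inner ℝ b u = 0) (hab : ‖a‖ = ‖b‖) (h : inner ℝ a b ≤ 0) : b = -a := by
  have hu2 : 0 < ‖u‖ ^ 2 := by positivity
  have hn : ∀ v : E2, ‖v‖ ^ 2 = v 0 ^ 2 + v 1 ^ 2 := fun v => by
    rw [EuclideanSpace.norm_sq_eq, Fin.sum_univ_two, Real.norm_eq_abs, Real.norm_eq_abs, sq_abs,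
      sq_abs]
  have hi : ∀ v w : E2, inner ℝ v w = v 0 * w 0 + v 1 * w 1 := fun v w => by
    simp [PiLp.inner_apply, Fin.sum_univ_two, mul_comm]
  rw [hi] at ha hb
  rw [hn] at hu2
  have hcross : a 0 * b 1 - a 1 * b 0 = 0 := by
    have : (a 0 * b 1 - a 1 * b 0) * (u 0 ^ 2 + u 1 ^ 2) = 0 := by
      linear_combination (b 1 * u 0 - b 0 * u 1) * ha + (-a 1 * u 0 + a 0 * u 1) * hb
    exact (mul_eq_zero.1 this).resolve_right hu2.ne'
  have h1 : inner ℝ a b ^ 2 = (‖a‖ ^ 2) ^ 2 := by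
    calc inner ℝ a b ^ 2 = ‖a‖ ^ 2 * ‖b‖ ^ 2 := by
          rw [hi, hn, hn]
          linear_combination -(a 0 * b 1 - a 1 * b 0) * hcross
      _ = _ := by rw [← hab]; ring
  have h2 : inner ℝ a b = -‖a‖ ^ 2 := by
    rcases sq_eq_sq_iff_eq_or_eq_neg.1 h1 with h3 | h3
    · linarith [sq_nonneg ‖a‖]
    · exact h3
  have h3 : ‖a + b‖ ^ 2 = 0 := by
    rw [norm_add_sq_real, h2, ← hab]
    ring
  exact eq_neg_of_add_eq_zero_right (norm_eq_zero.1 (pow_eq_zero_iff two_ne_zero |>.1 h3))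

/-- Points of a level set all of whose neighbouring level sets have bounded turning are
not critical for the distance function. -/
theorem exists_inner_neg_of_boundedTurning {K : Set E2} (hK : IsClosed K) {ε C : ℝ} (hC : 0 ≤ C)
    (hε : 0 < ε) {x : E2} (hx : infDist x K = ε)
    (hacc : ∀ ρ > 0, ∃ w, infDist w K = ε ∧ w ≠ x ∧ dist w x < ρ)
    (hBT : ∀ e, 0 < e → e < ε → ε / 2 ≤ e → BoundedTurning {z | infDist z K = e} C) :
    ∃ u : E2, u ≠ 0 ∧ ∀ p ∈ K, dist p x = ε → inner ℝ (p - x) u < 0 := by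
  by_contra! hcon
  choose! P hPK hPx hPu using hcon
  choose w hwε hwx hw using fun n : ℕ => hacc (1 / ((n : ℝ) + 1)) (by positivity)
  have hne : ∀ n, ‖w n - x‖ ≠ 0 := fun n => norm_ne_zero_iff.2 (sub_ne_zero.2 (hwx n))
  obtain ⟨u, hu, θ, hθ, hθu⟩ := (isCompact_sphere (0 : E2) 1).tendsto_subseq
    (x := fun n => ‖w n - x‖⁻¹ • (w n - x)) fun n => by
      rw [mem_sphere_zero_iff_norm, norm_smul, norm_inv, norm_norm, inv_mul_cancel₀ (hne n)]
  have hu1 : ‖u‖ = 1 := by simpa using hu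
  have hu0 : u ≠ 0 := norm_ne_zero_iff.1 (by rw [hu1]; exact one_ne_zero)
  have htend := tendsto_one_div_add_atTop_nhds_zero_nat (𝕜 := ℝ)
  have hle : ∀ p ∈ K, dist p x = ε → inner ℝ (p - x) u ≤ 0 := by
    intro p hp hpx
    have h1 : ∀ n, inner ℝ (p - x) (‖w n - x‖⁻¹ • (w n - x)) ≤ 1 / ((n : ℝ) + 1) := by
      intro n
      have h2 : ε ^ 2 ≤ ‖(p - x) - (w n - x)‖ ^ 2 := by
        rw [sub_sub_sub_cancel_right, ← dist_eq_norm, dist_comm]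
        exact pow_le_pow_left₀ hε.le (hwε n ▸ infDist_le_dist_of_mem hp) 2
      rw [norm_sub_sq_real, ← dist_eq_norm p x, hpx] at h2
      have h3 : ‖w n - x‖ < 1 / ((n : ℝ) + 1) := by rw [← dist_eq_norm]; exact hw n
      rw [inner_smul_right, inv_mul_le_iff₀ (lt_of_le_of_ne (norm_nonneg _) (hne n).symm)]
      have h4 := mul_le_mul_of_nonneg_left h3.le (norm_nonneg (w n - x))
      linarith [sq_nonneg ‖w n - x‖, sq ‖w n - x‖]
    refine le_of_tendsto_of_tendsto' ?_ (htend.comp hθ.tendsto_atTop) fun n => h1 (θ n)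
    exact tendsto_const_nhds.inner hθu
  set p := P u with hp
  have hpu : inner ℝ (p - x) u = 0 := le_antisymm (hle p (hPK u hu0) (hPx u hu0)) (hPu u hu0)
  set U : ℕ → E2 := fun m => u - (1 / ((m : ℝ) + 1)) • (p - x) with hU
  have hU0 : ∀ m, U m ≠ 0 := fun m h0 => by
    have h1 : inner ℝ (U m) u = 1 := by
      simp only [hU]
      rw [inner_sub_left, inner_smul_left, hpu, real_inner_self_eq_norm_sq, hu1]
      simp
    rw [h0, inner_zero_left] at h1
    exact zero_ne_one h1
  have hUinner : ∀ m, inner ℝ (P (U m) - x) (p - x) / ((m : ℝ) + 1) ≤ inner ℝ (P (U m) - x) u := by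
    intro m
    have h1 := hPu (U m) (hU0 m)
    simp only [hU] at h1 ⊢
    rw [inner_sub_right, inner_smul_right] at h1
    rw [div_eq_mul_one_div]
    linarith
  have hle1 : ∀ m, inner ℝ (P (U m) - x) (p - x) ≤ 0 := fun m => by
    have h1 := (hUinner m).trans (hle _ (hPK _ (hU0 m)) (hPx _ (hU0 m)))
    rwa [div_le_iff₀ (by positivity), zero_mul] at h1
  have hge1 : ∀ m, -ε ^ 2 ≤ inner ℝ (P (U m) - x) (p - x) := fun m => by
    have h1 := abs_real_inner_le_norm (P (U m) - x) (p - x)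
    rw [← dist_eq_norm, ← dist_eq_norm, hPx _ (hU0 m), hPx u hu0] at h1
    linarith [(abs_le.1 h1).1]
  obtain ⟨q, hq, ψ, hψ, hψq⟩ := ((isCompact_sphere x ε).inter_left hK).tendsto_subseq
    (x := fun m => P (U m)) fun m => ⟨hPK _ (hU0 m), hPx _ (hU0 m)⟩
  have hqu : 0 ≤ inner ℝ (q - x) u := by
    have h1 := ((htend.comp hψ.tendsto_atTop).const_mul (-ε ^ 2))
    rw [mul_zero] at h1
    refine le_of_tendsto_of_tendsto' h1
      (Filter.Tendsto.inner (hψq.sub tendsto_const_nhds) tendsto_const_nhds) fun m => ?_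
    refine le_trans ?_ (hUinner (ψ m))
    rw [div_eq_mul_one_div (inner ℝ _ _ : ℝ)]
    exact mul_le_mul_of_nonneg_right (hge1 _) (one_div_nonneg.2 (by positivity))
  have hqp : inner ℝ (q - x) (p - x) ≤ 0 :=
    le_of_tendsto' (Filter.Tendsto.inner (hψq.sub tendsto_const_nhds) tendsto_const_nhds)
      fun m => hle1 (ψ m)
  have hqx : dist q x = ε := hq.2
  have hpq : q - x = -(p - x) := by
    refine eq_neg_of_inner_eq_zero hu0 hpu (le_antisymm (hle q hq.1 hqx) hqu) ?_ ?_
    · rw [← dist_eq_norm, ← dist_eq_norm, hqx, hPx u hu0]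
    · rwa [real_inner_comm]
  obtain ⟨y, hyε, hyx, hy⟩ := hacc (ε / (4 * (2 * C + 1))) (by positivity)
  have hH0 : 0 < dist y x := dist_pos.2 hyx
  rw [lt_div_iff₀ (by positivity), mul_comm] at hy
  have hHε : 4 * dist y x < ε := by linarith [mul_nonneg hC hH0.le]
  have hμ : dist y x ^ 2 / (2 * ε) < ε / 8 := by
    rw [div_lt_iff₀ (by positivity)]
    have := pow_lt_pow_left₀ hHε (by positivity) two_ne_zero
    linarith [sq_nonneg ε]
  have hμ0 : 0 < dist y x ^ 2 / (2 * ε) := div_pos (pow_pos hH0 2) (by positivity)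
  exact not_antipodal_of_boundedTurning hK hC (hPK u hu0) hq.1 hε hx (hPx u hu0) hpq hyε.ge rfl hH0
    hy (hBT _ (by linarith) (by linarith) (by linarith))

/-- Near a noncritical point the distance function increases along a fixed direction. -/
theorem exists_strictMono_direction {K : Set E2} (hK : IsClosed K) (hKne : K.Nonempty) {x u : E2}
    (hu : ‖u‖ = 1) (h : ∀ p ∈ K, dist p x = infDist x K → inner ℝ (p - x) u < 0) :
    ∃ ρ > 0, ∀ y ∈ ball x ρ, ∀ s > (0 : ℝ), y + s • u ∈ ball x ρ → infDist y K < infDist (y + s • u) K := by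
  obtain ⟨ρ, hρ, hc⟩ : ∃ ρ > 0, ∀ y ∈ ball x ρ, ∀ p ∈ K, dist y p = infDist y K →
      inner ℝ (p - y) u ≤ -ρ := by
    by_contra! hcon
    choose y hyx p hp hpy hpu using fun n : ℕ => hcon (1 / ((n : ℝ) + 1)) (by positivity)
    have htend := tendsto_one_div_add_atTop_nhds_zero_nat (𝕜 := ℝ)
    have hy : Filter.Tendsto y Filter.atTop (nhds x) :=
      tendsto_iff_dist_tendsto_zero.2 (squeeze_zero (fun _ => dist_nonneg)
        (fun n => (mem_ball.1 (hyx n)).le) htend)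
    have hbd : ∀ n, p n ∈ K ∩ closedBall x (infDist x K + 2) := fun n => by
      have h1 : dist (y n) x < 1 := (mem_ball.1 (hyx n)).trans_le (by
        rw [div_le_one (by positivity)]
        linarith [n.cast_nonneg (α := ℝ)])
      have h2 := infDist_le_infDist_add_dist (s := K) (x := y n) (y := x)
      have h3 := dist_triangle_left (p n) x (y n)
      exact ⟨hp n, by rw [mem_closedBall]; linarith [hpy n]⟩
    obtain ⟨q, hq, ψ, hψ, hψq⟩ := ((isCompact_closedBall x _).inter_left hK).tendsto_subseq hbd
    have hyψ := hy.comp hψ.tendsto_atTop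
    have h1 : dist x q = infDist x K :=
      tendsto_nhds_unique (hyψ.dist hψq)
        ((((continuous_infDist_pt K).tendsto x).comp hyψ).congr fun n => (hpy (ψ n)).symm)
    have h2 := h q hq.1 (by rw [dist_comm, h1])
    have h3 : (-0 : ℝ) ≤ inner ℝ (q - x) u :=
      le_of_tendsto_of_tendsto' (htend.comp hψ.tendsto_atTop).neg
        (Filter.Tendsto.inner (hψq.sub hyψ) tendsto_const_nhds) fun n => (hpu (ψ n)).le
    linarith
  refine ⟨ρ, hρ, fun y hy s hs hys => ?_⟩
  obtain ⟨p, hp, hpy⟩ := hK.exists_infDist_eq_dist hKne (y + s • u)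
  have h1 := hc _ hys p hp hpy.symm
  have hs2 : s < 2 * ρ := by
    have h2 := dist_triangle_right (y + s • u) y x
    rw [dist_eq_norm, add_sub_cancel_left, norm_smul, hu, mul_one, Real.norm_of_nonneg hs.le] at h2
    linarith [mem_ball.1 hy, mem_ball.1 hys]
  refine (infDist_le_dist_of_mem hp).trans_lt ?_
  rw [hpy]
  refine lt_of_pow_lt_pow_left₀ 2 dist_nonneg ?_
  have h3 : dist y p ^ 2 = dist (y + s • u) p ^ 2 + 2 * s * inner ℝ (p - (y + s • u)) u + s ^ 2 := by
    rw [dist_comm y, dist_comm (y + s • u), dist_eq_norm, dist_eq_norm,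
      show p - y = (p - (y + s • u)) + s • u by abel, norm_add_sq_real, inner_smul_right, norm_smul,
      hu, mul_one, Real.norm_of_nonneg hs.le]
    ring
  rw [h3]
  have h4 := mul_le_mul_of_nonneg_left h1 hs.le
  have h5 := mul_lt_mul_of_pos_left hs2 hs
  linarith [sq s]

/-- An orthonormal frame of the plane with prescribed second vector. -/
theorem exists_orthonormal_frame {u : E2} (hu : ‖u‖ = 1) :
    ∃ v : E2, ‖v‖ = 1 ∧ inner ℝ u v = 0 ∧ ∀ y : E2, y = inner ℝ y v • v + inner ℝ y u • u := by
  have hu2 : u 0 ^ 2 + u 1 ^ 2 = 1 := by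
    have := EuclideanSpace.norm_sq_eq u
    rw [hu, Fin.sum_univ_two, Real.norm_eq_abs, Real.norm_eq_abs, sq_abs, sq_abs] at this
    linarith
  refine ⟨!₂[-u 1, u 0], ?_, ?_, fun y => ?_⟩
  · rw [EuclideanSpace.norm_eq, Fin.sum_univ_two, Real.sqrt_eq_one]
    simp only [Real.norm_eq_abs, sq_abs]
    simp
    linarith
  · simp [PiLp.inner_apply, Fin.sum_univ_two]
    ring
  · ext i
    fin_cases i
    · simp [PiLp.inner_apply, Fin.sum_univ_two]
      linear_combination -y 0 * hu2
    · simp [PiLp.inner_apply, Fin.sum_univ_two]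
      linear_combination -y 1 * hu2

/-- A level set of a continuous function that strictly increases in a direction near a point is
a graph near that point. -/
theorem exists_isArcChart {D : E2 → ℝ} (hD : Continuous D) {x u : E2} (hu : ‖u‖ = 1) {ρ : ℝ}
    (hρ : 0 < ρ)
    (h : ∀ y ∈ ball x ρ, ∀ s > (0 : ℝ), y + s • u ∈ ball x ρ → D y < D (y + s • u)) :
    ∃ π c W r, IsArcChart {z | D z = D x} π c W r ∧ x ∈ W := by
  obtain ⟨v, hv, huv, hframe⟩ := exists_orthonormal_frame hu
  set f : ℝ → ℝ → ℝ := fun t s => D (x + t • v + s • u) with hf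
  have hfc : Continuous fun z : ℝ × ℝ => f z.1 z.2 := hD.comp (by fun_prop)
  set s₀ := ρ / 2 with hs₀
  have hs0 : 0 < s₀ := by positivity
  have hball : ∀ t s : ℝ, |t| < s₀ → |s| ≤ s₀ → x + t • v + s • u ∈ ball x ρ := by
    intro t s ht hs
    rw [mem_ball, dist_eq_norm, show x + t • v + s • u - x = t • v + s • u by abel]
    refine (norm_add_le _ _).trans_lt ?_
    rw [norm_smul, norm_smul, hu, hv, mul_one, mul_one, Real.norm_eq_abs, Real.norm_eq_abs]
    linarith
  have hmono : ∀ t : ℝ, |t| < s₀ → StrictMonoOn (f t) (Icc (-s₀) s₀) := by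
    intro t ht s hs s' hs' hss
    have h1 := h _ (hball t s ht (abs_le.2 hs)) (s' - s) (sub_pos.2 hss)
    rw [show x + t • v + s • u + (s' - s) • u = x + t • v + s' • u by module] at h1
    exact h1 (hball t s' ht (abs_le.2 hs'))
  have hf0 : f 0 0 = D x := by simp [hf]
  have h00 : |(0 : ℝ)| < s₀ := by rwa [abs_zero]
  have hlow : f 0 (-s₀) < D x := hf0 ▸ hmono 0 h00 ⟨le_rfl, by linarith⟩ ⟨by linarith, hs0.le⟩
    (by linarith)
  have hupp : D x < f 0 s₀ := hf0 ▸ hmono 0 h00 ⟨by linarith, hs0.le⟩ ⟨by linarith, le_rfl⟩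
    (by linarith)
  have hfs : ∀ s, Continuous fun t => f t s := fun s => hfc.comp (by fun_prop : Continuous fun t => (t, s))
  obtain ⟨t₁, ht₁, ht₁f⟩ := Metric.eventually_nhds_iff.1
    ((((hfs (-s₀)).tendsto 0).eventually (gt_mem_nhds hlow)).and
      (((hfs s₀).tendsto 0).eventually (lt_mem_nhds hupp)))
  set r := min t₁ s₀ / 2 with hr
  have hr0 : 0 < r := by positivity
  have hrlt : r < min t₁ s₀ := by linarith [lt_min ht₁ hs0]
  have habs : ∀ t ∈ Icc (-r) r, |t| < s₀ := fun t ht =>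
    (abs_le.2 ht).trans_lt (hrlt.trans_le (min_le_right _ _))
  have hbd : ∀ t ∈ Icc (-r) r, f t (-s₀) < D x ∧ D x < f t s₀ := fun t ht =>
    ht₁f (by
      rw [Real.dist_eq, sub_zero]
      exact (abs_le.2 ht).trans_lt (hrlt.trans_le (min_le_left _ _)))
  have hex : ∀ t ∈ Icc (-r) r, ∃ s ∈ Icc (-s₀) s₀, f t s = D x := fun t ht =>
    intermediate_value_Icc (by linarith)
      (hfc.comp (by fun_prop : Continuous fun s => (t, s))).continuousOn
      ⟨(hbd t ht).1.le, (hbd t ht).2.le⟩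
  choose! g hg hgf using hex
  have hlt : ∀ t ∈ Icc (-r) r, ∀ s ∈ Icc (-s₀) s₀, s < g t ↔ f t s < D x := fun t ht s hs => by
    rw [← hgf t ht, (hmono t (habs t ht)).lt_iff_lt hs (hg t ht)]
  have hgt : ∀ t ∈ Icc (-r) r, ∀ s ∈ Icc (-s₀) s₀, g t < s ↔ D x < f t s := fun t ht s hs => by
    rw [← hgf t ht, (hmono t (habs t ht)).lt_iff_lt (hg t ht) hs]
  have hleft : -s₀ ∈ Icc (-s₀) s₀ := ⟨le_rfl, by linarith⟩
  have hright : s₀ ∈ Icc (-s₀) s₀ := ⟨by linarith, le_rfl⟩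
  have hgc : ContinuousOn g (Icc (-r) r) := by
    intro t ht
    refine tendsto_order.2 ⟨fun a ha => ?_, fun a ha => ?_⟩
    · have hm : max a (-s₀) ∈ Icc (-s₀) s₀ :=
        ⟨le_max_right _ _, max_le (ha.le.trans (hg t ht).2) (by linarith)⟩
      have h1 := (hlt t ht _ hm).1 (max_lt ha ((hlt t ht _ hleft).2 (hbd t ht).1))
      filter_upwards [self_mem_nhdsWithin,
        ((hfs _).continuousWithinAt (s := Icc (-r) r)).eventually (gt_mem_nhds h1)] with t' ht' h2
      exact (le_max_left _ _).trans_lt ((hlt t' ht' _ hm).2 h2)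
    · have hm : min a s₀ ∈ Icc (-s₀) s₀ :=
        ⟨le_min ((hg t ht).1.trans ha.le) (by linarith), min_le_right _ _⟩
      have h1 := (hgt t ht _ hm).1 (lt_min ha ((hgt t ht _ hright).2 (hbd t ht).2))
      filter_upwards [self_mem_nhdsWithin,
        ((hfs _).continuousWithinAt (s := Icc (-r) r)).eventually (lt_mem_nhds h1)] with t' ht' h2
      exact ((hgt t' ht' _ hm).2 h2).trans_le (min_le_left _ _)
  refine ⟨fun y => inner ℝ (y - x) v, fun t => x + t • v + g t • u,
    {y | |inner ℝ (y - x) v| < r} ∩ {y | |inner ℝ (y - x) u| < s₀}, r, ?_, ?_⟩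
  · refine ⟨hr0, by fun_prop, by fun_prop, hgf, fun t ht => ?_, ?_, fun y hy => abs_lt.1 hy.2.1, ?_⟩
    · rw [show x + t • v + g t • u - x = t • v + g t • u by abel, inner_add_left, inner_smul_left,
        inner_smul_left, huv, real_inner_self_eq_norm_sq, hv]
      simp
    · exact (isOpen_lt (by fun_prop) continuous_const).inter
        (isOpen_lt (by fun_prop) continuous_const)
    · rintro y ⟨hyD, hy1, hy2⟩
      have h1 : y = x + inner ℝ (y - x) v • v + inner ℝ (y - x) u • u := by
        rw [add_assoc, ← hframe (y - x)]
        abel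
      have ht : inner ℝ (y - x) v ∈ Icc (-r) r := abs_le.1 (le_of_lt hy1)
      have h2 : g (inner ℝ (y - x) v) = inner ℝ (y - x) u := by
        refine (hmono _ (habs _ ht)).injOn (hg _ ht) (abs_le.1 (le_of_lt hy2)) ?_
        rw [hgf _ ht]
        simp only [hf]
        rw [← h1]
        exact hyD.symm
      rw [h2, ← h1]
  · simp [hr0, hs0]

/-- A bounded connected level set of a distance function, with uniform bounded turning of the
level sets slightly below it, is a Jordan curve. -/
theorem isJordanCurve_infDist_level {K : Set E2} (hK : IsClosed K) (hKne : K.Nonempty) {ε C : ℝ}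
    (hC : 0 ≤ C) (hε : 0 < ε) (hX : IsCompact {z | infDist z K = ε})
    (hc : IsPreconnected {z | infDist z K = ε}) (hnt : {z | infDist z K = ε}.Nontrivial)
    (hBT : ∀ e, 0 < e → e < ε → ε / 2 ≤ e → BoundedTurning {z | infDist z K = e} C) :
    IsJordanCurve {z | infDist z K = ε} := by
  refine isJordanCurve_of_arcCharts hX hnt.nonempty hc fun x hx => ?_
  have hacc : ∀ ρ > 0, ∃ w, infDist w K = ε ∧ w ≠ x ∧ dist w x < ρ := by
    intro ρ hρ
    obtain ⟨w, hw, hwx⟩ := hnt.exists_ne x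
    by_contra! hcon
    obtain ⟨z, hz, hz1 : dist z x = min (ρ / 2) (dist w x)⟩ := hc.intermediate_value hx hw
      (f := fun z => dist z x) (continuous_id.dist continuous_const).continuousOn
      (show min (ρ / 2) (dist w x) ∈ Icc (dist x x) (dist w x) from
        ⟨(dist_self x).trans_le (le_min (by positivity) dist_nonneg), min_le_right _ _⟩)
    have hz0 : 0 < dist z x := by
      rw [hz1]
      exact lt_min (by positivity) (dist_pos.2 hwx)
    have := hcon z hz (dist_pos.1 hz0)
    rw [hz1] at this
    linarith [min_le_left (ρ / 2) (dist w x)]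
  obtain ⟨u, hu0, hu⟩ := exists_inner_neg_of_boundedTurning hK hC hε hx hacc hBT
  have hun : 0 < ‖u‖ := norm_pos_iff.2 hu0
  obtain ⟨ρ, hρ, hmono⟩ := exists_strictMono_direction hK hKne (x := x) (u := ‖u‖⁻¹ • u)
    (by rw [norm_smul, norm_inv, norm_norm, inv_mul_cancel₀ hun.ne']) fun p hp hpx => by
      rw [inner_smul_right]
      exact mul_neg_of_pos_of_neg (inv_pos.2 hun) (hu p hp (hpx.trans hx))
  have := exists_isArcChart (continuous_infDist_pt K)
    (by rw [norm_smul, norm_inv, norm_norm, inv_mul_cancel₀ hun.ne']) hρ hmono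
  rwa [show infDist x K = ε from hx] at this

/-- The piecewise linear function rising from `0` at `e - η` to `1` at `e + η`. -/
def ramp (e η t : ℝ) : ℝ := max 0 (min 1 ((t - e + η) / (2 * η)))

theorem ramp_nonneg (e η t : ℝ) : 0 ≤ ramp e η t := le_max_left _ _

theorem ramp_le_one (e η t : ℝ) : ramp e η t ≤ 1 := max_le zero_le_one (min_le_left _ _)

theorem ramp_mono (e : ℝ) {η : ℝ} (hη : 0 < η) : Monotone (ramp e η) := fun s t hst => by
  unfold ramp
  gcongr

theorem continuous_ramp (e η : ℝ) : Continuous (ramp e η) := by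
  unfold ramp
  fun_prop

theorem ramp_center (e : ℝ) {η : ℝ} (hη : 0 < η) : ramp e η e = 1 / 2 := by
  have : (e - e + η) / (2 * η) = 1 / 2 := by field_simp; ring
  rw [ramp, this]
  norm_num

theorem ramp_of_le (e : ℝ) {η t : ℝ} (hη : 0 < η) (ht : t ≤ e - η) : ramp e η t = 0 := by
  refine max_eq_left ((min_le_right _ _).trans ?_)
  exact div_nonpos_of_nonpos_of_nonneg (by linarith) (by linarith)

theorem ramp_of_ge (e : ℝ) {η t : ℝ} (hη : 0 < η) (ht : e + η ≤ t) : ramp e η t = 1 := by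
  have : 1 ≤ (t - e + η) / (2 * η) := by
    rw [le_div_iff₀ (by linarith)]
    linarith
  rw [ramp, min_eq_left this, max_eq_right zero_le_one]

theorem abs_ramp_sub_le (e : ℝ) {η : ℝ} (hη : 0 < η) (s t : ℝ) :
    |ramp e η s - ramp e η t| ≤ 1 / (2 * η) * |s - t| := by
  unfold ramp
  have h1 := abs_max_sub_max_le_max (0 : ℝ) (min 1 ((s - e + η) / (2 * η))) 0
    (min 1 ((t - e + η) / (2 * η)))
  have h2 := abs_min_sub_min_le_max (1 : ℝ) ((s - e + η) / (2 * η)) 1 ((t - e + η) / (2 * η))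
  rw [sub_self, abs_zero] at h1 h2
  replace h1 := h1.trans_eq (max_eq_right (abs_nonneg _))
  replace h2 := h2.trans_eq (max_eq_right (abs_nonneg _))
  refine (h1.trans h2).trans (le_of_eq ?_)
  rw [show (s - e + η) / (2 * η) - (t - e + η) / (2 * η) = 1 / (2 * η) * (s - t) by ring, abs_mul,
    abs_of_pos (a := 1 / (2 * η)) (by positivity)]

/-- There is a gauge that grows by prescribed summable amounts across prescribed windows that
shrink to zero. -/
theorem exists_gaugeF_jump {e η a : ℕ → ℝ} (hη : ∀ n, 0 < η n) (hηe : ∀ n, η n ≤ e n)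
    (he : ∀ n : ℕ, e n ≤ 1 / ((n : ℝ) + 1)) (ha : ∀ n, 0 < a n) (ha' : ∀ n, a n ≤ (1 / 2) ^ n) :
    ∃ φ, GaugeF φ ∧ ∀ n, a n ≤ φ (e n) ∧ ∀ t, 0 ≤ t → |φ t - φ (e n)| < a n → |t - e n| < η n := by
  set g : ℕ → ℝ → ℝ := fun n t => 2 * a n * ramp (e n) (η n) t with hg
  have hg0 : ∀ n t, 0 ≤ g n t := fun n t =>
    mul_nonneg (by linarith [ha n]) (ramp_nonneg _ _ _)
  have hgm : ∀ n, Monotone (g n) := fun n s t hst =>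
    mul_le_mul_of_nonneg_left (ramp_mono _ (hη n) hst) (by linarith [ha n])
  have hgb : ∀ n t, ‖g n t‖ ≤ 2 * (1 / 2) ^ n := fun n t => by
    rw [Real.norm_of_nonneg (hg0 n t)]
    calc g n t ≤ 2 * a n * 1 :=
          mul_le_mul_of_nonneg_left (ramp_le_one _ _ _) (by linarith [ha n])
      _ ≤ _ := by linarith [ha' n]
  have hsum : Summable fun n : ℕ => (2 : ℝ) * (1 / 2) ^ n := summable_geometric_two.mul_left 2
  have hgs : ∀ t, Summable fun n => g n t := fun t => hsum.of_norm_bounded fun n => hgb n t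
  set φ : ℝ → ℝ := fun t => t + ∑' n, g n t with hφ
  have hφc : Continuous φ := continuous_id.add
    (continuous_tsum (fun n => continuous_const.mul (continuous_ramp _ _)) hsum hgb)
  have hinc : ∀ n s t, s ≤ t → t - s + (g n t - g n s) ≤ φ t - φ s := by
    intro n s t hst
    have h1 : g n t - g n s ≤ ∑' m, (g m t - g m s) :=
      ((hgs t).sub (hgs s)).le_tsum n fun m _ => sub_nonneg.2 (hgm m hst)
    rw [(hgs t).tsum_sub (hgs s)] at h1
    simp only [hφ]
    linarith
  have hmono : StrictMono φ := fun s t hst => by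
    have := hinc 0 s t hst.le
    linarith [hgm 0 hst.le]
  have h0 : φ 0 = 0 := by
    have : ∀ n, g n 0 = 0 := fun n => by
      simp only [hg]
      rw [ramp_of_le _ (hη n) (by linarith [hηe n]), mul_zero]
    simp [hφ, this]
  have hge : ∀ t, 0 ≤ t → t ≤ φ t := fun t ht => by
    have := hinc 0 0 t ht
    rw [h0] at this
    linarith [hgm 0 ht]
  refine ⟨φ, ⟨hφc.continuousOn, hmono.strictMonoOn _, ?_, h0, ⟨1, one_pos, ?_⟩, ?_⟩, fun n => ⟨?_, ?_⟩⟩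
  · intro t ht
    obtain ⟨s, hs, hst⟩ := intermediate_value_Icc (show (0 : ℝ) ≤ t from ht) hφc.continuousOn
      (show t ∈ Icc (φ 0) (φ t) from ⟨by rw [h0]; exact ht, hge t ht⟩)
    exact ⟨s, hs.1, hst⟩
  · filter_upwards [self_mem_nhdsWithin] with t ht
    rw [one_mul]
    exact hge t (le_of_lt ht)
  · intro r hr
    obtain ⟨N, hN⟩ := exists_nat_one_div_lt (show 0 < r / 2 by positivity)
    have hconst : ∀ n t, r ≤ t → g (n + N) t = 2 * a (n + N) := fun n t ht => by
      have h1 : 1 / (((n + N : ℕ) : ℝ) + 1) ≤ 1 / ((N : ℝ) + 1) := by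
        apply one_div_le_one_div_of_le (by positivity)
        push_cast
        linarith [n.cast_nonneg (α := ℝ)]
      simp only [hg]
      rw [ramp_of_ge _ (hη _) (by linarith [hηe (n + N), he (n + N)]), mul_one]
    have hφr : ∀ t, r ≤ t →
        φ t = t + (∑ n ∈ Finset.range N, g n t + ∑' n, 2 * a (n + N)) := fun t ht => by
      simp only [hφ]
      rw [← (hgs t).sum_add_tsum_nat_add N]
      simp only [hconst _ t ht]
    have hL : 0 ≤ 1 + ∑ n ∈ Finset.range N, a n / η n :=
      add_nonneg zero_le_one (Finset.sum_nonneg fun n _ => div_nonneg (ha n).le (hη n).le)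
    refine ⟨Real.toNNReal (1 + ∑ n ∈ Finset.range N, a n / η n), LipschitzOnWith.of_dist_le_mul fun s hs t ht => ?_⟩
    rw [Real.dist_eq, Real.dist_eq, hφr s hs, hφr t ht, Real.coe_toNNReal _ hL, add_mul, one_mul,
      Finset.sum_mul, add_sub_add_comm, add_sub_add_right_eq_sub, ← Finset.sum_sub_distrib]
    refine (abs_add_le _ _).trans (add_le_add_right ((Finset.abs_sum_le_sum_abs _ _).trans
      (Finset.sum_le_sum fun n _ => ?_)) _)
    simp only [hg]
    rw [← mul_sub, abs_mul, abs_of_pos (by linarith [ha n] : 0 < 2 * a n)]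
    refine (mul_le_mul_of_nonneg_left (abs_ramp_sub_le _ (hη n) s t)
      (by linarith [ha n])).trans (le_of_eq ?_)
    have := (hη n).ne'
    field_simp
  · have := hinc n 0 (e n) ((hη n).le.trans (hηe n))
    rw [h0] at this
    simp only [hg] at this
    rw [ramp_center _ (hη n), ramp_of_le _ (hη n) (by linarith [hηe n])] at this
    linarith [hη n, hηe n]
  · intro t ht hlt
    by_contra! hcon
    rcases le_abs.1 hcon with h1 | h1
    · have h2 := hinc n (e n) t (by linarith [hη n])
      simp only [hg] at h2
      rw [ramp_center _ (hη n), ramp_of_ge _ (hη n) (by linarith)] at h2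
      linarith [(abs_lt.1 hlt).2, hη n]
    · have h2 := hinc n t (e n) (by linarith [hη n])
      simp only [hg] at h2
      rw [ramp_center _ (hη n), ramp_of_le _ (hη n) (by linarith)] at h2
      linarith [(abs_lt.1 hlt).1, hη n]

/-- The horizontal projection of space to the plane. -/
def planeProj (p : E3) : E2 := !₂[p 0, p 1]

theorem continuous_planeProj : Continuous planeProj := by
  unfold planeProj
  fun_prop

theorem planeProj_mk3 (x : E2) (z : ℝ) : planeProj (mk3 x z) = x := by
  ext i
  fin_cases i <;> simp [planeProj, mk3]

theorem dist_mk3_sq (x y : E2) (z w : ℝ) :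
    dist (mk3 x z) (mk3 y w) ^ 2 = dist x y ^ 2 + (z - w) ^ 2 := by
  rw [EuclideanSpace.dist_eq, EuclideanSpace.dist_eq, Real.sq_sqrt (by positivity),
    Real.sq_sqrt (by positivity), Fin.sum_univ_two, Fin.sum_univ_three]
  simp [mk3, Real.dist_eq]

theorem dist_le_dist_mk3 (x y : E2) (z w : ℝ) : dist x y ≤ dist (mk3 x z) (mk3 y w) := by
  refine le_of_sq_le_sq ?_ dist_nonneg
  rw [dist_mk3_sq]
  linarith [sq_nonneg (z - w)]

theorem abs_sub_le_dist_mk3 (x y : E2) (z w : ℝ) : |z - w| ≤ dist (mk3 x z) (mk3 y w) := by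
  refine le_of_sq_le_sq ?_ dist_nonneg
  rw [dist_mk3_sq, sq_abs]
  linarith [sq_nonneg (dist x y)]

theorem dist_mk3_same (x y : E2) (z : ℝ) : dist (mk3 x z) (mk3 y z) = dist x y := by
  rw [← sq_eq_sq₀ dist_nonneg dist_nonneg, dist_mk3_sq, sub_self]
  ring

/-- Inside an open set, the distances to the boundary and to the complement agree. -/
theorem infDist_frontier_eq {Ω : Set E2} (hΩ : IsOpen Ω) (hne : (frontier Ω).Nonempty) {x : E2}
    (hx : x ∈ closure Ω) : infDist x (frontier Ω) = infDist x Ωᶜ := by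
  have hsub : frontier Ω ⊆ Ωᶜ := fun y hy => by
    rw [hΩ.frontier_eq] at hy
    exact hy.2
  refine le_antisymm ?_ (infDist_le_infDist_of_subset hsub hne)
  refine (le_infDist (hne.mono hsub)).2 fun k hk => ?_
  by_cases hxΩ : x ∈ Ω
  · have hseg : IsPreconnected (segment ℝ x k) := (convex_segment x k).isPreconnected
    obtain ⟨z, hz, hzf⟩ : ∃ z ∈ segment ℝ x k, z ∈ frontier Ω := by
      by_contra! hcon
      obtain ⟨z, -, hz, hz'⟩ := hseg Ω (closure Ω)ᶜ hΩ isClosed_closure.isOpen_compl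
        (fun z hz => by
          have := hcon z hz
          rw [hΩ.frontier_eq] at this
          by_contra! h1
          simp only [mem_union, mem_compl_iff, not_or, not_not] at h1
          exact this ⟨h1.2, h1.1⟩)
        ⟨x, left_mem_segment ℝ x k, hxΩ⟩
        ⟨k, right_mem_segment ℝ x k, fun h => hcon k (right_mem_segment ℝ x k)
          (by rw [hΩ.frontier_eq]; exact ⟨h, hk⟩)⟩
      exact hz' (subset_closure hz)
    refine (infDist_le_dist_of_mem hzf).trans ?_
    have := dist_add_dist_of_mem_segment hz
    linarith [dist_nonneg (x := z) (y := k)]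
  · rw [infDist_zero_of_mem (by rw [hΩ.frontier_eq]; exact ⟨hx, hxΩ⟩)]
    exact dist_nonneg

/-- If every double-dome-like surface over `Ω` satisfies `LLC₁`, the level sets have
bounded turning at small scales, uniformly near the boundary. -/
theorem exists_local_boundedTurning {Ω : Set E2} (hΩ : IsOpen Ω) (hne : (frontier Ω).Nonempty)
    (h : ∀ φ, GaugeF φ → ∃ lam, LLC1With (domeSurface Ω φ) lam) :
    ∃ C ≥ (1 : ℝ), ∃ ε₀ > 0, ∀ ε, 0 < ε → ε ≤ ε₀ → ∀ x y, infDist x Ωᶜ = ε → infDist y Ωᶜ = ε →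
      dist x y ≤ 1 / C → ∃ S ⊆ {z | infDist z Ωᶜ = ε} ∩ closedBall x (C * dist x y),
        IsPreconnected S ∧ x ∈ S ∧ y ∈ S := by
  by_contra! hcon
  choose e he0 he x y hx hy hxy hS using fun n : ℕ =>
    hcon (4 ^ n) (one_le_pow₀ (by norm_num)) (1 / ((n : ℝ) + 1)) (by positivity)
  have hs : ∀ n, 0 < dist (x n) (y n) := fun n => by
    rw [dist_pos]
    intro h0
    refine hS n {x n} ?_ isPreconnected_singleton rfl h0.symm
    exact singleton_subset_iff.2 ⟨hx n, mem_closedBall_self (by positivity)⟩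
  have hη : ∀ n, ∃ η > 0, ∀ S ⊆ closedBall (x n) (4 ^ n * dist (x n) (y n)) ∩
      {z | |infDist z Ωᶜ - e n| ≤ η}, IsPreconnected S → x n ∈ S → y n ∉ S := by
    intro n
    by_contra! hη
    obtain ⟨S, hSB, -, hSc, hxS, hyS⟩ := exists_continuum_of_forall_sublevel
      (isCompact_closedBall (x n) (4 ^ n * dist (x n) (y n)))
      (F := fun z => |infDist z Ωᶜ - e n|) (by fun_prop) hη
    refine hS n S (fun z hz => ⟨?_, (hSB hz).1⟩) hSc hxS hyS
    exact sub_eq_zero.1 (abs_nonpos_iff.1 (hSB hz).2)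
  choose η hη0 hη using hη
  obtain ⟨φ, hφ, hφj⟩ := exists_gaugeF_jump (e := e) (η := fun n => min (η n) (e n))
    (a := fun n => 2 ^ n * dist (x n) (y n)) (fun n => lt_min (hη0 n) (he0 n))
    (fun n => min_le_right _ _) he (fun n => mul_pos (by positivity) (hs n)) (fun n => by
      refine (mul_le_mul_of_nonneg_left (hxy n) (by positivity)).trans (le_of_eq ?_)
      rw [mul_one_div, ← div_pow]
      norm_num)
  obtain ⟨lam, hlam⟩ := h φ hφ
  obtain ⟨n, hn⟩ := pow_unbounded_of_one_lt (2 * lam) (one_lt_two (α := ℝ))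
  have hφ0 : ∀ t, 0 ≤ t → 0 ≤ φ t := fun t ht => by
    rw [← hφ.map_zero]
    exact hφ.strictMonoOn.monotoneOn self_mem_Ici ht ht
  have hcl : ∀ z, infDist z Ωᶜ = e n → z ∈ Ω ∧ infDist z (frontier Ω) = e n := fun z hz => by
    have hzΩ : z ∈ Ω := by
      by_contra h0
      rw [infDist_zero_of_mem h0] at hz
      exact (he0 n).ne hz
    exact ⟨hzΩ, (infDist_frontier_eq hΩ hne (subset_closure hzΩ)).trans hz⟩
  have hsurf : ∀ z, infDist z Ωᶜ = e n → mk3 z (φ (e n)) ∈ domeSurface Ω φ := fun z hz =>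
    ⟨z, subset_closure (hcl z hz).1, Or.inl (by rw [(hcl z hz).2])⟩
  obtain ⟨E, hE, -, hEc, hxE, hyE⟩ := hlam _ (hsurf _ (hx n)) (2 * dist (x n) (y n))
    (by linarith [hs n]) _ ⟨mem_ball_self (by linarith [hs n]), hsurf _ (hx n)⟩
    (mk3 (y n) (φ (e n))) ⟨by
      rw [mem_ball, dist_mk3_same, dist_comm]
      linarith [hs n], hsurf _ (hy n)⟩
  refine hη n (planeProj '' E) ?_
    (hEc.isPreconnected.image _ continuous_planeProj.continuousOn)
    ⟨_, hxE, planeProj_mk3 _ _⟩ ⟨_, hyE, planeProj_mk3 _ _⟩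
  rintro _ ⟨p, hp, rfl⟩
  obtain ⟨hpb, z, hz, hpz⟩ := hE hp
  rw [infDist_frontier_eq hΩ hne hz] at hpz
  have hpd : dist p (mk3 (x n) (φ (e n))) < 2 ^ n * dist (x n) (y n) :=
    (mem_ball.1 hpb).trans_le (by linarith [mul_le_mul_of_nonneg_right hn.le (hs n).le])
  have hd0 : 0 ≤ infDist z Ωᶜ := infDist_nonneg
  obtain ⟨hj1, hj2⟩ := hφj n
  have h24 : (2 : ℝ) ^ n * dist (x n) (y n) ≤ 4 ^ n * dist (x n) (y n) :=
    mul_le_mul_of_nonneg_right (pow_le_pow_left₀ (by norm_num) (by norm_num) n) (hs n).le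
  rcases hpz with rfl | rfl
  · rw [planeProj_mk3]
    refine ⟨mem_closedBall.2 ((dist_le_dist_mk3 _ _ _ _).trans (hpd.le.trans h24)), ?_⟩
    exact (hj2 _ hd0 ((abs_sub_le_dist_mk3 _ _ _ _).trans_lt hpd)).le.trans (min_le_left _ _)
  · have h1 := (neg_le_abs _).trans_lt ((abs_sub_le_dist_mk3 _ _ _ _).trans_lt hpd)
    linarith [hφ0 _ hd0]

theorem IsJordanCurve.isPreconnected {Γ : Set E2} (h : IsJordanCurve Γ) : IsPreconnected Γ := by
  obtain ⟨G, hG, rfl, -, -⟩ := h.exists_param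
  exact isPreconnected_range hG

theorem IsJordanCurve.isCompact {Γ : Set E2} (h : IsJordanCurve Γ) : IsCompact Γ := by
  obtain ⟨f, hf, -, rfl⟩ := h
  exact (isCompact_sphere 0 1).image_of_continuousOn hf

theorem IsJordanCurve.nonempty {Γ : Set E2} (h : IsJordanCurve Γ) : Γ.Nonempty := by
  obtain ⟨G, -, rfl, -, -⟩ := h.exists_param
  exact range_nonempty G

theorem BoundedTurning.mono {X : Set E2} {C C' : ℝ} (h : BoundedTurning X C) (hC : C ≤ C') :
    BoundedTurning X C' := fun x hx y hy => by
  obtain ⟨S, hS, h'⟩ := h x hx y hy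
  exact ⟨S, hS.trans (inter_subset_inter_right _
    (closedBall_subset_closedBall (mul_le_mul_of_nonneg_right hC dist_nonneg))), h'⟩

theorem TwoPointCondition.mono {Γ : Set E2} {C C' : ℝ} (h : TwoPointCondition Γ C) (hC : C ≤ C') :
    TwoPointCondition Γ C' := fun x hx y hy hxy => by
  obtain ⟨A, hA, h'⟩ := h x hx y hy hxy
  exact ⟨A, hA, h'.trans (mul_le_mul_of_nonneg_right hC dist_nonneg)⟩

theorem mem_of_infDist_compl_pos {Ω : Set E2} {z : E2} (h : 0 < infDist z Ωᶜ) : z ∈ Ω := by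
  by_contra h0
  exact h.ne' (infDist_zero_of_mem h0)

theorem levelSet_eq {Ω : Set E2} (hΩ : IsOpen Ω) (hne : (frontier Ω).Nonempty) {ε : ℝ}
    (hε : 0 < ε) : levelSet Ω ε = {z | infDist z Ωᶜ = ε} := by
  ext z
  rw [levelSet, if_neg hε.ne']
  constructor
  · rintro ⟨hz, h⟩
    exact (infDist_frontier_eq hΩ hne (subset_closure hz)).symm.trans h
  · intro h
    have hz : z ∈ Ω := mem_of_infDist_compl_pos (hε.trans_eq h.symm)
    exact ⟨hz, (infDist_frontier_eq hΩ hne (subset_closure hz)).trans h⟩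

theorem isCompact_infDist_level {Ω : Set E2} (hb : Bornology.IsBounded Ω) {ε : ℝ} (hε : 0 < ε) :
    IsCompact {z | infDist z Ωᶜ = ε} :=
  isCompact_of_isClosed_isBounded (isClosed_eq (continuous_infDist_pt _) continuous_const)
    (hb.subset fun _ hz => mem_of_infDist_compl_pos (hε.trans_eq hz.symm))

/-- The boundary of an open set with compact boundary is approximated by level sets. -/
theorem exists_level_near_frontier {Ω : Set E2} (hΩ : IsOpen Ω) (hc : IsCompact (frontier Ω))
    {δ : ℝ} (hδ : 0 < δ) :
    ∃ ε₁ > 0, ∀ ε, 0 < ε → ε ≤ ε₁ → ∀ p ∈ frontier Ω, ∃ x, infDist x Ωᶜ = ε ∧ dist x p < δ := by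
  rcases (frontier Ω).eq_empty_or_nonempty with h0 | hne
  · exact ⟨1, one_pos, fun ε _ _ p hp => absurd hp (h0 ▸ notMem_empty p)⟩
  have hsub : frontier Ω ⊆ Ωᶜ := fun y hy => by
    rw [hΩ.frontier_eq] at hy
    exact hy.2
  obtain ⟨t, htΩ, htf, ht⟩ := hc.elim_finite_subcover_image (b := Ω) (c := fun z => ball z δ)
    (fun _ _ => isOpen_ball) fun p hp => by
      obtain ⟨z, hz, hpz⟩ := Metric.mem_closure_iff.1 (frontier_subset_closure hp) δ hδ
      exact mem_iUnion₂.2 ⟨z, hz, hpz⟩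
  have hpos : ∀ z ∈ t, 0 < infDist z Ωᶜ := fun z hz =>
    (hΩ.isClosed_compl.notMem_iff_infDist_pos (hne.mono hsub)).1 (not_not.2 (htΩ hz))
  obtain ⟨ε₁, hε₁, hle⟩ : ∃ ε₁ > 0, ∀ z ∈ t, ε₁ ≤ infDist z Ωᶜ := by
    rcases t.eq_empty_or_nonempty with h0 | h0
    · exact ⟨1, one_pos, fun z hz => absurd hz (h0 ▸ notMem_empty z)⟩
    · obtain ⟨z, hz, hmin⟩ := htf.exists_minimalFor (fun z => infDist z Ωᶜ) t h0
      exact ⟨_, hpos z hz, fun w hw => (le_total _ _).elim id (hmin hw)⟩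
  refine ⟨ε₁ / 2, by positivity, fun ε hε hεle p hp => ?_⟩
  obtain ⟨z, hz, hpz⟩ := mem_iUnion₂.1 (ht hp)
  obtain ⟨τ, hτ0, hτ1, hτ⟩ := exists_infDist_eq_on_segment (hsub hp) hε.le
    (show ε < infDist z Ωᶜ by linarith [hle z hz])
  refine ⟨_, hτ, ?_⟩
  rw [dist_eq_norm, show z + τ • (p - z) - p = -((1 - τ) • (p - z)) by module, norm_neg, norm_smul,
    Real.norm_of_nonneg (by linarith), ← dist_eq_norm]
  exact (mul_le_of_le_one_left dist_nonneg (by linarith)).trans_lt hpz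

/-- Small-scale bounded turning of the level sets close to a connected boundary makes them
connected and of bounded turning at all scales. -/
theorem exists_boundedTurning {Ω : Set E2} (hΩ : IsOpen Ω) (hb : Bornology.IsBounded Ω)
    (hJ : IsJordanCurve (frontier Ω))
    (h : ∀ φ, GaugeF φ → ∃ lam, LLC1With (domeSurface Ω φ) lam) :
    ∃ C ≥ (1 : ℝ), ∃ ε₀ > 0, ∀ ε, 0 < ε → ε ≤ ε₀ →
      IsPreconnected {z | infDist z Ωᶜ = ε} ∧ BoundedTurning {z | infDist z Ωᶜ = ε} C := by
  obtain ⟨C, hC, ε₀, hε₀, hloc⟩ := exists_local_boundedTurning hΩ hJ.nonempty h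
  have hC0 : 0 < C := by linarith
  have hδ : 0 < 1 / C / 2 := by positivity
  obtain ⟨ε₁, hε₁, hnear⟩ := exists_level_near_frontier hΩ hJ.isCompact hδ
  obtain ⟨R, hR⟩ := Metric.isBounded_iff.1 hb
  refine ⟨max C (R * C), hC.trans (le_max_left _ _), min ε₀ (min ε₁ (1 / C / 4)), by positivity,
    fun ε hε hεle => ?_⟩
  have hle0 : ε ≤ ε₀ := hεle.trans (min_le_left _ _)
  have hle1 : ε ≤ ε₁ := hεle.trans ((min_le_right _ _).trans (min_le_left _ _))
  have hleδ : ε < 1 / C / 2 := by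
    have := hεle.trans ((min_le_right _ _).trans (min_le_right _ _))
    linarith
  set X := {z | infDist z Ωᶜ = ε} with hX
  have hXΩ : ∀ z ∈ X, z ∈ Ω := fun z hz => mem_of_infDist_compl_pos (hε.trans_eq hz.symm)
  have hproj : ∀ z ∈ X, ∃ p ∈ frontier Ω, dist p z < 1 / C / 2 := fun z hz => by
    obtain ⟨p, hp, hpz⟩ := hJ.isCompact.isClosed.exists_infDist_eq_dist hJ.nonempty z
    refine ⟨p, hp, ?_⟩
    rw [dist_comm, ← hpz, infDist_frontier_eq hΩ hJ.nonempty (subset_closure (hXΩ z hz))]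
    exact (le_of_eq hz).trans_lt hleδ
  have hpre : IsPreconnected X := by
    rcases X.eq_empty_or_nonempty with h0 | ⟨x₀, hx₀⟩
    · rw [h0]
      exact isPreconnected_empty
    set A := connectedComponentIn X x₀ with hA
    have hAX : A ⊆ X := connectedComponentIn_subset _ _
    have hx₀A : x₀ ∈ A := mem_connectedComponentIn hx₀
    have hApre : IsPreconnected A := isPreconnected_connectedComponentIn
    have hXA : X ⊆ A := by
      by_contra! hnot
      obtain ⟨b₀, hb₀, hb₀A⟩ := not_subset.1 hnot
      obtain ⟨p, -, hpU, hpV⟩ := hJ.isPreconnected (⋃ a ∈ A, ball a (1 / C / 2))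
        (⋃ b ∈ X \ A, ball b (1 / C / 2)) (isOpen_biUnion fun _ _ => isOpen_ball)
        (isOpen_biUnion fun _ _ => isOpen_ball)
        (fun p hp => by
          obtain ⟨x, hx, hxp⟩ := hnear ε hε hle1 p hp
          rw [dist_comm] at hxp
          by_cases hxA : x ∈ A
          · exact Or.inl (mem_iUnion₂.2 ⟨x, hxA, hxp⟩)
          · exact Or.inr (mem_iUnion₂.2 ⟨x, ⟨hx, hxA⟩, hxp⟩))
        (by
          obtain ⟨p, hp, hpz⟩ := hproj x₀ hx₀
          exact ⟨p, hp, mem_iUnion₂.2 ⟨x₀, hx₀A, hpz⟩⟩)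
        (by
          obtain ⟨p, hp, hpz⟩ := hproj b₀ hb₀
          exact ⟨p, hp, mem_iUnion₂.2 ⟨b₀, ⟨hb₀, hb₀A⟩, hpz⟩⟩)
      obtain ⟨a, ha, hpa⟩ := mem_iUnion₂.1 hpU
      obtain ⟨b, ⟨hbX, hbA⟩, hpb⟩ := mem_iUnion₂.1 hpV
      have hab : dist a b ≤ 1 / C := by
        have := dist_triangle_left a b p
        linarith [mem_ball.1 hpa, mem_ball.1 hpb]
      obtain ⟨S, hS, hSc, haS, hbS⟩ := hloc ε hε hle0 a b (hAX ha) hbX hab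
      have hU : IsPreconnected (A ∪ S) := hApre.union a ha haS hSc
      exact hbA (hU.subset_connectedComponentIn (Or.inl hx₀A)
        (union_subset hAX fun z hz => (hS hz).1) (Or.inr hbS))
    rwa [subset_antisymm hXA hAX]
  refine ⟨hpre, fun x hx y hy => ?_⟩
  by_cases hxy : dist x y ≤ 1 / C
  · obtain ⟨S, hS, hS'⟩ := hloc ε hε hle0 x y hx hy hxy
    exact ⟨S, hS.trans (inter_subset_inter_right _ (closedBall_subset_closedBall
      (mul_le_mul_of_nonneg_right (le_max_left _ _) dist_nonneg))), hS'⟩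
  · refine ⟨X, fun z hz => ⟨hz, ?_⟩, hpre, hx, hy⟩
    have hR0 : 0 ≤ R := dist_nonneg.trans (hR (hXΩ x hx) (hXΩ x hx))
    rw [mem_closedBall]
    have h1 : 1 ≤ C * dist x y := by
      have := (not_le.1 hxy).le
      rwa [div_le_iff₀ hC0, mul_comm] at this
    calc dist z x ≤ R * 1 := by rw [mul_one]; exact hR (hXΩ z hz) (hXΩ x hx)
      _ ≤ R * (C * dist x y) := mul_le_mul_of_nonneg_left h1 hR0
      _ = R * C * dist x y := by ring
      _ ≤ _ := mul_le_mul_of_nonneg_right (le_max_right _ _) dist_nonneg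

/-- Bounded turning passes from the level sets to the boundary. -/
theorem boundedTurning_frontier {Ω : Set E2} (hΩ : IsOpen Ω) (hc : IsCompact (frontier Ω))
    (hne : (frontier Ω).Nonempty) {C ε₀ : ℝ} (hC : 1 ≤ C) (hε₀ : 0 < ε₀)
    (h : ∀ ε, 0 < ε → ε ≤ ε₀ → BoundedTurning {z | infDist z Ωᶜ = ε} C) :
    BoundedTurning (frontier Ω) (3 * C + 1) := by
  intro x hx y hy
  rcases eq_or_ne x y with rfl | hxy
  · refine ⟨{x}, singleton_subset_iff.2 ⟨hx, mem_closedBall_self ?_⟩, isPreconnected_singleton,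
      rfl, rfl⟩
    rw [dist_self, mul_zero]
  set s := dist x y with hs
  have hs0 : 0 < s := dist_pos.2 hxy
  suffices hη : ∀ η > 0, ∃ S ⊆ closedBall x ((3 * C + 1) * s) ∩ {z | infDist z (frontier Ω) ≤ η},
      IsPreconnected S ∧ x ∈ S ∧ y ∈ S by
    obtain ⟨S, hSB, -, hS'⟩ := exists_continuum_of_forall_sublevel
      (isCompact_closedBall x ((3 * C + 1) * s)) (continuous_infDist_pt (frontier Ω)) hη
    refine ⟨S, fun z hz => ⟨?_, (hSB hz).1⟩, hS'⟩
    exact (hc.isClosed.mem_iff_infDist_zero hne).2 (le_antisymm (hSB hz).2 infDist_nonneg)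
  intro η hη
  set δ := min η s with hδ
  have hδ0 : 0 < δ := lt_min hη hs0
  have hδη : δ ≤ η := min_le_left _ _
  have hδs : δ ≤ s := min_le_right _ _
  have hCs : s ≤ C * s := le_mul_of_one_le_left hs0.le hC
  obtain ⟨ε₁, hε₁, hnear⟩ := exists_level_near_frontier hΩ hc hδ0
  set ε := min ε₁ (min ε₀ η) with hε
  have hε0 : 0 < ε := by positivity
  have hεη : ε ≤ η := (min_le_right _ _).trans (min_le_right _ _)
  obtain ⟨x', hx', hxx'⟩ := hnear ε hε0 (min_le_left _ _) x hx
  obtain ⟨y', hy', hyy'⟩ := hnear ε hε0 (min_le_left _ _) y hy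
  obtain ⟨S, hS, hSc, hxS, hyS⟩ :=
    h ε hε0 ((min_le_right _ _).trans (min_le_left _ _)) x' hx' y' hy'
  have hseg : ∀ p ∈ frontier Ω, ∀ q, dist q p < δ → ∀ z ∈ segment ℝ p q,
      infDist z (frontier Ω) ≤ η ∧ dist z p ≤ s := fun p hp q hq z hz => by
    have h1 := dist_add_dist_of_mem_segment hz
    rw [dist_comm p z, dist_comm p q] at h1
    have h2 : dist z p ≤ δ := by linarith [dist_nonneg (x := z) (y := q)]
    exact ⟨(infDist_le_dist_of_mem hp).trans (h2.trans hδη), h2.trans hδs⟩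
  refine ⟨segment ℝ x x' ∪ (S ∪ segment ℝ y y'), ?_, ?_, Or.inl (left_mem_segment ℝ x x'),
    Or.inr (Or.inr (left_mem_segment ℝ y y'))⟩
  · rintro z (hz | hz | hz)
    · obtain ⟨h1, h2⟩ := hseg x hx x' hxx' z hz
      exact ⟨mem_closedBall.2 (by linarith), h1⟩
    · obtain ⟨hzε, hzB⟩ := hS hz
      have hzΩ : z ∈ Ω := mem_of_infDist_compl_pos (hε0.trans_eq hzε.symm)
      refine ⟨mem_closedBall.2 ?_, ?_⟩
      · have h1 : dist x' y' ≤ 3 * s := by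
          have h2 := dist_triangle x' x y'
          have h3 := dist_triangle_right x y' y
          linarith
        have h4 := dist_triangle z x' x
        have h5 := mul_le_mul_of_nonneg_left h1 (by linarith : (0 : ℝ) ≤ C)
        linarith [mem_closedBall.1 hzB]
      · exact ((infDist_frontier_eq hΩ hne (subset_closure hzΩ)).trans hzε).le.trans hεη
    · obtain ⟨h1, h2⟩ := hseg y hy y' hyy' z hz
      have h3 := dist_triangle_right z x y
      exact ⟨mem_closedBall.2 (by linarith), h1⟩
  · refine (convex_segment x x').isPreconnected.union x' (right_mem_segment ℝ x x') (Or.inl hxS) ?_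
    exact hSc.union y' hyS (right_mem_segment ℝ y y') (convex_segment y y').isPreconnected

/-- The level sets of a bounded open set below the level of some point have two points. -/
theorem nontrivial_infDist_level {Ω : Set E2} (hb : Bornology.IsBounded Ω) {ε : ℝ} (hε : 0 ≤ ε)
    {z : E2} (hz : ε < infDist z Ωᶜ) : {w | infDist w Ωᶜ = ε}.Nontrivial := by
  obtain ⟨R, hR⟩ := Metric.isBounded_iff.1 hb
  have hzΩ : z ∈ Ω := mem_of_infDist_compl_pos (hε.trans_lt hz)
  have hR0 : 0 ≤ R := dist_nonneg.trans (hR hzΩ hzΩ)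
  set v : E2 := EuclideanSpace.single 0 (R + 1) with hv
  have hvn : ‖v‖ = R + 1 := by
    rw [hv, PiLp.norm_single, Real.norm_of_nonneg (by linarith)]
  have hout : ∀ w : E2, ‖w‖ = R + 1 → z + w ∈ Ωᶜ := fun w hw hmem => by
    have := hR hmem hzΩ
    rw [dist_eq_norm, add_sub_cancel_left, hw] at this
    linarith
  obtain ⟨σ, hσ0, -, hσ⟩ := exists_infDist_eq_on_segment (hout v hvn) hε hz
  obtain ⟨τ, hτ0, -, hτ⟩ := exists_infDist_eq_on_segment (hout (-v) (by rw [norm_neg, hvn])) hε hz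
  refine ⟨_, hσ, _, hτ, fun heq => ?_⟩
  have h1 : (σ + τ) • v = 0 := by
    rw [add_sub_cancel_left, add_sub_cancel_left, smul_neg] at heq
    have := add_left_cancel heq
    rw [add_smul, this, neg_add_cancel]
  rcases smul_eq_zero.1 h1 with h2 | h2
  · linarith
  · rw [h2, norm_zero] at hvn
    linarith

/-- Lemma 5.4: if Σ(Ω,φ) is LLC for every φ ∈ 𝓕, then Ω has the level quasicircle
property. -/
theorem stmt9 (Ω : Set E2) (hΩ : IsJordanDomain Ω)
    (h : ∀ φ : ℝ → ℝ, GaugeF φ → ∃ lam ≥ (1:ℝ), LLCWith (domeSurface Ω φ) lam) :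
    LevelQuasicircle Ω := by
  obtain ⟨hopen, hconn, hb, hJ⟩ := hΩ
  have hne := hJ.nonempty
  have hKne : (Ωᶜ).Nonempty := by
    obtain ⟨p, hp⟩ := hne
    rw [hopen.frontier_eq] at hp
    exact ⟨p, hp.2⟩
  obtain ⟨C, hC, ε₀, hε₀, hlev⟩ := exists_boundedTurning hopen hb hJ fun φ hφ => by
    obtain ⟨lam, -, hlam⟩ := h φ hφ
    exact ⟨lam, hlam.1⟩
  have hΓ := boundedTurning_frontier hopen hJ.isCompact hne hC hε₀ fun ε h0 h1 => (hlev ε h0 h1).2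
  obtain ⟨z, hz⟩ := hconn.nonempty
  have hz0 : 0 < infDist z Ωᶜ :=
    (hopen.isClosed_compl.notMem_iff_infDist_pos hKne).1 (not_not.2 hz)
  refine ⟨min ε₀ (infDist z Ωᶜ / 2), by positivity, 2 * (3 * C + 1), by linarith,
    fun ε hε hεle => ?_⟩
  have hle : ε ≤ ε₀ := hεle.trans (min_le_left _ _)
  rcases hε.eq_or_lt with rfl | hε
  · rw [levelSet, if_pos rfl]
    exact ⟨hJ, hΓ.twoPointCondition hJ⟩
  · have hεz : ε < infDist z Ωᶜ := by
      linarith [hεle.trans (min_le_right _ _)]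
    rw [levelSet_eq hopen hne hε]
    have hJε := isJordanCurve_infDist_level hopen.isClosed_compl hKne (zero_le_one.trans hC) hε
      (isCompact_infDist_level hb hε) (hlev ε hε hle).1 (nontrivial_infDist_level hb hε.le hεz)
      fun e he0 heε _ => (hlev e he0 (heε.le.trans hle)).2
    exact ⟨hJε, ((hlev ε hε hle).2.twoPointCondition hJε).mono (by linarith)⟩
end
end

section
/- Suppose Ω is a planar Jordan domain whose boundary ∂Ω satisfies the 2-point condition with some constant C > 1 (i.e., Ω is a quasidisk) but ∂Ω is not a c-chord-arc curve for any c > 1. Then there exists a gauge φ in the class F such that Σ(Ω,φ) is not quasisymmetric to the unit sphere S². -/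
open Metric Set MeasureTheory

noncomputable section

theorem sum_pow_le_of_dist_ge {κ : Type*} (s : Finset κ) (c : κ → E3) (ρ : κ → ℝ)
    (hρ : ∀ k ∈ s, 0 < ρ k) (x : E3) (R : ℝ) (hR : 0 ≤ R)
    (hsub : ∀ k ∈ s, dist (c k) x + ρ k ≤ R)
    (hsep : ∀ k ∈ s, ∀ l ∈ s, k ≠ l → ρ k + ρ l ≤ dist (c k) (c l)) :
    ∑ k ∈ s, ρ k ^ 3 ≤ R ^ 3 := by
  set μ : Measure E3 := volume
  have h1 : μ (⋃ k ∈ s, ball (c k) (ρ k)) = ∑ k ∈ s, μ (ball (c k) (ρ k)) :=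
    measure_biUnion_finset
      (fun k hk l hl hkl => ball_disjoint_ball (hsep k hk l hl hkl))
      (fun _ _ => measurableSet_ball)
  have h2 : μ (⋃ k ∈ s, ball (c k) (ρ k)) ≤ μ (ball x R) :=
    measure_mono <| iUnion₂_subset fun k hk => ball_subset_ball' (by linarith [hsub k hk])
  have hfr : Module.finrank ℝ E3 = 3 := by simp
  have h3 : ∑ k ∈ s, μ (ball (c k) (ρ k)) =
      ENNReal.ofReal (∑ k ∈ s, ρ k ^ 3) * μ (ball 0 1) := by
    rw [ENNReal.ofReal_sum_of_nonneg (fun k hk => pow_nonneg (hρ k hk).le _), Finset.sum_mul]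
    refine Finset.sum_congr rfl fun k hk => ?_
    rw [Measure.addHaar_ball μ _ (hρ k hk).le, hfr]
  rw [h1, h3, Measure.addHaar_ball μ _ hR, hfr] at h2
  have h4 := (ENNReal.mul_le_mul_iff_left (measure_ball_pos μ 0 one_pos).ne'
    measure_ball_lt_top.ne).1 h2
  exact (ENNReal.ofReal_le_ofReal_iff (by positivity)).1 h4

theorem dist_le_dist_smul_of_norm_eq_one {p q : E3} (hp : ‖p‖ = 1) (hq : ‖q‖ = 1) {s t : ℝ}
    (hs : 1 ≤ s) (ht : 1 ≤ t) : dist p q ≤ dist (s • p) (t • q) := by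
  rw [dist_eq_norm, dist_eq_norm]
  refine le_of_sq_le_sq ?_ (norm_nonneg _)
  rw [@norm_sub_sq_real, @norm_sub_sq_real, inner_smul_left, inner_smul_right, norm_smul,
    norm_smul, hp, hq, Real.norm_of_nonneg (by linarith), Real.norm_of_nonneg (by linarith)]
  have := real_inner_le_norm p q
  rw [hp, hq] at this
  simp only [conj_trivial]
  have h1 : 0 ≤ s * t - 1 := by nlinarith
  nlinarith [mul_nonneg h1 (sub_nonneg.2 this), sq_nonneg (s - t)]

/-- Two-dimensional packing on the unit sphere, obtained by stacking balls radially. -/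
theorem sum_sq_le_of_sphere_separated {κ : Type*} (s : Finset κ) (q : κ → E3) (ρ : κ → ℝ)
    (hq : ∀ k ∈ s, ‖q k‖ = 1) (hρ : ∀ k ∈ s, 0 < ρ k) (x : E3) {D R : ℝ} (hD : 0 < D)
    (hsub : ∀ k ∈ s, dist (q k) x ≤ R) (hle : ∀ k ∈ s, ρ k ≤ D)
    (hsep : ∀ k ∈ s, ∀ l ∈ s, k ≠ l → ρ k + ρ l ≤ dist (q k) (q l)) (hR : 0 ≤ R) :
    D * ∑ k ∈ s, ρ k ^ 2 ≤ 8 * (R + 2 * D) ^ 3 := by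
  have key := sum_pow_le_of_dist_ge
    (s.sigma fun k => Finset.range (⌊D / ρ k⌋₊ + 1))
    (fun a => (1 + (a.2 : ℝ) * ρ a.1) • q a.1) (fun a => ρ a.1 / 2) ?_ x (R + 2 * D)
    (by positivity) ?_ ?_
  · rw [Finset.sum_sigma] at key
    have : D * ∑ k ∈ s, ρ k ^ 2 ≤ 8 * ∑ k ∈ s, ∑ _j ∈ Finset.range (⌊D / ρ k⌋₊ + 1),
        (ρ k / 2) ^ 3 := by
      rw [Finset.mul_sum, Finset.mul_sum]
      refine Finset.sum_le_sum fun k hk => ?_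
      have hk0 := hρ k hk
      rw [Finset.sum_const, Finset.card_range, nsmul_eq_mul]
      push_cast
      have h1 := (Nat.lt_floor_add_one (D / ρ k)).le
      rw [div_le_iff₀ hk0] at h1
      nlinarith [mul_le_mul_of_nonneg_right h1 (sq_nonneg (ρ k))]
    linarith
  · rintro ⟨k, j⟩ h
    simp only [Finset.mem_sigma] at h
    exact half_pos (hρ k h.1)
  · rintro ⟨k, j⟩ h
    simp only [Finset.mem_sigma, Finset.mem_range, Nat.lt_succ_iff] at h
    have hk0 := hρ k h.1
    have hj : (j : ℝ) * ρ k ≤ D := by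
      rw [← le_div_iff₀ hk0]
      exact (Nat.le_floor_iff (by positivity)).1 h.2
    have h1 : dist ((1 + (j : ℝ) * ρ k) • q k) (q k) = j * ρ k := by
      rw [dist_eq_norm, add_smul, one_smul, add_sub_cancel_left, norm_smul, hq k h.1, mul_one,
        Real.norm_of_nonneg (by positivity)]
    have h2 := dist_triangle ((1 + (j : ℝ) * ρ k) • q k) (q k) x
    have h3 := hsub k h.1
    have h4 := hle k h.1
    dsimp only
    linarith
  · rintro ⟨k, j⟩ h ⟨l, i⟩ h' hne
    simp only [Finset.mem_sigma] at h h'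
    have hk0 := hρ k h.1
    have hl0 := hρ l h'.1
    dsimp only
    by_cases hkl : k = l
    · subst hkl
      have hji : j ≠ i := fun e => hne (by rw [e])
      rw [dist_eq_norm, ← sub_smul, norm_smul, hq k h.1, mul_one, add_sub_add_left_eq_sub,
        ← sub_mul, norm_mul, Real.norm_of_nonneg hk0.le]
      have : (1 : ℝ) ≤ ‖(j : ℝ) - i‖ := by
        rw [Real.norm_eq_abs]
        have : (1 : ℤ) ≤ |(j : ℤ) - i| := Int.one_le_abs (by omega)
        exact_mod_cast this
      nlinarith
    · have h1 := hsep k h.1 l h'.1 hkl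
      have h2 := dist_le_dist_smul_of_norm_eq_one (hq k h.1) (hq l h'.1)
        (s := 1 + (j : ℝ) * ρ k) (t := 1 + (i : ℝ) * ρ l)
        (le_add_of_nonneg_right (by positivity)) (le_add_of_nonneg_right (by positivity))
      linarith

/-- The length-area estimate: a weakly quasisymmetric image in the sphere of a grid of `card P`
columns of height `N` forces `card P ≲ N`. -/
theorem card_le_of_grid {ι : Type*} (P : Finset ι) (N : ℕ) (hN : 1 ≤ N) (q : ι → ℕ → E3)
    {H : ℝ} (hH : 1 ≤ H) (hq : ∀ i ∈ P, ∀ j ≤ N, ‖q i j‖ = 1)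
    (hpos : ∀ i ∈ P, ∀ j < N, 0 < dist (q i j) (q i (j + 1)))
    (hsep : ∀ i ∈ P, ∀ j < N, ∀ i' ∈ P, ∀ j' ≤ N, (i, j) ≠ (i', j') →
      dist (q i j) (q i (j + 1)) ≤ H * dist (q i j) (q i' j'))
    (hdiam : ∀ i ∈ P, ∀ i' ∈ P, ∀ j ≤ N,
      dist (q i 0) (q i' j) ≤ H * dist (q i 0) (q i N)) :
    (P.card : ℝ) ≤ 3456 * H ^ 7 * N := by
  rcases P.eq_empty_or_nonempty with rfl | ⟨a, ha⟩
  · simp only [Finset.card_empty, Nat.cast_zero]; positivity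
  set D := dist (q a 0) (q a N) with hDdef
  have hH0 : 0 < H := by linarith
  have hD : 0 < D := by
    have h1 := hpos a ha 0 (by omega)
    have h2 := hdiam a ha a ha 1 hN
    simp only [zero_add] at h1
    exact pos_of_mul_pos_right (h1.trans_le h2) hH0.le
  have hDi : ∀ i ∈ P, D ≤ 2 * H * dist (q i 0) (q i N) := fun i hi => by
    have h1 := hdiam i hi a ha 0 (Nat.zero_le _)
    have h2 := hdiam i hi a ha N le_rfl
    have h3 := dist_triangle_left (q a 0) (q a N) (q i 0)
    linarith
  have hball : ∀ i ∈ P, ∀ j ≤ N, dist (q i j) (q a 0) ≤ H * D := fun i hi j hj => by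
    rw [dist_comm]; exact hdiam a ha i hi j hj
  have hpack := sum_sq_le_of_sphere_separated (P ×ˢ Finset.range N) (fun a => q a.1 a.2)
    (fun a => dist (q a.1 a.2) (q a.1 (a.2 + 1)) / (2 * H)) ?_ ?_ (q a 0) hD (R := H * D)
    ?_ ?_ ?_ (by positivity)
  · rw [Finset.sum_product] at hpack
    have hcol : ∀ i ∈ P, D ^ 2 / (16 * H ^ 4 * N) ≤
        ∑ j ∈ Finset.range N, (dist (q i j) (q i (j + 1)) / (2 * H)) ^ 2 := fun i hi => by
      have h1 := dist_le_range_sum_dist (q i) N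
      have h2 := sq_sum_le_card_mul_sum_sq (s := Finset.range N)
        (f := fun j => dist (q i j) (q i (j + 1)))
      rw [Finset.card_range] at h2
      simp only [div_pow]
      rw [← Finset.sum_div]
      set S := ∑ j ∈ Finset.range N, dist (q i j) (q i (j + 1))
      set S2 := ∑ j ∈ Finset.range N, dist (q i j) (q i (j + 1)) ^ 2
      have h3 : D ≤ 2 * H * S := (hDi i hi).trans (by gcongr)
      have h4 : D ^ 2 ≤ (2 * H * S) ^ 2 := by gcongr
      have hN0 : (0 : ℝ) < N := by exact_mod_cast hN
      rw [div_le_div_iff₀ (by positivity) (by positivity)]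
      calc D ^ 2 * (2 * H) ^ 2 ≤ (2 * H * S) ^ 2 * (2 * H) ^ 2 := by gcongr
        _ = 16 * H ^ 4 * S ^ 2 := by ring
        _ ≤ 16 * H ^ 4 * (N * S2) := by gcongr
        _ = S2 * (16 * H ^ 4 * N) := by ring
    have hsum := Finset.sum_le_sum hcol
    rw [Finset.sum_const, nsmul_eq_mul] at hsum
    have hN0 : (0 : ℝ) < N := by exact_mod_cast hN
    have h5 : D * (P.card * (D ^ 2 / (16 * H ^ 4 * N))) ≤ 8 * (H * D + 2 * D) ^ 3 :=
      (mul_le_mul_of_nonneg_left hsum hD.le).trans hpack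
    have h6 : 8 * (H * D + 2 * D) ^ 3 ≤ 8 * (3 * H * D) ^ 3 := by
      gcongr; nlinarith
    have h7 : D * (P.card * (D ^ 2 / (16 * H ^ 4 * N))) =
        D ^ 3 * (P.card / (16 * H ^ 4 * N)) := by ring
    have h8 : 8 * (3 * H * D) ^ 3 = D ^ 3 * (216 * H ^ 3) := by ring
    have h9 : P.card / (16 * H ^ 4 * N) ≤ 216 * H ^ 3 :=
      le_of_mul_le_mul_left (by linarith) (pow_pos hD 3)
    rw [div_le_iff₀ (by positivity)] at h9
    linarith
  · rintro ⟨i, j⟩ h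
    simp only [Finset.mem_product, Finset.mem_range] at h
    exact hq i h.1 j h.2.le
  · rintro ⟨i, j⟩ h
    simp only [Finset.mem_product, Finset.mem_range] at h
    have := hpos i h.1 j h.2
    positivity
  · rintro ⟨i, j⟩ h
    simp only [Finset.mem_product, Finset.mem_range] at h
    exact hball i h.1 j h.2.le
  · rintro ⟨i, j⟩ h
    simp only [Finset.mem_product, Finset.mem_range] at h
    have h1 := hball i h.1 j h.2.le
    have h2 := hball i h.1 (j + 1) h.2
    have h3 := dist_triangle_right (q i j) (q i (j + 1)) (q a 0)
    rw [div_le_iff₀ (by positivity)]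
    linarith
  · rintro ⟨i, j⟩ h ⟨i', j'⟩ h' hne
    simp only [Finset.mem_product, Finset.mem_range] at h h'
    have h1 := hsep i h.1 j h.2 i' h'.1 j' h'.2.le hne
    have h2 := hsep i' h'.1 j' h'.2 i h.1 j h.2.le hne.symm
    rw [dist_comm (q i' j') (q i j)] at h2
    rw [← add_div, div_le_iff₀ (by positivity)]
    dsimp only
    linarith

/-- There are gauges growing from `0` as fast as desired along a given sequence. -/
theorem exists_gaugeF_ge (ε : ℕ → ℝ) (hε : ∀ n, 0 < ε n) :
    ∃ φ : ℝ → ℝ, GaugeF φ ∧ ∀ n, (1 / 2 : ℝ) ^ n ≤ φ (ε n) := by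
  set g : ℕ → ℝ → ℝ := fun n t => (1 / 2) ^ n * min 1 (t / ε n) with hg
  have hsum : Summable fun n : ℕ => (1 / 2 : ℝ) ^ n := summable_geometric_two
  have hg0 : ∀ n t, 0 ≤ t → 0 ≤ g n t := fun n t ht => by
    have := hε n
    positivity
  have hg1 : ∀ n t, g n t ≤ (1 / 2) ^ n := fun n t =>
    mul_le_of_le_one_right (by positivity) (min_le_left _ _)
  have hgs : ∀ t, 0 ≤ t → Summable fun n => g n t := fun t ht =>
    hsum.of_nonneg_of_le (fun n => hg0 n t ht) fun n => hg1 n t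
  have hmono : ∀ n a b, a ≤ b → g n a ≤ g n b := fun n a b hab => by
    have := hε n
    simp only [hg]
    gcongr
  have hgcont : ContinuousOn (fun t => ∑' n, g n t) (Ici 0) := by
    refine continuousOn_tsum (u := fun n => (1 / 2 : ℝ) ^ n) (fun n => ?_) hsum fun n t ht => ?_
    · exact Continuous.continuousOn (by fun_prop)
    · rw [Real.norm_of_nonneg (hg0 n t ht)]
      exact hg1 n t
  have hS0 : ∀ t, 0 ≤ t → 0 ≤ ∑' n, g n t := fun t ht => tsum_nonneg fun n => hg0 n t ht
  have hcont : ContinuousOn (fun t => t + ∑' n, g n t) (Ici 0) := continuousOn_id.add hgcont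
  have hzero : (0 : ℝ) + ∑' n, g n 0 = 0 := by simp [hg]
  refine ⟨fun t => t + ∑' n, g n t, ⟨hcont, ?_, ?_, hzero, ⟨1, one_pos, ?_⟩, ?_⟩, ?_⟩
  · intro a ha b hb hab
    exact add_lt_add_of_lt_of_le hab
      ((hgs a ha).tsum_le_tsum (fun n => hmono n a b hab.le) (hgs b hb))
  · intro y hy
    have h := intermediate_value_Icc (mem_Ici.1 hy) (hcont.mono Icc_subset_Ici_self)
    obtain ⟨x, hx, hxy⟩ := h ⟨hzero.le.trans hy, le_add_of_nonneg_right (hS0 y hy)⟩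
    exact ⟨x, hx.1, hxy⟩
  · filter_upwards [self_mem_nhdsWithin] with t ht
    rw [one_mul]
    exact le_add_of_nonneg_right (hS0 t (le_of_lt ht))
  · intro r hr
    refine ⟨(1 + 2 / r).toNNReal, LipschitzOnWith.of_le_add_mul' _ ?_⟩
    intro a ha b hb
    have ha0 : 0 ≤ a := hr.le.trans ha
    have hb0 : 0 ≤ b := hr.le.trans hb
    have hterm : ∀ n, g n a ≤ g n b + (1 / 2) ^ n * (dist a b / r) := fun n => by
      have hn := hε n
      simp only [hg]
      rw [← mul_add]
      refine mul_le_mul_of_nonneg_left ?_ (by positivity)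
      rcases le_total (ε n) r with h | h
      · have : min 1 (b / ε n) = 1 := min_eq_left ((one_le_div hn).2 (h.trans hb))
        rw [this]
        exact (min_le_left _ _).trans (le_add_of_nonneg_right (by positivity))
      · have h1 : a / ε n ≤ b / ε n + dist a b / r := by
          have h2 : a ≤ b + dist a b := by
            have := le_abs_self (a - b)
            rw [← Real.dist_eq] at this
            linarith
          calc a / ε n ≤ (b + dist a b) / ε n := by gcongr
            _ = b / ε n + dist a b / ε n := add_div _ _ _
            _ ≤ b / ε n + dist a b / r := by gcongr
        rw [min_add_add_right 1 (b / ε n) (dist a b / r) |>.symm]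
        exact min_le_min (le_add_of_nonneg_right (by positivity)) h1
    have h3 : ∑' n, g n a ≤ ∑' n, (g n b + (1 / 2) ^ n * (dist a b / r)) :=
      (hgs a ha0).tsum_le_tsum hterm ((hgs b hb0).add (hsum.mul_right _))
    rw [(hgs b hb0).tsum_add (hsum.mul_right _), tsum_mul_right, tsum_geometric_two] at h3
    have h4 : a ≤ b + dist a b := by
      have := le_abs_self (a - b)
      rw [← Real.dist_eq] at this
      linarith
    have h5 : (1 + 2 / r) * dist a b = dist a b + 2 * (dist a b / r) := by ring
    linarith
  · intro n
    have h1 : g n (ε n) = (1 / 2) ^ n := by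
      simp [hg, div_self (hε n).ne']
    have h2 := (hgs _ (hε n).le).le_tsum n fun m _ => hg0 m _ (hε n).le
    rw [h1] at h2
    have := hε n
    dsimp only
    linarith

/-- Near a boundary point of an open set, every small distance to the boundary is attained. -/
theorem exists_forall_infDist_frontier_eq {Ω : Set E2} (hΩ : IsOpen Ω) {p : E2}
    (hp : p ∈ frontier Ω) {τ : ℝ} (hτ : 0 < τ) :
    ∃ ε > 0, ∀ t, 0 ≤ t → t ≤ ε →
      ∃ y ∈ closure Ω, dist y p ≤ τ ∧ infDist y (frontier Ω) = t := by
  classical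
  obtain ⟨y₀, hy₀, hd⟩ := Metric.mem_closure_iff.1 (frontier_subset_closure hp) τ hτ
  have hy₀f : y₀ ∉ frontier Ω := fun h => by
    rw [hΩ.frontier_eq] at h
    exact h.2 hy₀
  refine ⟨infDist y₀ (frontier Ω),
    (isClosed_frontier.notMem_iff_infDist_pos ⟨p, hp⟩).1 hy₀f, fun t ht0 ht => ?_⟩
  rcases ht0.eq_or_lt with rfl | ht0
  · exact ⟨p, frontier_subset_closure hp, by simpa using hτ.le, infDist_zero_of_mem hp⟩
  have hcont : Continuous fun y => if y ∈ closure Ω then infDist y (frontier Ω) else 0 :=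
    Continuous.if (fun a ha => infDist_zero_of_mem (frontier_closure_subset ha))
      (continuous_infDist_pt _) continuous_const
  obtain ⟨y, hy, hyt⟩ := (convex_ball p τ).isPreconnected.intermediate_value
    (mem_ball_self hτ) (by rwa [mem_ball, dist_comm]) hcont.continuousOn
    (show t ∈ Icc _ _ from ⟨by simp [infDist_zero_of_mem hp, ht0.le],
      by simpa [subset_closure hy₀] using ht⟩)
  by_cases hyc : y ∈ closure Ω
  · simp only [hyc, if_true] at hyt
    exact ⟨y, hyc, (mem_ball.1 hy).le, hyt⟩
  · simp only [hyc, if_false] at hyt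
    exact absurd hyt ht0.ne

/-- Linear bounds on the cardinality of separated sets bound the Hausdorff measure. -/
theorem hausdorffMeasure_one_le_of_card_le {S : Set E2} {K r : ℝ} (hr : 0 < r)
    (h : ∀ N : ℕ, 1 ≤ N → ∀ P : Finset E2, (P : Set E2) ⊆ S →
      (∀ p ∈ P, ∀ q ∈ P, p ≠ q → r / N ≤ dist p q) → (P.card : ℝ) ≤ K * N) :
    μH[1] S ≤ ENNReal.ofReal (2 * K * r) := by
  have hcover : ∀ N : ℕ, 1 ≤ N → ∃ P : Finset E2, (P.card : ℝ) ≤ K * N ∧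
      S ⊆ ⋃ p : P, closedBall (p : E2) (r / N) := by
    intro N hN
    set T : Set ℕ := {n | ∃ P : Finset E2, (P : Set E2) ⊆ S ∧
      (∀ p ∈ P, ∀ q ∈ P, p ≠ q → r / N ≤ dist p q) ∧ P.card = n}
    have hbdd : BddAbove T :=
      ⟨⌊K * N⌋₊, by rintro n ⟨P, h1, h2, rfl⟩; exact Nat.le_floor (h N hN P h1 h2)⟩
    obtain ⟨P, hPS, hPsep, hcard⟩ : sSup T ∈ T :=
      Nat.sSup_mem ⟨0, ∅, by simp, by simp, by simp⟩ hbdd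
    refine ⟨P, h N hN P hPS hPsep, fun x hx => ?_⟩
    by_contra hxP
    simp only [mem_iUnion, mem_closedBall, not_exists, not_le, Subtype.forall] at hxP
    have hxnot : x ∉ P := fun hxm => by
      have := hxP x hxm
      rw [dist_self] at this
      exact absurd this (not_lt.2 (by positivity))
    have hins : (insert x P).card ≤ sSup T := le_csSup hbdd ⟨insert x P, ?_, ?_, rfl⟩
    · rw [Finset.card_insert_of_notMem hxnot, ← hcard] at hins
      omega
    · rw [Finset.coe_insert]
      exact insert_subset hx hPS
    · intro p hp q hq hpq
      rcases Finset.mem_insert.1 hp with rfl | hp' <;> rcases Finset.mem_insert.1 hq with rfl | hq'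
      · exact absurd rfl hpq
      · exact (hxP q hq').le
      · rw [dist_comm]
        exact (hxP p hp').le
      · exact hPsep p hp' q hq' hpq
  choose! P hPcard hPcover using hcover
  have hdiam : ∀ N : ℕ, ∀ p : E2,
      ediam (closedBall p (r / N)) ≤ ENNReal.ofReal (2 * (r / N)) := fun N p => by
    rw [← closedEBall_ofReal (by positivity), ENNReal.ofReal_mul zero_le_two, ENNReal.ofReal_ofNat]
    exact ediam_closedEBall_le
  have hlim := Measure.hausdorffMeasure_le_liminf_sum 1 S (l := Filter.atTop)
    (ι := fun N : ℕ => P N) (fun N : ℕ => ENNReal.ofReal (2 * (r / N))) ?_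
    (fun N p => closedBall (p : E2) (r / N))
    (Filter.Eventually.of_forall fun N p => hdiam N p)
    ((Filter.eventually_ge_atTop 1).mono fun N hN => hPcover N hN)
  · refine hlim.trans ?_
    refine (Filter.liminf_le_liminf (v := fun _ => ENNReal.ofReal (2 * K * r)) ?_).trans
      (Filter.liminf_const _).le
    filter_upwards [Filter.eventually_ge_atTop 1] with N hN
    have hN0 : (0 : ℝ) < N := by exact_mod_cast hN
    calc ∑ p : P N, ediam (closedBall (p : E2) (r / N)) ^ (1 : ℝ)
        ≤ ∑ _p : P N, ENNReal.ofReal (2 * (r / N)) := by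
          refine Finset.sum_le_sum fun p _ => ?_
          rw [ENNReal.rpow_one]
          exact hdiam N p
      _ = ENNReal.ofReal ((P N).card * (2 * (r / N))) := by
          rw [Finset.sum_const, nsmul_eq_mul, Finset.card_univ, Fintype.card_coe,
            ENNReal.ofReal_mul (Nat.cast_nonneg _), ENNReal.ofReal_natCast]
      _ ≤ ENNReal.ofReal (K * N * (2 * (r / N))) := by
          gcongr
          exact hPcard N hN
      _ = ENNReal.ofReal (2 * K * r) := by
          congr 1
          field_simp
  · rw [← ENNReal.ofReal_zero]
    refine ENNReal.tendsto_ofReal ?_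
    simpa using (tendsto_const_div_atTop_nhds_zero_nat r).const_mul 2

/-- A quasicircle that is not chord-arc has, at arbitrarily small scales, separated sets of
cardinality much larger than linear. -/
theorem exists_separated_of_not_isChordArc {Γ : Set E2} (hΓ : IsJordanCurve Γ) {C : ℝ}
    (hC : 0 < C) (h2pt : TwoPointCondition Γ C) (hnot : ∀ c : ℝ, 1 < c → ¬ IsChordArc Γ c)
    {K s : ℝ} (hK : 0 ≤ K) (hs : 0 < s) :
    ∃ N : ℕ, 1 ≤ N ∧ ∃ δ > 0, N * δ ≤ s ∧ ∃ P : Finset E2, (P : Set E2) ⊆ Γ ∧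
      (∀ p ∈ P, ∀ q ∈ P, p ≠ q → δ ≤ dist p q) ∧
      (∀ p ∈ P, ∀ q ∈ P, dist p q ≤ 2 * (N * δ)) ∧ K * N < P.card := by
  by_contra! hcon
  have hball : ∀ x r, 0 < r → r ≤ s →
      μH[1] (Γ ∩ closedBall x r) ≤ ENNReal.ofReal (2 * K * r) := fun x r hr hrs => by
    refine hausdorffMeasure_one_le_of_card_le hr fun N hN P hPS hsep => ?_
    have hN0 : (0 : ℝ) < N := by exact_mod_cast hN
    have hNr : N * (r / N) = r := mul_div_cancel₀ r hN0.ne'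
    refine hcon N hN (r / N) (by positivity) (by rwa [hNr]) P
      (fun p hp => (hPS hp).1) hsep fun p hp q hq => ?_
    have h1 := mem_closedBall.1 (hPS hp).2
    have h2 := mem_closedBall.1 (hPS hq).2
    have h3 := dist_triangle_right p q x
    rw [hNr]
    linarith
  have hcpt : IsCompact Γ := by
    obtain ⟨f, hf, -, rfl⟩ := hΓ
    exact (isCompact_sphere _ _).image_of_continuousOn hf
  have hfin : μH[1] Γ < ⊤ := by
    obtain ⟨t, -, htfin, ht⟩ := hcpt.finite_cover_balls hs
    have hsub : Γ ⊆ ⋃ x ∈ t, Γ ∩ closedBall x s := fun y hy => by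
      obtain ⟨x, hx, hxy⟩ := mem_iUnion₂.1 (ht hy)
      exact mem_iUnion₂.2 ⟨x, hx, hy, ball_subset_closedBall hxy⟩
    exact (measure_mono hsub).trans_lt (measure_biUnion_lt_top htfin fun x _ =>
      (hball x s hs le_rfl).trans_lt ENNReal.ofReal_lt_top)
  set L := (μH[1] Γ).toReal
  have hL : 0 ≤ L := ENNReal.toReal_nonneg
  refine hnot (2 * K * C + L / s * C + 2)
    (by have : 0 ≤ 2 * K * C + L / s * C := by positivity
        linarith) ⟨hΓ, hfin, fun x hx y hy hxy => ?_⟩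
  obtain ⟨A, hA, hdiam⟩ := h2pt x hx y hy hxy
  refine ⟨A, hA, ?_⟩
  have hd : 0 < dist x y := dist_pos.2 hxy
  have hLs : 0 ≤ L / s := by positivity
  rcases le_total (C * dist x y) s with hle | hle
  · have hsub : A ⊆ Γ ∩ closedBall x (C * dist x y) := by
      obtain ⟨hAΓ, f, -, -, hf0, -, hfA⟩ := hA
      have hxA : x ∈ A := by
        rw [← hfA, ← hf0]
        exact mem_image_of_mem f ⟨le_rfl, zero_le_one⟩
      exact fun a ha => ⟨hAΓ ha,
        (dist_le_diam_of_mem (hcpt.isBounded.subset hAΓ) ha hxA).trans hdiam⟩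
    refine (measure_mono hsub).trans ((hball x _ (by positivity) hle).trans ?_)
    refine ENNReal.ofReal_le_ofReal ?_
    have : 0 ≤ (L / s * C + 2) * dist x y := by positivity
    linarith
  · refine (measure_mono hA.1).trans ?_
    rw [← ENNReal.ofReal_toReal hfin.ne]
    refine ENNReal.ofReal_le_ofReal ?_
    have h1 : L ≤ L / s * (C * dist x y) := by
      calc L = L / s * s := (div_mul_cancel₀ L hs.ne').symm
        _ ≤ _ := by gcongr
    have : 0 ≤ (2 * K * C + 2) * dist x y := by positivity
    linarith

theorem dist_mk3_le (x y : E2) (z w : ℝ) : dist (mk3 x z) (mk3 y w) ≤ dist x y + |z - w| :=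
  le_of_sq_le_sq
    (by nlinarith [dist_mk3_sq x y z w, sq_abs (z - w),
          mul_nonneg (dist_nonneg (x := x) (y := y)) (abs_nonneg (z - w))])
    (by positivity)

/-- Proposition 6.3: if Ω is a quasidisk whose boundary is not a chord-arc curve, then
there is a gauge φ ∈ 𝓕 for which Σ(Ω,φ) is not quasisymmetric to S². -/
theorem stmt12 (Ω : Set E2) (hΩ : IsJordanDomain Ω) (C : ℝ) (hC : 1 < C)
    (h2pt : TwoPointCondition (frontier Ω) C)
    (hnotca : ∀ c : ℝ, 1 < c → ¬ IsChordArc (frontier Ω) c) :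
    ∃ φ : ℝ → ℝ, GaugeF φ ∧ ¬ QSEquivSphere (domeSurface Ω φ) := by
  obtain ⟨hopen, -, -, hJ⟩ := hΩ
  have hconf : ∀ n : ℕ, ∃ N : ℕ, 1 ≤ N ∧ ∃ δ > 0, N * δ ≤ (1 / 2 : ℝ) ^ n ∧ ∃ P : Finset E2,
      (∀ p ∈ P, ∀ q ∈ P, p ≠ q → δ ≤ dist p q) ∧
      (∀ p ∈ P, ∀ q ∈ P, dist p q ≤ 2 * (N * δ)) ∧ (n : ℝ) * N < P.card ∧
      ∃ ε > 0, ∀ p ∈ P, ∀ t, 0 ≤ t → t ≤ ε →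
        ∃ y ∈ closure Ω, dist y p ≤ δ / 10 ∧ infDist y (frontier Ω) = t := by
    intro n
    obtain ⟨N, hN, δ, hδ, hNδ, P, hPΓ, hsep, hdiam, hcard⟩ :=
      exists_separated_of_not_isChordArc hJ (by linarith) h2pt hnotca n.cast_nonneg
        (s := (1 / 2 : ℝ) ^ n) (by positivity)
    have hne : P.Nonempty := by
      rw [← Finset.card_pos]
      exact_mod_cast (show (0 : ℝ) ≤ n * N by positivity).trans_lt hcard
    choose! e he hlev using fun p (hp : p ∈ P) =>
      exists_forall_infDist_frontier_eq hopen (hPΓ hp) (τ := δ / 10) (by positivity)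
    obtain ⟨p₀, hp₀, hmin⟩ := P.exists_min_image e hne
    exact ⟨N, hN, δ, hδ, hNδ, P, hsep, hdiam, hcard, e p₀, he p₀ hp₀,
      fun p hp t ht0 ht => hlev p hp t ht0 (ht.trans (hmin p hp))⟩
  choose N hN δ hδ hNδ P hsep hdiam hcard ε hε hlev using hconf
  obtain ⟨φ, hφ, hφε⟩ := exists_gaugeF_ge ε hε
  refine ⟨φ, hφ, ?_⟩
  rintro ⟨η, -, f, hf, hqs⟩
  set H := max 1 (η 4)
  have hqsH : ∀ x a b : domeSurface Ω φ, dist (x : E3) a ≤ 4 * dist (x : E3) b →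
      dist (f x : E3) (f a) ≤ H * dist (f x : E3) (f b) := fun x a b h =>
    (hqs x a b 4 four_pos h).trans (by gcongr; exact le_max_right _ _)
  obtain ⟨n, hn⟩ := exists_nat_ge (3456 * H ^ 7)
  have hpt : ∀ p ∈ P n, ∀ j ≤ N n, ∃ a : domeSurface Ω φ, ∃ y : E2,
      dist y p ≤ δ n / 10 ∧ (a : E3) = mk3 y (j * δ n) := fun p hp j hj => by
    have hz0 : 0 ≤ j * δ n := mul_nonneg (Nat.cast_nonneg _) (hδ n).le
    obtain ⟨t, ht0, ht⟩ := hφ.surjOn (mem_Ici.2 hz0)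
    have hz : j * δ n ≤ φ (ε n) := by
      have : (j : ℝ) * δ n ≤ N n * δ n :=
        mul_le_mul_of_nonneg_right (by exact_mod_cast hj) (hδ n).le
      linarith [hNδ n, hφε n]
    have htε : t ≤ ε n := (hφ.strictMonoOn.le_iff_le ht0 (hε n).le).1 (ht.le.trans hz)
    obtain ⟨y, hy, hyp, hyt⟩ := hlev n p hp t ht0 htε
    exact ⟨⟨mk3 y (j * δ n), y, hy, Or.inl (by rw [hyt, ht])⟩, y, hyp, rfl⟩
  have hne : Nonempty (domeSurface Ω φ) := by
    have hP : (P n).Nonempty := by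
      rw [← Finset.card_pos]
      exact_mod_cast (show (0 : ℝ) ≤ n * N n by positivity).trans_lt (hcard n)
    obtain ⟨p, hp⟩ := hP
    exact ⟨(hpt p hp 0 (Nat.zero_le _)).choose⟩
  choose! a y hy ha using hpt
  have hδ0 := hδ n
  have hyy : ∀ p ∈ P n, ∀ j ≤ N n, ∀ p' ∈ P n, ∀ j' ≤ N n,
      |dist (y p j) (y p' j') - dist p p'| ≤ δ n / 5 := fun p hp j hj p' hp' j' hj' => by
    have h1 := hy p hp j hj
    have h2 := hy p' hp' j' hj'
    have h3 := dist_dist_dist_le (y p j) (y p' j') p p'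
    rw [Real.dist_eq] at h3
    linarith
  have hlow : ∀ p ∈ P n, ∀ j ≤ N n, ∀ p' ∈ P n, ∀ j' ≤ N n, (p, j) ≠ (p', j') →
      δ n / 2 ≤ dist (a p j : E3) (a p' j') := fun p hp j hj p' hp' j' hj' hne => by
    rw [ha p hp j hj, ha p' hp' j' hj']
    by_cases hpp : p = p'
    · subst hpp
      have hjj : j ≠ j' := fun h => hne (by rw [h])
      refine le_trans ?_ (abs_sub_le_dist_mk3 _ _ _ _)
      rw [← sub_mul, abs_mul, abs_of_pos hδ0]
      have : (1 : ℝ) ≤ |(j : ℝ) - j'| := by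
        have : (1 : ℤ) ≤ |(j : ℤ) - j'| := Int.one_le_abs (by omega)
        exact_mod_cast this
      nlinarith
    · refine le_trans ?_ (dist_le_dist_mk3 _ _ _ _)
      have h1 := (abs_le.1 (hyy p hp j hj p' hp' j' hj')).1
      have h2 := hsep n p hp p' hp' hpp
      linarith
  have hstep : ∀ p ∈ P n, ∀ j < N n, dist (a p j : E3) (a p (j + 1)) ≤ 2 * δ n :=
    fun p hp j hj => by
    rw [ha p hp j hj.le, ha p hp (j + 1) hj]
    refine (dist_mk3_le _ _ _ _).trans ?_
    have h1 := (abs_le.1 (hyy p hp j hj.le p hp (j + 1) hj)).2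
    rw [dist_self] at h1
    have h2 : |(j : ℝ) * δ n - ((j + 1 : ℕ) : ℝ) * δ n| = δ n := by
      rw [abs_sub_comm]
      push_cast
      rw [add_mul, one_mul, add_sub_cancel_left, abs_of_pos hδ0]
    linarith
  have hup : ∀ p ∈ P n, ∀ p' ∈ P n, ∀ j ≤ N n,
      dist (a p 0 : E3) (a p' j) ≤ 4 * dist (a p 0 : E3) (a p (N n)) := fun p hp p' hp' j hj => by
    have hN1 : (1 : ℝ) ≤ N n := by exact_mod_cast hN n
    have hj1 : (j : ℝ) ≤ N n := by exact_mod_cast hj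
    rw [ha p hp 0 (Nat.zero_le _), ha p' hp' j hj, ha p hp (N n) le_rfl]
    have h1 := dist_mk3_le (y p 0) (y p' j) (((0 : ℕ) : ℝ) * δ n) (j * δ n)
    have h2 := abs_sub_le_dist_mk3 (y p 0) (y p (N n)) (((0 : ℕ) : ℝ) * δ n) (N n * δ n)
    have h3 := (abs_le.1 (hyy p hp 0 (Nat.zero_le _) p' hp' j hj)).2
    have h4 := hdiam n p hp p' hp'
    simp only [Nat.cast_zero, zero_mul] at h1 h2 ⊢
    rw [zero_sub, abs_neg, abs_of_nonneg (by positivity)] at h1 h2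
    nlinarith [mul_le_mul_of_nonneg_right hN1 hδ0.le, mul_le_mul_of_nonneg_right hj1 hδ0.le]
  have hbound := card_le_of_grid (P n) (N n) (hN n) (fun p j => (f (a p j) : E3)) (H := H)
    (le_max_left _ _) (fun p _ j _ => mem_sphere_zero_iff_norm.1 (f (a p j)).2) ?_ ?_ ?_
  · have h1 : 3456 * H ^ 7 * N n ≤ n * N n := by gcongr
    linarith [hcard n]
  · intro p hp j hj
    have h1 := hlow p hp j hj.le p hp (j + 1) hj (by simp)
    rw [dist_pos]
    intro h
    rw [hf.injective (Subtype.ext h), dist_self] at h1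
    linarith
  · intro p hp j hj p' hp' j' hj' hne
    refine hqsH _ _ _ ?_
    linarith [hlow p hp j hj.le p' hp' j' hj' hne, hstep p hp j hj]
  · exact fun p hp p' hp' j hj => hqsH _ _ _ (hup p hp p' hp' j hj)
end
end

section
/- There exists an absolute constant C > 1 with the following property. Let Ω ⊊ ℝ² ≅ ℂ be a simply connected domain, f a conformal map of the open unit disk 𝔹² onto Ω, and define F on the double circular cone C = {(x,z) ∈ 𝔹² × ℝ : |z| < 1 − |x|} by F(x,z) = (f(x), D_x · z), where D_x = dist(f(x), ∂Ω)/(1 − |x|). Then for every x₀ ∈ 𝔹² and all points (x₁,z₁), (x₂,z₂) ∈ C with x₁, x₂ ∈ B(x₀, (1−|x₀|)/2), one has C⁻¹ |f′(x₀)| |(x₁,z₁) − (x₂,z₂)| ≤ |F(x₁,z₁) − F(x₂,z₂)| ≤ C |f′(x₀)| |(x₁,z₁) − (x₂,z₂)|; that is, the restrictions of F/|f′(x₀)| to C ∩ (B(x₀,(1−|x₀|)/2) × ℝ) are uniformly bi-Lipschitz. -/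
open Metric Set

noncomputable section

/-- ℝ³, realized as the L²-product ℂ × ℝ (so that the metric is Euclidean). -/
abbrev P2 : Type := WithLp 2 (ℂ × ℝ)

def mkP2 (x : ℂ) (z : ℝ) : P2 := (WithLp.equiv 2 (ℂ × ℝ)).symm (x, z)

section Auxiliary

open Filter Topology Complex

theorem deriv_ne_zero_of_injOn {f : ℂ → ℂ} {U : Set ℂ} {a : ℂ} (hU : U ∈ 𝓝 a)
    (hf : DifferentiableOn ℂ f U) (hinj : InjOn f U) : deriv f a ≠ 0 := by
  intro h0
  have hfa : AnalyticAt ℂ f a := hf.analyticAt hU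
  have hna : ¬∀ᶠ z in 𝓝 a, f z - f a = 0 := by
    intro h
    have h1 : ∀ᶠ z in 𝓝[≠] a, z = a := by
      filter_upwards [nhdsWithin_le_nhds h, nhdsWithin_le_nhds hU] with z hz hzU
      exact hinj hzU (mem_of_mem_nhds hU) (sub_eq_zero.1 hz)
    have h2 := h1.and (eventually_mem_nhdsWithin : ∀ᶠ z in 𝓝[≠] a, z ∈ ({a}ᶜ : Set ℂ))
    obtain ⟨z, hz, hz'⟩ := h2.exists
    exact hz' hz
  have hsub : AnalyticAt ℂ (fun z ↦ f z - f a) a := hfa.sub analyticAt_const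
  obtain ⟨n, g, hg, hga, hfg⟩ := hsub.exists_eventuallyEq_pow_smul_nonzero_iff.2 hna
  have hn0 : n ≠ 0 := by
    rintro rfl
    apply hga
    simpa using hfg.self_of_nhds.symm
  have hn1 : n ≠ 1 := by
    rintro rfl
    apply hga
    have h1 : HasDerivAt (fun z ↦ f z - f a) 0 a := by
      simpa [h0] using hfa.differentiableAt.hasDerivAt.sub_const (f a)
    have h2 : HasDerivAt (fun z ↦ (z - a) ^ 1 • g z) (1 * g a + (a - a) * deriv g a) a := by
      simpa using! ((hasDerivAt_id a).sub_const a).mul hg.differentiableAt.hasDerivAt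
    have := (h2.congr_of_eventuallyEq hfg).unique h1
    simpa using this
  obtain ⟨c, hc⟩ := IsAlgClosed.exists_pow_nat_eq (g a) (Nat.pos_of_ne_zero hn0)
  have hc0 : c ≠ 0 := by rintro rfl; exact hga (by rw [← hc, zero_pow hn0])
  let k : ℂ → ℂ := fun z ↦ c * (g z / g a) ^ (1 / n : ℂ)
  have hk : AnalyticAt ℂ k a := by
    refine analyticAt_const.mul ((hg.div analyticAt_const hga).cpow analyticAt_const ?_)
    simp [div_self hga]
  have hka : k a = c := by simp [k, div_self hga]
  have hkn : ∀ z, k z ^ n = g z := by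
    intro z
    have hn' : (n : ℂ) ≠ 0 := by exact_mod_cast hn0
    simp only [k, mul_pow, hc, one_div, cpow_nat_inv_pow _ hn0]
    field_simp
  let h : ℂ → ℂ := fun z ↦ (z - a) * k z
  have hh : HasStrictDerivAt h c a := by
    have := HasStrictDerivAt.mul ((hasStrictDerivAt_id a).sub_const a) hk.hasStrictDerivAt
    simpa [hka] using! this
  have hha : h a = 0 := by simp [h]
  have hmap := hh.map_nhds_eq hc0
  have hζ := Complex.isPrimitiveRoot_exp n hn0
  set ζ := Complex.exp (2 * Real.pi * I / n)
  have hS : {z | z ∈ U ∧ f z - f a = (z - a) ^ n • g z} ∈ 𝓝 a := Filter.inter_mem hU hfg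
  have hI : h '' {z | z ∈ U ∧ f z - f a = (z - a) ^ n • g z} ∈ 𝓝 0 := by
    rw [← hha, ← hmap]; exact image_mem_map hS
  have hI2 : ∀ᶠ s in 𝓝 (0 : ℂ), ζ * s ∈ h '' {z | z ∈ U ∧ f z - f a = (z - a) ^ n • g z} := by
    have : Tendsto (fun s : ℂ ↦ ζ * s) (𝓝 0) (𝓝 0) := by
      have : Continuous fun s : ℂ ↦ ζ * s := by fun_prop
      simpa using this.tendsto 0
    exact this hI
  have hev := (nhdsWithin_le_nhds (s := {0}ᶜ) (Filter.inter_mem hI hI2))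
  obtain ⟨s, ⟨⟨x, ⟨hxU, hx⟩, hxs⟩, ⟨y, ⟨hyU, hy⟩, hys⟩⟩, hs0⟩ :=
    (Filter.inter_mem hev (self_mem_nhdsWithin (a := (0 : ℂ)))  |> Filter.nonempty_of_mem)
  have hfh : ∀ z, (z - a) ^ n • g z = h z ^ n := by
    intro z; simp [h, mul_pow, hkn]
  have hxy : x = y := by
    apply hinj hxU hyU
    have : f x - f a = f y - f a := by
      rw [hx, hy, hfh, hfh, hxs, hys, mul_pow, hζ.pow_eq_one, one_mul]
    exact sub_left_inj.1 this
  have hs : ζ * s = s := by rw [← hys, ← hxs, hxy]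
  have hζ1 : ζ = 1 := by
    have : (ζ - 1) * s = 0 := by linear_combination hs
    rcases mul_eq_zero.1 this with h | h
    · exact sub_eq_zero.1 h
    · exact absurd h hs0
  exact hζ.ne_one (by omega) hζ1

theorem exists_differentiableOn_log {U : Set ℂ} (hUo : IsOpen U) (hU : IsSimplyConnected U)
    {g : ℂ → ℂ} (hg : DifferentiableOn ℂ g U) (hg0 : ∀ z ∈ U, g z ≠ 0) {a b : ℂ} (ha : a ∈ U)
    (hb : exp b = g a) :
    ∃ L : ℂ → ℂ, DifferentiableOn ℂ L U ∧ L a = b ∧ ∀ z ∈ U, exp (L z) = g z := by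
  obtain ⟨L, hLc, hL⟩ := exists_continuousOn_eqOn_exp_comp hU hUo hg.continuousOn
    (by rintro ⟨z, hz, h⟩; exact hg0 z hz h)
  have hLd : DifferentiableOn ℂ L U := by
    intro z hz
    have hzU := hUo.mem_nhds hz
    exact (HasDerivAt.of_comp_left (hLc.continuousAt hzU) (hasDerivAt_exp (L z))
      (hg.differentiableAt hzU).hasDerivAt (exp_ne_zero _)
      (hL.eventuallyEq_of_mem hzU)).differentiableAt.differentiableWithinAt
  refine ⟨fun z ↦ L z + (b - L a), hLd.add_const _, by ring, fun z hz ↦ ?_⟩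
  have h1 : exp (L z) = g z := hL hz
  have h2 : exp (L a) = g a := hL ha
  rw [exp_add, exp_sub, h1, h2, hb, div_self (hg0 a ha), mul_one]

theorem isSimplyConnected_ball (a : ℂ) {r : ℝ} (hr : 0 < r) : IsSimplyConnected (ball a r) := by
  have := (convex_ball a r).contractibleSpace (nonempty_ball.2 hr)
  exact SimplyConnectedSpace.ofContractible _

/-- A lower Harnack inequality for zero-free holomorphic functions. -/
theorem norm_center_le_of_forall_ne_zero {G : ℂ → ℂ} {a x : ℂ} {r M : ℝ} (hr : 0 < r) (hM : 1 < M)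
    (hG : DifferentiableOn ℂ G (ball a r)) (hG0 : ∀ z ∈ ball a r, G z ≠ 0)
    (hGM : ∀ z ∈ ball a r, ‖G z‖ ≤ M * ‖G a‖) (hx : ‖x - a‖ ≤ 7 / 8 * r) :
    ‖G a‖ ≤ M ^ 14 * ‖G x‖ := by
  have ha := mem_ball_self (x := a) hr
  have hxr : x ∈ ball a r := by rw [mem_ball_iff_norm]; linarith
  have hGa := norm_pos_iff.2 (hG0 a ha)
  obtain ⟨ℓ, hℓ, hℓa, hexp⟩ := exists_differentiableOn_log isOpen_ball
    (isSimplyConnected_ball a hr) (g := fun z ↦ G z / G a) (hG.div_const _)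
    (fun z hz ↦ div_ne_zero (hG0 z hz) (hG0 a ha)) ha (b := 0) (by simp [div_self (hG0 a ha)])
  have hre : ∀ z ∈ ball a r, Real.exp (ℓ z).re = ‖G z‖ / ‖G a‖ := by
    intro z hz
    rw [← norm_exp, hexp z hz, norm_div]
  have hmaps : MapsTo (fun z ↦ a + z) (ball 0 r) (ball a r) := by
    intro z hz; simpa using hz
  have hB := borelCaratheodory_zero (f := fun z ↦ ℓ (a + z)) (M := Real.log M) (R := r)
    (z := x - a) (Real.log_pos hM) (hℓ.comp (by fun_prop) hmaps) (by
      intro z hz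
      have hz' := hmaps hz
      have h1 := hre _ hz'
      have h2 := (div_le_iff₀ hGa).2 (hGM _ hz')
      show (ℓ (a + z)).re ≤ Real.log M
      rw [Real.le_log_iff_exp_le (by linarith), h1]
      exact h2) hr (by simpa [dist_eq_norm] using hxr) (by simpa using hℓa)
  simp only [add_sub_cancel] at hB
  have hlog := Real.log_pos hM
  have h14 : ‖ℓ x‖ ≤ 14 * Real.log M := by
    refine hB.trans ?_
    rw [div_le_iff₀ (by linarith)]
    nlinarith
  have h3 : -(14 * Real.log M) ≤ (ℓ x).re :=
    (neg_le_neg h14).trans (neg_le_of_abs_le (abs_re_le_norm _))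
  have h4 : Real.exp (-(14 * Real.log M)) = (M ^ 14)⁻¹ := by
    rw [Real.exp_neg, mul_comm, Real.exp_mul, Real.exp_log (by linarith)]
    norm_cast
  have h5 := Real.exp_le_exp.2 h3
  rw [h4, hre x hxr, le_div_iff₀ hGa, inv_mul_le_iff₀ (by positivity)] at h5
  exact h5

/-- A logarithm of `(u - w) / (u₀ - w)` on a simply connected domain omitting `w` stays away from
`2πi` once the domain contains the disk about `u₀` through `w`. -/
theorem exists_log_away {Ω : Set ℂ} (hΩo : IsOpen Ω) (hΩ : IsSimplyConnected Ω) {u₀ w : ℂ}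
    (hw : w ∉ Ω) (hne : u₀ ≠ w) (hball : ball u₀ ‖u₀ - w‖ ⊆ Ω) :
    ∃ L : ℂ → ℂ, DifferentiableOn ℂ L Ω ∧ L u₀ = 0 ∧
      (∀ u ∈ Ω, exp (L u) = (u - w) / (u₀ - w)) ∧
      ∀ u ∈ Ω, 1 / 2 ≤ ‖L u - 2 * Real.pi * I‖ := by
  have hne' : u₀ - w ≠ 0 := sub_ne_zero.2 hne
  have hpos : 0 < ‖u₀ - w‖ := norm_pos_iff.2 hne'
  have hu₀ := mem_ball_self (x := u₀) hpos
  obtain ⟨L, hLd, hL0, hL⟩ := exists_differentiableOn_log hΩo hΩ (g := fun u ↦ (u - w) / (u₀ - w))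
    (by fun_prop) (fun z hz ↦ div_ne_zero (sub_ne_zero.2 (by rintro rfl; exact hw hz)) hne')
    (hball hu₀) (b := 0) (by simp [div_self hne'])
  refine ⟨L, hLd, hL0, hL, fun u hu ↦ ?_⟩
  by_contra! hlt
  set v := L u - 2 * Real.pi * I
  have hev : exp v = (u - w) / (u₀ - w) := by
    rw [← hL u hu]; simp [v, exp_sub, exp_two_pi_mul_I]
  have hev1 : ‖exp v - 1‖ < 1 := by
    have := norm_exp_sub_one_le (x := v) (by linarith)
    linarith
  have hub : u ∈ ball u₀ ‖u₀ - w‖ := by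
    rw [hev, div_sub_one hne', norm_div, div_lt_one hpos] at hev1
    rw [mem_ball_iff_norm]
    simpa using hev1
  have hslit : ∀ z ∈ ball u₀ ‖u₀ - w‖, (z - w) / (u₀ - w) ∈ slitPlane := by
    intro z hz
    have : (z - w) / (u₀ - w) = 1 + (z - u₀) / (u₀ - w) := by field_simp; ring
    rw [this]
    apply mem_slitPlane_of_norm_lt_one
    rw [norm_div, div_lt_one hpos]
    exact mem_ball_iff_norm.1 hz
  have heq : EqOn L (fun z ↦ log ((z - w) / (u₀ - w))) (ball u₀ ‖u₀ - w‖) := by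
    have hlogd : DifferentiableOn ℂ (fun z ↦ log ((z - w) / (u₀ - w))) (ball u₀ ‖u₀ - w‖) :=
      DifferentiableOn.clog (by fun_prop) hslit
    refine isOpen_ball.eqOn_of_deriv_eq (convex_ball _ _).isPreconnected (hLd.mono hball) hlogd
      (fun z hz ↦ ?_) hu₀ (by simp [hL0, div_self hne'])
    have hzΩ := hΩo.mem_nhds (hball hz)
    have hd : HasDerivAt (fun u ↦ (u - w) / (u₀ - w)) (1 / (u₀ - w)) z :=
      ((hasDerivAt_id z).sub_const w).div_const _
    rw [(hd.clog (hslit z hz)).deriv]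
    have h1 : HasDerivAt (fun u ↦ exp (L u)) (exp (L z) * deriv L z) z :=
      (hLd.differentiableAt hzΩ).hasDerivAt.cexp
    have h2 := h1.unique (hd.congr_of_eventuallyEq (Filter.mem_of_superset hzΩ hL))
    rw [← h2, hL z (hball hz), mul_div_cancel_left₀ _ (slitPlane_ne_zero (hslit z hz))]
  have hLu : L u = v := by
    rw [heq hub]
    simp only [← hev]
    have him := (abs_im_le_norm v).trans_lt hlt
    have := Real.pi_gt_three
    apply log_exp
    · linarith [neg_lt_of_abs_lt him]
    · linarith [lt_of_abs_lt him]
  have hv : v = L u - 2 * Real.pi * I := rfl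
  have : (2 * Real.pi * I : ℂ) = 0 := by linear_combination hLu + hv
  simp at this

theorem ball_infDist_frontier_subset {Ω : Set ℂ} (hΩo : IsOpen Ω) {u : ℂ} (hu : u ∈ Ω) :
    ball u (infDist u (frontier Ω)) ⊆ Ω := by
  rcases (infDist_nonneg (x := u) (s := frontier Ω)).eq_or_lt with h0 | h0
  · simp [← h0]
  refine (convex_ball u _).isPreconnected.subset_of_closure_inter_subset hΩo
    ⟨u, mem_ball_self h0, hu⟩ ?_
  rintro y ⟨hy, hyb⟩
  by_contra hyΩ
  have hyf : y ∈ frontier Ω := by rw [hΩo.frontier_eq]; exact ⟨hy, hyΩ⟩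
  have := infDist_le_dist_of_mem (x := u) hyf
  rw [mem_ball, dist_comm] at hyb
  linarith

/-- The constant in the growth estimate `norm_sub_le_mul_infDist`. -/
def growthConst : ℝ := Real.exp (2 * Real.pi + 2 * Real.pi * (4 * Real.pi) ^ 14) + 1

theorem one_lt_growthConst : 1 < growthConst := by
  have := Real.exp_pos (2 * Real.pi + 2 * Real.pi * (4 * Real.pi) ^ 14)
  unfold growthConst; linarith

section Koebe

variable {Ω : Set ℂ} {f : ℂ → ℂ} {a : ℂ} {R : ℝ}

/-- A holomorphic map into a simply connected proper subdomain, composed with a Möbius transform of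
the logarithm from `exists_log_away`, is a bounded zero-free function. -/
theorem exists_bounded_transform (hΩo : IsOpen Ω) (hΩ : IsSimplyConnected Ω) (hne : Ω ≠ univ)
    (hR : 0 < R) (hf : DifferentiableOn ℂ f (ball a R)) (hmaps : MapsTo f (ball a R) Ω) :
    ∃ (w : ℂ) (M : ℂ → ℂ), ‖f a - w‖ = infDist (f a) (frontier Ω) ∧ f a ≠ w ∧
      DifferentiableOn ℂ M (ball a R) ∧ M a = 0 ∧
      (∀ x ∈ ball a R, exp (M x) = (f x - w) / (f a - w)) ∧
      ∀ x ∈ ball a R, 1 / 2 ≤ ‖M x - 2 * Real.pi * I‖ := by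
  have haΩ := hmaps (mem_ball_self hR)
  obtain ⟨w, hw, hd⟩ := isClosed_frontier.exists_infDist_eq_dist
    (nonempty_frontier_iff.2 ⟨hΩ.nonempty, hne⟩) (f a)
  have hwΩ : w ∉ Ω := by rw [hΩo.frontier_eq] at hw; exact hw.2
  have haw : f a ≠ w := by rintro h; exact hwΩ (h ▸ haΩ)
  rw [dist_eq_norm] at hd
  obtain ⟨L, hLd, hL0, hL, hLb⟩ := exists_log_away hΩo hΩ hwΩ haw
    (hd ▸ ball_infDist_frontier_subset hΩo haΩ)
  exact ⟨w, L ∘ f, hd.symm, haw, hLd.comp hf hmaps, hL0, fun x hx ↦ hL _ (hmaps hx),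
    fun x hx ↦ hLb _ (hmaps hx)⟩

/-- A weak form of the Koebe quarter theorem. -/
theorem mul_norm_deriv_le_infDist (hΩo : IsOpen Ω) (hΩ : IsSimplyConnected Ω) (hne : Ω ≠ univ)
    (hR : 0 < R) (hf : DifferentiableOn ℂ f (ball a R)) (hmaps : MapsTo f (ball a R) Ω) :
    R * ‖deriv f a‖ ≤ 160 * infDist (f a) (frontier Ω) := by
  obtain ⟨w, M, hd, haw, hM, hMa, hexp, hMb⟩ := exists_bounded_transform hΩo hΩ hne hR hf hmaps
  have ha := mem_ball_self (x := a) hR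
  have hnhds := isOpen_ball.mem_nhds ha
  have haw' := sub_ne_zero.2 haw
  have hM0 : ∀ x ∈ ball a R, M x - 2 * Real.pi * I ≠ 0 := by
    intro x hx
    rw [← norm_pos_iff]; linarith [hMb x hx]
  have hG : DifferentiableOn ℂ (fun x ↦ (M x - 2 * Real.pi * I)⁻¹) (ball a R) :=
    (hM.sub_const _).inv hM0
  have hsub : closedBall a (R / 2) ⊆ ball a R := closedBall_subset_ball (by linarith)
  have hC := norm_deriv_le_of_forall_mem_sphere_norm_le (C := 2) (half_pos hR)
    (hG.diffContOnCl_ball hsub) (by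
      intro z hz
      rw [norm_inv]
      have := hMb z (hsub (sphere_subset_closedBall hz))
      exact inv_le_of_inv_le₀ (by norm_num) (by linarith))
  have hMd := (hM.differentiableAt hnhds).hasDerivAt
  have h1 : HasDerivAt (fun x ↦ exp (M x)) (exp (M a) * deriv M a) a := hMd.cexp
  have h2 : HasDerivAt (fun x ↦ (f x - w) / (f a - w)) (deriv f a / (f a - w)) a :=
    ((hf.differentiableAt hnhds).hasDerivAt.sub_const w).div_const _
  have h3 := h1.unique (h2.congr_of_eventuallyEq (Filter.mem_of_superset hnhds hexp))
  rw [hMa, exp_zero, one_mul] at h3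
  have h4 : HasDerivAt (fun x ↦ (M x - 2 * Real.pi * I)⁻¹) _ a :=
    (hMd.sub_const (2 * Real.pi * I)).fun_inv (hM0 a ha)
  rw [h4.deriv, hMa, h3] at hC
  have hd0 : 0 < ‖f a - w‖ := norm_pos_iff.2 haw'
  have hpi := Real.pi_pos
  simp only [zero_sub, norm_div, norm_neg, norm_pow, norm_mul, norm_ofNat, norm_real, norm_I,
    Real.norm_eq_abs, abs_of_pos hpi, mul_one] at hC
  rw [div_div, div_le_div_iff₀ (by positivity) (by positivity)] at hC
  rw [← hd]
  have hpi2 : Real.pi ^ 2 ≤ 10 := by nlinarith [Real.pi_lt_d2]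
  nlinarith

/-- Growth of a holomorphic map into a simply connected proper subdomain. -/
theorem norm_sub_le_mul_infDist (hΩo : IsOpen Ω) (hΩ : IsSimplyConnected Ω) (hne : Ω ≠ univ)
    (hR : 0 < R) (hf : DifferentiableOn ℂ f (ball a R)) (hmaps : MapsTo f (ball a R) Ω)
    {x : ℂ} (hx : ‖x - a‖ ≤ 7 / 8 * R) :
    ‖f x - f a‖ ≤ growthConst * infDist (f a) (frontier Ω) := by
  obtain ⟨w, M, hd, haw, hM, hMa, hexp, hMb⟩ := exists_bounded_transform hΩo hΩ hne hR hf hmaps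
  have ha := mem_ball_self (x := a) hR
  have hxR : x ∈ ball a R := by rw [mem_ball_iff_norm]; linarith
  have haw' := sub_ne_zero.2 haw
  have hM0 : ∀ x ∈ ball a R, M x - 2 * Real.pi * I ≠ 0 := by
    intro x hx
    rw [← norm_pos_iff]; linarith [hMb x hx]
  have hpi := Real.pi_gt_three
  have h2pi : ‖(2 * Real.pi * I : ℂ)‖ = 2 * Real.pi := by simp [abs_of_pos Real.pi_pos]
  have hGa : ‖(M a - 2 * Real.pi * I)⁻¹‖ = (2 * Real.pi)⁻¹ := by
    rw [hMa, zero_sub, norm_inv, norm_neg, h2pi]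
  have hH := norm_center_le_of_forall_ne_zero (G := fun x ↦ (M x - 2 * Real.pi * I)⁻¹)
    (M := 4 * Real.pi) hR (by linarith) ((hM.sub_const _).inv hM0)
    (fun z hz ↦ inv_ne_zero (hM0 z hz)) (by
      intro z hz
      have h4 : 4 * Real.pi * (2 * Real.pi)⁻¹ = 2 := by field_simp; norm_num
      rw [hGa, h4, norm_inv]
      exact inv_le_of_inv_le₀ (by norm_num) (by linarith [hMb z hz])) hx
  simp only [hGa, norm_inv] at hH
  have hpos := norm_pos_iff.2 (hM0 x hxR)
  rw [← div_eq_mul_inv, le_div_iff₀ hpos, inv_mul_le_iff₀ (by positivity)] at hH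
  have hMx : ‖M x‖ ≤ 2 * Real.pi + 2 * Real.pi * (4 * Real.pi) ^ 14 := by
    have := norm_add_le (M x - 2 * Real.pi * I) (2 * Real.pi * I)
    rw [sub_add_cancel, h2pi] at this
    linarith
  have hfx : f x - f a = (exp (M x) - 1) * (f a - w) := by
    rw [hexp x hxR]; field_simp; ring
  rw [hfx, norm_mul, hd]
  refine mul_le_mul_of_nonneg_right ?_ infDist_nonneg
  calc ‖exp (M x) - 1‖ ≤ ‖exp (M x)‖ + ‖(1 : ℂ)‖ := norm_sub_le _ _
    _ ≤ growthConst := by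
      rw [norm_one, growthConst, norm_exp]
      gcongr
      exact (re_le_norm _).trans hMx

end Koebe

section UnitDisk

variable {f : ℂ → ℂ}

theorem dslope_ne_zero_of_injOn {U : Set ℂ} (hU : IsOpen U) (hf : DifferentiableOn ℂ f U)
    (hinj : InjOn f U) {x y : ℂ} (hx : x ∈ U) (hy : y ∈ U) : dslope f y x ≠ 0 := by
  rcases eq_or_ne x y with rfl | h
  · rw [dslope_same]
    exact deriv_ne_zero_of_injOn (hU.mem_nhds hx) hf hinj
  · rw [dslope_of_ne _ h, slope_def_field]
    exact div_ne_zero (sub_ne_zero.2 fun h' ↦ h (hinj hx hy h')) (sub_ne_zero.2 h)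

theorem norm_sub_eq_norm_dslope_mul (f : ℂ → ℂ) (x y : ℂ) :
    ‖f x - f y‖ = ‖dslope f y x‖ * ‖x - y‖ := by
  rw [← norm_mul, mul_comm, ← smul_eq_mul, sub_smul_dslope]

theorem dslope_comm (f : ℂ → ℂ) (x y : ℂ) : dslope f x y = dslope f y x := by
  rcases eq_or_ne x y with rfl | h
  · rfl
  · rw [dslope_of_ne _ h, dslope_of_ne _ h.symm, slope_comm]

theorem norm_sub_le_norm_one_sub_conj_mul {a x : ℂ} (ha : ‖a‖ ≤ 1) (hx : ‖x‖ ≤ 1) :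
    ‖x - a‖ ≤ ‖1 - (starRingEnd ℂ) a * x‖ := by
  rw [← sq_le_sq₀ (norm_nonneg _) (norm_nonneg _)]
  have ha2 : normSq a ≤ 1 := by rw [normSq_eq_norm_sq]; nlinarith [norm_nonneg a]
  have hx2 : normSq x ≤ 1 := by rw [normSq_eq_norm_sq]; nlinarith [norm_nonneg x]
  simp only [← normSq_eq_norm_sq, normSq_apply, sub_re, sub_im, mul_re, mul_im, conj_re, conj_im,
    one_re, one_im] at *
  nlinarith [mul_nonneg (sub_nonneg.2 ha2) (sub_nonneg.2 hx2)]

theorem exists_closedBall_subset_image_ball (hf : DifferentiableOn ℂ f (ball 0 1))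
    (hinj : InjOn f (ball 0 1)) {u : ℂ} {s : ℝ} (hs : closedBall u s ⊆ f '' ball 0 1) :
    ∃ r < 1, closedBall u s ⊆ f '' ball 0 r := by
  have : Nonempty (Iio (1 : ℝ)) := ⟨⟨0, by simp⟩⟩
  have hmono : Monotone fun r : Iio (1 : ℝ) ↦ f '' ball 0 r :=
    fun r t hrt ↦ image_mono (ball_subset_ball hrt)
  have hopen : ∀ r : Iio (1 : ℝ), IsOpen (f '' ball 0 r) := by
    rcases (hf.analyticOnNhd isOpen_ball).is_constant_or_isOpen
      (convex_ball 0 1).isPreconnected with ⟨w, hw⟩ | h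
    · have h0 : (0 : ℂ) ∈ ball (0 : ℂ) 1 := by simp
      have h1 : (1 / 2 : ℂ) ∈ ball (0 : ℂ) 1 := by simp; norm_num
      have := hinj h0 h1 (by rw [hw _ h0, hw _ h1])
      norm_num at this
    · exact fun r ↦ h _ (ball_subset_ball r.2.le) isOpen_ball
  have hcover : closedBall u s ⊆ ⋃ r : Iio (1 : ℝ), f '' ball 0 r := by
    intro y hy
    obtain ⟨x, hx, rfl⟩ := hs hy
    rw [mem_ball_zero_iff] at hx
    refine mem_iUnion.2 ⟨⟨(‖x‖ + 1) / 2, ?_⟩, mem_image_of_mem f ?_⟩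
    · rw [mem_Iio]; linarith
    · rw [mem_ball_zero_iff]; show ‖x‖ < (‖x‖ + 1) / 2; linarith
  obtain ⟨⟨r, hr⟩, h⟩ := (isCompact_closedBall u s).elim_directed_cover _ hopen hcover
    hmono.directed_le
  exact ⟨r, hr, h⟩

theorem le_of_closedBall_subset_image (hf : DifferentiableOn ℂ f (ball 0 1))
    (hinj : InjOn f (ball 0 1)) {a : ℂ} (ha : a ∈ ball (0 : ℂ) 1) {s : ℝ}
    (hs : closedBall (f a) s ⊆ f '' ball 0 1) : s ≤ ‖deriv f a‖ * (1 - ‖a‖ ^ 2) := by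
  have ha1 : ‖a‖ < 1 := mem_ball_zero_iff.1 ha
  have hpos : 0 < 1 - ‖a‖ ^ 2 := by nlinarith [norm_nonneg a]
  rcases le_or_gt s 0 with hs0 | hs0
  · exact hs0.trans (by positivity)
  obtain ⟨r, hr1, hr⟩ := exists_closedBall_subset_image_ball hf hinj hs
  set ρ := max r ((1 + ‖a‖) / 2)
  have hρ1 : ρ < 1 := max_lt hr1 (by linarith)
  have haρ : ‖a‖ < ρ := lt_of_lt_of_le (by linarith) (le_max_right r ((1 + ‖a‖) / 2))
  have hfar : ∀ x, ‖x‖ = ρ → s < ‖f x - f a‖ := by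
    intro x hx
    by_contra! h
    obtain ⟨y, hy, hyx⟩ := hr (mem_closedBall_iff_norm.2 h)
    rw [mem_ball_zero_iff] at hy
    have := hinj (mem_ball_zero_iff.2 (hy.trans hr1)) (mem_ball_zero_iff.2 (by linarith)) hyx
    rw [this, hx] at hy
    exact (le_max_left r _).not_gt hy
  have hconj : ∀ x ∈ ball (0 : ℂ) 1, 1 - (starRingEnd ℂ) a * x ≠ 0 := by
    intro x hx h
    rw [mem_ball_zero_iff] at hx
    have : ‖(starRingEnd ℂ) a * x‖ = 1 := by rw [← sub_eq_zero.1 h, norm_one]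
    rw [norm_mul, RCLike.norm_conj] at this
    nlinarith [norm_nonneg a, norm_nonneg x]
  let H : ℂ → ℂ := fun x ↦ (dslope f a x * (1 - (starRingEnd ℂ) a * x))⁻¹
  have hH : DifferentiableOn ℂ H (ball 0 1) := by
    refine DifferentiableOn.inv (DifferentiableOn.mul
      ((differentiableOn_dslope (isOpen_ball.mem_nhds ha)).2 hf) (by fun_prop)) fun x hx ↦ ?_
    exact mul_ne_zero (dslope_ne_zero_of_injOn isOpen_ball hf hinj hx ha) (hconj x hx)
  have hmax := norm_le_of_forall_mem_frontier_norm_le (C := s⁻¹) isBounded_ball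
    (hH.diffContOnCl_ball (closedBall_subset_ball hρ1)) (by
      intro z hz
      have hz' := frontier_ball_subset_sphere hz
      rw [mem_sphere_zero_iff_norm] at hz'
      rw [norm_inv, norm_mul]
      apply inv_anti₀ hs0
      have h1 := hfar z hz'
      rw [norm_sub_eq_norm_dslope_mul] at h1
      have h2 := norm_sub_le_norm_one_sub_conj_mul ha1.le (hz'.trans_lt hρ1).le
      nlinarith [norm_nonneg (dslope f a z)])
    (subset_closure (mem_ball_zero_iff.2 haρ))
  have hHa : ‖H a‖ = (‖deriv f a‖ * (1 - ‖a‖ ^ 2))⁻¹ := by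
    have : (1 - (starRingEnd ℂ) a * a : ℂ) = ((1 - ‖a‖ ^ 2 : ℝ) : ℂ) := by
      rw [conj_mul']; push_cast; rfl
    simp only [H, dslope_same, this, norm_inv, norm_mul, norm_real, Real.norm_eq_abs,
      abs_of_pos hpos]
  have hda : 0 < ‖deriv f a‖ :=
    norm_pos_iff.2 (deriv_ne_zero_of_injOn (isOpen_ball.mem_nhds ha) hf hinj)
  rw [hHa] at hmax
  exact (inv_le_inv₀ (by positivity) hs0).1 hmax

/-- The upper half of the Koebe distortion estimate for the distance to the boundary. -/
theorem infDist_frontier_le (hf : DifferentiableOn ℂ f (ball 0 1)) (hinj : InjOn f (ball 0 1))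
    (hΩo : IsOpen (f '' ball 0 1)) {a : ℂ} (ha : a ∈ ball (0 : ℂ) 1) :
    infDist (f a) (frontier (f '' ball 0 1)) ≤ 2 * (1 - ‖a‖) * ‖deriv f a‖ := by
  have ha1 : ‖a‖ < 1 := mem_ball_zero_iff.1 ha
  refine le_of_forall_lt fun s hs ↦ ?_
  obtain ⟨t, hst, ht⟩ := exists_between hs
  have h := le_of_closedBall_subset_image hf hinj ha (s := t)
    ((closedBall_subset_ball ht).trans
      (ball_infDist_frontier_subset hΩo (mem_image_of_mem f ha)))
  nlinarith [mul_nonneg (norm_nonneg (deriv f a)) (sq_nonneg (1 - ‖a‖))]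

end UnitDisk

section Distortion

variable {f : ℂ → ℂ} {x₀ : ℂ}

theorem mem_ball_zero_of_mem_ball {x : ℂ} {t : ℝ} (hx₀ : ‖x₀‖ < 1) (ht : t ≤ 1)
    (hx : x ∈ ball x₀ (t * (1 - ‖x₀‖))) : x ∈ ball (0 : ℂ) 1 := by
  rw [mem_ball_iff_norm] at hx
  rw [mem_ball_zero_iff]
  have := norm_le_norm_add_norm_sub' x x₀
  nlinarith

theorem norm_deriv_le_mul_norm_deriv (hf : DifferentiableOn ℂ f (ball 0 1))
    (hinj : InjOn f (ball 0 1)) (hΩo : IsOpen (f '' ball 0 1))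
    (hΩ : IsSimplyConnected (f '' ball 0 1)) (hne : f '' ball 0 1 ≠ univ) (hx₀ : ‖x₀‖ < 1)
    {x : ℂ} (hx : x ∈ ball x₀ (3 / 4 * (1 - ‖x₀‖))) :
    ‖deriv f x‖ ≤ 32 * growthConst * ‖deriv f x₀‖ := by
  have hR : 0 < 1 - ‖x₀‖ := by linarith
  have hsub : ball x₀ (1 - ‖x₀‖) ⊆ ball 0 1 := fun y hy ↦
    mem_ball_zero_of_mem_ball hx₀ le_rfl (by simpa using hy)
  have hnear : ∀ y ∈ closedBall x (1 / 16 * (1 - ‖x₀‖)), ‖y - x₀‖ ≤ 7 / 8 * (1 - ‖x₀‖) := by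
    intro y hy
    rw [mem_closedBall_iff_norm] at hy
    rw [mem_ball_iff_norm] at hx
    have := norm_sub_le_norm_sub_add_norm_sub y x x₀
    linarith
  have hball : closedBall x (1 / 16 * (1 - ‖x₀‖)) ⊆ ball 0 1 := fun y hy ↦
    hsub (by rw [mem_ball_iff_norm]; linarith [hnear y hy])
  have hC := norm_deriv_le_of_forall_mem_sphere_norm_le (f := fun y ↦ f y - f x₀)
    (C := growthConst * infDist (f x₀) (frontier (f '' ball 0 1)))
    (by positivity : 0 < 1 / 16 * (1 - ‖x₀‖)) ((hf.sub_const _).diffContOnCl_ball hball)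
    (fun z hz ↦ norm_sub_le_mul_infDist hΩo hΩ hne hR (hf.mono hsub)
      ((mapsTo_image f _).mono_left hsub) (hnear z (sphere_subset_closedBall hz)))
  rw [deriv_sub_const, le_div_iff₀ (by positivity)] at hC
  have hd := infDist_frontier_le hf hinj hΩo (mem_ball_zero_iff.2 hx₀)
  have hA := one_lt_growthConst
  have := mul_le_mul_of_nonneg_left hd (by linarith : 0 ≤ growthConst)
  have h3 : (1 - ‖x₀‖) * ‖deriv f x‖ ≤ (1 - ‖x₀‖) * (32 * growthConst * ‖deriv f x₀‖) := by
    linarith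
  exact le_of_mul_le_mul_left h3 hR

theorem norm_dslope_le (hf : DifferentiableOn ℂ f (ball 0 1))
    (hinj : InjOn f (ball 0 1)) (hΩo : IsOpen (f '' ball 0 1))
    (hΩ : IsSimplyConnected (f '' ball 0 1)) (hne : f '' ball 0 1 ≠ univ) (hx₀ : ‖x₀‖ < 1)
    {x y : ℂ} (hx : x ∈ ball x₀ (3 / 4 * (1 - ‖x₀‖))) (hy : y ∈ ball x₀ (3 / 4 * (1 - ‖x₀‖))) :
    ‖dslope f y x‖ ≤ 32 * growthConst * ‖deriv f x₀‖ := by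
  rcases eq_or_ne x y with rfl | hxy
  · rw [dslope_same]
    exact norm_deriv_le_mul_norm_deriv hf hinj hΩo hΩ hne hx₀ hx
  · have h := (convex_ball x₀ (3 / 4 * (1 - ‖x₀‖))).norm_image_sub_le_of_norm_deriv_le
      (fun z hz ↦ hf.differentiableAt (isOpen_ball.mem_nhds
        (mem_ball_zero_of_mem_ball hx₀ (by norm_num) hz)))
      (fun z hz ↦ norm_deriv_le_mul_norm_deriv hf hinj hΩo hΩ hne hx₀ hz) hy hx
    rw [norm_sub_eq_norm_dslope_mul] at h
    exact le_of_mul_le_mul_right h (norm_pos_iff.2 (sub_ne_zero.2 hxy))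

theorem norm_deriv_le_mul_norm_dslope (hf : DifferentiableOn ℂ f (ball 0 1))
    (hinj : InjOn f (ball 0 1)) (hΩo : IsOpen (f '' ball 0 1))
    (hΩ : IsSimplyConnected (f '' ball 0 1)) (hne : f '' ball 0 1 ≠ univ) (hx₀ : ‖x₀‖ < 1)
    {x y : ℂ} (hx : x ∈ ball x₀ (1 / 2 * (1 - ‖x₀‖))) (hy : y ∈ ball x₀ (1 / 2 * (1 - ‖x₀‖))) :
    ‖deriv f x₀‖ ≤ (32 * growthConst) ^ 224 * ‖dslope f y x‖ := by
  set B := 32 * growthConst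
  have hB : 1 < B := by have := one_lt_growthConst; simp only [B]; linarith
  have hR : 0 < 1 - ‖x₀‖ := by linarith
  have hr : 0 < 3 / 4 * (1 - ‖x₀‖) := by positivity
  have hsub : ball x₀ (3 / 4 * (1 - ‖x₀‖)) ⊆ ball 0 1 := fun z hz ↦
    mem_ball_zero_of_mem_ball hx₀ (by norm_num) hz
  have hsub' : ball x₀ (1 / 2 * (1 - ‖x₀‖)) ⊆ ball x₀ (3 / 4 * (1 - ‖x₀‖)) :=
    ball_subset_ball (by linarith)
  have hclose : ∀ z ∈ ball x₀ (1 / 2 * (1 - ‖x₀‖)),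
      ‖z - x₀‖ ≤ 7 / 8 * (3 / 4 * (1 - ‖x₀‖)) := by
    intro z hz
    rw [mem_ball_iff_norm] at hz
    linarith
  have hx₀r := mem_ball_self (x := x₀) hr
  have hdiff : ∀ z ∈ ball x₀ (3 / 4 * (1 - ‖x₀‖)),
      DifferentiableOn ℂ (dslope f z) (ball x₀ (3 / 4 * (1 - ‖x₀‖))) := fun z hz ↦
    (differentiableOn_dslope (isOpen_ball.mem_nhds hz)).2 (hf.mono hsub)
  have hnz : ∀ z ∈ ball x₀ (3 / 4 * (1 - ‖x₀‖)), ∀ t ∈ ball x₀ (3 / 4 * (1 - ‖x₀‖)),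
      dslope f z t ≠ 0 := fun z hz t ht ↦
    dslope_ne_zero_of_injOn isOpen_ball hf hinj (hsub ht) (hsub hz)
  have h1 : ‖deriv f x₀‖ ≤ B ^ 14 * ‖dslope f y x₀‖ := by
    have := norm_center_le_of_forall_ne_zero hr hB (hdiff x₀ hx₀r) (hnz x₀ hx₀r)
      (fun z hz ↦ by
        rw [dslope_same]; exact norm_dslope_le hf hinj hΩo hΩ hne hx₀ hz hx₀r) (hclose y hy)
    rwa [dslope_same, dslope_comm] at this
  have h2 : ‖dslope f y x₀‖ ≤ (B ^ 15) ^ 14 * ‖dslope f y x‖ :=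
    norm_center_le_of_forall_ne_zero hr (one_lt_pow₀ hB (by norm_num)) (hdiff y (hsub' hy))
      (hnz y (hsub' hy)) (fun z hz ↦ by
        refine (norm_dslope_le hf hinj hΩo hΩ hne hx₀ hz (hsub' hy)).trans ?_
        rw [pow_succ' B 14, mul_assoc B (B ^ 14)]
        exact mul_le_mul_of_nonneg_left h1 (zero_le_one.trans hB.le)) (hclose x hx)
  calc ‖deriv f x₀‖ ≤ B ^ 14 * ((B ^ 15) ^ 14 * ‖dslope f y x‖) := by
        refine h1.trans (mul_le_mul_of_nonneg_left h2 (by positivity))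
    _ = B ^ 224 * ‖dslope f y x‖ := by rw [← mul_assoc, ← pow_mul, ← pow_add]

end Distortion

theorem dist_mkP2_bounds (x y : ℂ) (s t : ℝ) :
    ‖x - y‖ ≤ dist (mkP2 x s) (mkP2 y t) ∧ |s - t| ≤ dist (mkP2 x s) (mkP2 y t) ∧
      dist (mkP2 x s) (mkP2 y t) ≤ ‖x - y‖ + |s - t| := by
  have h : dist (mkP2 x s) (mkP2 y t) = √(‖x - y‖ ^ 2 + |s - t| ^ 2) := by
    rw [WithLp.prod_dist_eq_of_L2, dist_eq_norm, Real.dist_eq]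
    rfl
  have h1 := norm_nonneg (x - y)
  have h2 := abs_nonneg (s - t)
  rw [h]
  refine ⟨Real.le_sqrt_of_sq_le (by nlinarith), Real.le_sqrt_of_sq_le (by nlinarith), ?_⟩
  rw [Real.sqrt_le_left (by positivity)]
  nlinarith

/-- The real-variable part of the estimate: `p` and `q` are the horizontal distances in the source
and in the target, `r₁, r₂` and `d₁, d₂` the distances to the respective boundaries. -/
theorem vertical_estimates {K N p q r₁ r₂ d₁ d₂ z₁ z₂ : ℝ} (hK : 1 ≤ K) (hN : 0 < N)
    (hr₁ : 0 < r₁) (hr₂ : 0 < r₂) (hr : r₂ ≤ 3 * r₁) (hrp : |r₁ - r₂| ≤ p)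
    (hdq : |d₁ - d₂| ≤ q) (hp : N * p ≤ K * q) (hq : q ≤ K * N * p) (hd₁ : d₁ ≤ K * N * r₁)
    (hd₂ : d₂ ≤ K * N * r₂) (hd₁0 : r₁ * N ≤ K * d₁) (hd₂0 : 0 ≤ d₂) (hz₂ : |z₂| < r₂) :
    |d₁ / r₁ * z₁ - d₂ / r₂ * z₂| ≤ K * N * |z₁ - z₂| + 6 * K * N * p ∧
      N * |z₁ - z₂| ≤ K * |d₁ / r₁ * z₁ - d₂ / r₂ * z₂| + 6 * K ^ 3 * q := by
  have hK0 : 0 < K := by linarith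
  have hp0 : 0 ≤ p := (abs_nonneg _).trans hrp
  have hD₁ : d₁ / r₁ ≤ K * N := (div_le_iff₀ hr₁).2 hd₁
  have hD₁' : N ≤ K * (d₁ / r₁) := by
    rw [mul_div_assoc', le_div_iff₀ hr₁]; linarith
  have hD₂ : d₂ / r₂ ≤ K * N := (div_le_iff₀ hr₂).2 hd₂
  have hD₂0 : 0 ≤ d₂ / r₂ := by positivity
  have hD₁0 : 0 < d₁ / r₁ := by
    by_contra! h
    nlinarith
  have hz : |z₂ / r₁| ≤ 3 := by
    rw [abs_div, abs_of_pos hr₁, div_le_iff₀ hr₁]; linarith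
  have hE : |(d₁ / r₁ - d₂ / r₂) * z₂| ≤ 6 * K * N * p := by
    have h1 : (d₁ / r₁ - d₂ / r₂) * z₂ = ((d₁ - d₂) - d₂ / r₂ * (r₁ - r₂)) * (z₂ / r₁) := by
      field_simp
      ring
    have h2 : |(d₁ - d₂) - d₂ / r₂ * (r₁ - r₂)| ≤ 2 * K * N * p := by
      refine (abs_sub _ _).trans ?_
      rw [abs_mul, abs_of_nonneg hD₂0]
      have := mul_le_mul hD₂ hrp (abs_nonneg _) (by positivity)
      linarith
    rw [h1, abs_mul]
    have := mul_le_mul h2 hz (abs_nonneg _) (by positivity)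
    linarith
  have hsplit : d₁ / r₁ * z₁ - d₂ / r₂ * z₂ = d₁ / r₁ * (z₁ - z₂) + (d₁ / r₁ - d₂ / r₂) * z₂ := by
    ring
  have habs : |d₁ / r₁ * (z₁ - z₂)| = d₁ / r₁ * |z₁ - z₂| := by rw [abs_mul, abs_of_pos hD₁0]
  constructor
  · rw [hsplit]
    refine (abs_add_le _ _).trans ?_
    rw [habs]
    have := mul_le_mul_of_nonneg_right hD₁ (abs_nonneg (z₁ - z₂))
    linarith
  · have h1 : d₁ / r₁ * |z₁ - z₂| ≤ |d₁ / r₁ * z₁ - d₂ / r₂ * z₂| + 6 * K * N * p := by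
      rw [← habs]
      have : d₁ / r₁ * (z₁ - z₂) =
        (d₁ / r₁ * z₁ - d₂ / r₂ * z₂) - (d₁ / r₁ - d₂ / r₂) * z₂ := by ring
      rw [this]
      refine (abs_sub _ _).trans ?_
      linarith
    calc N * |z₁ - z₂| ≤ K * (d₁ / r₁) * |z₁ - z₂| :=
          mul_le_mul_of_nonneg_right hD₁' (abs_nonneg _)
      _ = K * (d₁ / r₁ * |z₁ - z₂|) := by ring
      _ ≤ K * (|d₁ / r₁ * z₁ - d₂ / r₂ * z₂| + 6 * K * N * p) :=
          mul_le_mul_of_nonneg_left h1 hK0.le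
      _ = K * |d₁ / r₁ * z₁ - d₂ / r₂ * z₂| + 6 * K ^ 2 * (N * p) := by ring
      _ ≤ K * |d₁ / r₁ * z₁ - d₂ / r₂ * z₂| + 6 * K ^ 2 * (K * q) := by gcongr
      _ = _ := by ring

end Auxiliary

/-- The local bi-Lipschitz estimate for the cone map F(x,z) = (f(x), D_x·z), where
D_x = dist(f(x),∂Ω)/(1−|x|): there is an absolute constant C > 1 such that
C⁻¹|f′(x₀)| |p₁−p₂| ≤ |F(p₁)−F(p₂)| ≤ C|f′(x₀)| |p₁−p₂| for points p᷈ᵢ = (xᵢ,zᵢ) of the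
double circular cone with xᵢ ∈ B(x₀,(1−|x₀|)/2). -/
theorem stmt16 : ∃ C : ℝ, 1 < C ∧
    ∀ (Ω : Set ℂ) (f : ℂ → ℂ), IsOpen Ω → IsConnected Ω → Ω ≠ univ →
      SimplyConnectedSpace Ω →
      DifferentiableOn ℂ f (ball 0 1) → InjOn f (ball 0 1) → f '' (ball 0 1) = Ω →
      ∀ x₀ ∈ ball (0:ℂ) 1, ∀ (x₁ x₂ : ℂ) (z₁ z₂ : ℝ),
        x₁ ∈ ball x₀ ((1 - ‖x₀‖) / 2) → x₂ ∈ ball x₀ ((1 - ‖x₀‖) / 2) →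
        |z₁| < 1 - ‖x₁‖ → |z₂| < 1 - ‖x₂‖ →
        C⁻¹ * ‖deriv f x₀‖ * dist (mkP2 x₁ z₁) (mkP2 x₂ z₂) ≤
            dist (mkP2 (f x₁) (infDist (f x₁) (frontier Ω) / (1 - ‖x₁‖) * z₁))
              (mkP2 (f x₂) (infDist (f x₂) (frontier Ω) / (1 - ‖x₂‖) * z₂)) ∧
          dist (mkP2 (f x₁) (infDist (f x₁) (frontier Ω) / (1 - ‖x₁‖) * z₁))
              (mkP2 (f x₂) (infDist (f x₂) (frontier Ω) / (1 - ‖x₂‖) * z₂)) ≤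
            C * ‖deriv f x₀‖ * dist (mkP2 x₁ z₁) (mkP2 x₂ z₂) := by
  set B := 32 * growthConst
  have hB : 1 < B := by have := one_lt_growthConst; simp only [B]; linarith
  set K := 160 * B ^ 224
  have hB224 : B ≤ B ^ 224 := le_self_pow₀ hB.le (by norm_num)
  have hKB : 160 * B ≤ K := mul_le_mul_of_nonneg_left hB224 (by norm_num)
  have hK : 1 ≤ K := by linarith
  have hK3 : K ≤ K ^ 3 := le_self_pow₀ hK (by norm_num)
  refine ⟨8 * K ^ 3, by linarith, ?_⟩
  rintro _ f hΩo - hne hΩ hf hinj rfl x₀ hx₀ x₁ x₂ z₁ z₂ hx₁ hx₂ hz₁ hz₂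
  replace hΩ : IsSimplyConnected (f '' ball 0 1) := hΩ
  have hx₀' := mem_ball_zero_iff.1 hx₀
  rw [show (1 - ‖x₀‖) / 2 = 1 / 2 * (1 - ‖x₀‖) by ring] at hx₁ hx₂
  set N := ‖deriv f x₀‖
  have hN : 0 < N := norm_pos_iff.2 (deriv_ne_zero_of_injOn (isOpen_ball.mem_nhds hx₀) hf hinj)
  have hhalf : ball x₀ (1 / 2 * (1 - ‖x₀‖)) ⊆ ball x₀ (3 / 4 * (1 - ‖x₀‖)) :=
    ball_subset_ball (by linarith)
  have hx₁D := mem_ball_zero_of_mem_ball hx₀' (by norm_num) hx₁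
  have hx₂D := mem_ball_zero_of_mem_ball hx₀' (by norm_num) hx₂
  have hr₁ : 0 < 1 - ‖x₁‖ := by linarith [mem_ball_zero_iff.1 hx₁D]
  have hr₂ : 0 < 1 - ‖x₂‖ := by linarith [mem_ball_zero_iff.1 hx₂D]
  have hr : 1 - ‖x₂‖ ≤ 3 * (1 - ‖x₁‖) := by
    rw [mem_ball_iff_norm] at hx₁ hx₂
    have h1 := norm_le_norm_add_norm_sub' x₁ x₀
    have h2 := norm_le_norm_add_norm_sub' x₀ x₂
    rw [norm_sub_rev] at h2
    linarith
  have hslope := norm_dslope_le hf hinj hΩo hΩ hne hx₀' (hhalf hx₁) (hhalf hx₂)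
  have hslope' := norm_deriv_le_mul_norm_dslope hf hinj hΩo hΩ hne hx₀' hx₁ hx₂
  have hupper : ∀ x ∈ ball x₀ (1 / 2 * (1 - ‖x₀‖)), x ∈ ball (0 : ℂ) 1 →
      infDist (f x) (frontier (f '' ball 0 1)) ≤ K * N * (1 - ‖x‖) := by
    intro x hx hxD
    have h1 := infDist_frontier_le hf hinj hΩo hxD
    have h2 := norm_deriv_le_mul_norm_deriv hf hinj hΩo hΩ hne hx₀' (hhalf hx)
    have h3 : 0 < 1 - ‖x‖ := by linarith [mem_ball_zero_iff.1 hxD]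
    calc _ ≤ 2 * (1 - ‖x‖) * (B * N) := h1.trans (by gcongr)
      _ = (2 * B) * N * (1 - ‖x‖) := by ring
      _ ≤ K * N * (1 - ‖x‖) := by gcongr; linarith
  have hlower : (1 - ‖x₁‖) * N ≤ K * infDist (f x₁) (frontier (f '' ball 0 1)) := by
    have hsub : ball x₁ (1 - ‖x₁‖) ⊆ ball 0 1 := fun y hy ↦
      mem_ball_zero_of_mem_ball (mem_ball_zero_iff.1 hx₁D) le_rfl (by simpa using hy)
    have h1 := mul_norm_deriv_le_infDist hΩo hΩ hne hr₁ (hf.mono hsub)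
      ((mapsTo_image f _).mono_left hsub)
    have h2 := norm_deriv_le_mul_norm_dslope hf hinj hΩo hΩ hne hx₀' hx₁ hx₁
    rw [dslope_same] at h2
    calc (1 - ‖x₁‖) * N ≤ (1 - ‖x₁‖) * (B ^ 224 * ‖deriv f x₁‖) := by gcongr
      _ = B ^ 224 * ((1 - ‖x₁‖) * ‖deriv f x₁‖) := by ring
      _ ≤ B ^ 224 * (160 * infDist (f x₁) (frontier (f '' ball 0 1))) := by gcongr
      _ = _ := by ring
  have hp : N * ‖x₁ - x₂‖ ≤ K * ‖f x₁ - f x₂‖ := by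
    rw [norm_sub_eq_norm_dslope_mul, ← mul_assoc]
    gcongr
    refine hslope'.trans ?_
    gcongr
    linarith
  have hq : ‖f x₁ - f x₂‖ ≤ K * N * ‖x₁ - x₂‖ := by
    rw [norm_sub_eq_norm_dslope_mul]
    gcongr
    refine hslope.trans ?_
    gcongr
    linarith
  obtain ⟨hv, hv'⟩ := vertical_estimates (z₁ := z₁) hK hN hr₁ hr₂ hr
    (by
      rw [sub_sub_sub_cancel_left, abs_sub_comm]
      exact abs_norm_sub_norm_le x₁ x₂)
    (by
      rw [← Real.dist_eq, ← dist_eq_norm]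
      exact (lipschitz_infDist_pt (frontier (f '' ball 0 1))).dist_le_mul _ _ |>.trans (by simp))
    hp hq (hupper x₁ hx₁ hx₁D) (hupper x₂ hx₂ hx₂D) hlower infDist_nonneg hz₂
  obtain ⟨hs₁, hs₂, hs₃⟩ := dist_mkP2_bounds x₁ x₂ z₁ z₂
  obtain ⟨ht₁, ht₂, ht₃⟩ := dist_mkP2_bounds (f x₁) (f x₂)
    (infDist (f x₁) (frontier (f '' ball 0 1)) / (1 - ‖x₁‖) * z₁)
    (infDist (f x₂) (frontier (f '' ball 0 1)) / (1 - ‖x₂‖) * z₂)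
  set S := dist (mkP2 x₁ z₁) (mkP2 x₂ z₂)
  set T := dist (mkP2 (f x₁) _) (mkP2 (f x₂) _)
  constructor
  · rw [mul_assoc, inv_mul_le_iff₀ (by positivity)]
    calc N * S ≤ N * ‖x₁ - x₂‖ + N * |z₁ - z₂| := by rw [← mul_add]; gcongr
      _ ≤ K * T + (K * T + 6 * K ^ 3 * T) :=
          add_le_add (hp.trans (by gcongr)) (hv'.trans (by gcongr))
      _ = 2 * K * T + 6 * K ^ 3 * T := by ring
      _ ≤ 2 * K ^ 3 * T + 6 * K ^ 3 * T := by gcongr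
      _ = 8 * K ^ 3 * T := by ring
  · calc T ≤ K * N * S + (K * N * S + 6 * K * N * S) :=
          ht₃.trans (add_le_add (hq.trans (by gcongr)) (hv.trans (by gcongr)))
      _ = 8 * K * N * S := by ring
      _ ≤ 8 * K ^ 3 * N * S := by gcongr
end
end
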